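/- arXiv:math/0512619 — 10 statements merged into one kernel-verified Lean document; each statement's English description precedes it below -/
import Mathlib

section
/- Let r ≥ 2 and let N be an additive subgroup of ℚ^r containing ℤ^r that satisfies the Gorenstein condition. Suppose the junior simplex admits a basic triangulation with respect to N. Then the Hilbert basis of the positive orthant with respect to N equals the set of junior points of N; that is, a nonzero element x ∈ N with all coordinates ≥ 0 is additively irreducible if and only if its coordinate sum equals 1. -/
/-- The `i`-th standard basis vector of `ℚ^r`. -/
def stdVec (r : ℕ) (i : Fin r) : Fin r → ℚ := fun j => if j = i then 1 else 0

/-- The integer lattice `ℤ^r` inside `ℚ^r`, as an additive subgroup. -/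
def intLattice (r : ℕ) : AddSubgroup (Fin r → ℚ) where
  carrier := {x | ∀ i, ∃ m : ℤ, x i = (m : ℚ)}
  add_mem' := by
    intro a b ha hb i
    obtain ⟨m, hm⟩ := ha i
    obtain ⟨n, hn⟩ := hb i
    exact ⟨m + n, by simp [hm, hn]⟩
  zero_mem' := fun i => ⟨0, by simp⟩
  neg_mem' := by
    intro a ha i
    obtain ⟨m, hm⟩ := ha i
    exact ⟨-m, by simp [hm]⟩

/-- The Gorenstein condition on a lattice `N` with `ℤ^r ⊆ N ⊆ ℚ^r`: every nonzero
element of `N` with nonnegative coordinates has coordinate sum at least `1`. -/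
def Gorenstein {r : ℕ} (N : AddSubgroup (Fin r → ℚ)) : Prop :=
  ∀ x ∈ N, (∀ i, 0 ≤ x i) → x ≠ 0 → 1 ≤ ∑ i, x i

/-- The junior points of `N`: points of `N` with nonnegative coordinates and
coordinate sum `1`. -/
def juniorPoints {r : ℕ} (N : AddSubgroup (Fin r → ℚ)) : Set (Fin r → ℚ) :=
  {x | x ∈ N ∧ (∀ i, 0 ≤ x i) ∧ ∑ i, x i = 1}

/-- The junior simplex `conv{e_1, …, e_r}`. -/
def juniorSimplex (r : ℕ) : Set (Fin r → ℚ) :=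
  convexHull ℚ (Set.range (stdVec r))

/-- A basic triangulation of the junior simplex w.r.t. `N`: a finite family of
`r`-element subsets of the junior points, each of which is a `ℤ`-basis of `N`,
whose convex hulls cover the junior simplex and intersect along common faces. -/
def IsBasicTriangulation {r : ℕ} (N : AddSubgroup (Fin r → ℚ))
    (T : Finset (Finset (Fin r → ℚ))) : Prop :=
  (∀ s ∈ T, s.card = r ∧ (s : Set (Fin r → ℚ)) ⊆ juniorPoints N ∧
      LinearIndependent ℚ (fun x : {y : Fin r → ℚ // y ∈ s} => x.1) ∧
      AddSubgroup.closure (s : Set (Fin r → ℚ)) = N) ∧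
  (juniorSimplex r ⊆ ⋃ s ∈ T, convexHull ℚ (s : Set (Fin r → ℚ))) ∧
  (∀ s ∈ T, ∀ t ∈ T,
    convexHull ℚ (s : Set (Fin r → ℚ)) ∩ convexHull ℚ (t : Set (Fin r → ℚ)) =
      convexHull ℚ ((s ∩ t : Finset (Fin r → ℚ)) : Set (Fin r → ℚ)))

/-- A nonnegative vector of coordinate sum `1` lies in the junior simplex. -/
theorem mem_juniorSimplex {r : ℕ} {x : Fin r → ℚ} (hx : ∀ i, 0 ≤ x i) (hsum : ∑ i, x i = 1) :
    x ∈ juniorSimplex r := by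
  have hrepr : x = ∑ i, x i • stdVec r i := by
    ext j
    simp [Finset.sum_apply, stdVec]
  rw [hrepr]
  exact (convex_convexHull ℚ _).sum_mem (fun i _ => hx i) hsum
    fun i _ => subset_convexHull ℚ _ ⟨i, rfl⟩

/-- If `s` is `ℚ`-linearly independent, then an element of the group generated by `s` having a
positive multiple in `conv(s)` is a combination of `s` with nonnegative integer coefficients. -/
theorem exists_nonneg_int_combination {V : Type*} [AddCommGroup V] [Module ℚ V] {s : Finset V}
    (hs : LinearIndepOn ℚ id (s : Set V)) {x : V} (hx : x ∈ AddSubgroup.closure (s : Set V))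
    {c : ℚ} (hc : 0 < c) (hconv : c⁻¹ • x ∈ convexHull ℚ (s : Set V)) :
    ∃ n : V → ℤ, (∀ v ∈ s, 0 ≤ n v) ∧ ∑ v ∈ s, n v • v = x := by
  obtain ⟨w, hw, -, hwx⟩ := Finset.mem_convexHull'.1 hconv
  rw [← Submodule.span_int_eq_addSubgroupClosure, Submodule.mem_toAddSubgroup,
    Submodule.mem_span_finset] at hx
  obtain ⟨n, -, hn⟩ := hx
  refine ⟨n, fun v hv => ?_, hn⟩
  have hzero : ∑ v ∈ s, ((n v : ℚ) - c * w v) • id v = 0 := by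
    simp only [id, sub_smul, Finset.sum_sub_distrib, mul_smul, ← Finset.smul_sum, hwx,
      smul_inv_smul₀ hc.ne', Int.cast_smul_eq_zsmul, hn, sub_self]
  have hcoeff := linearIndepOn_finset_iff.1 hs _ hzero v hv
  have hcw := mul_nonneg hc.le (hw v hv)
  exact_mod_cast (by linarith : (0 : ℚ) ≤ n v)

/-- **First necessary existence condition.** If the junior simplex of a Gorenstein
lattice `N ⊇ ℤ^r` admits a basic triangulation, then the Hilbert basis of the positive
orthant w.r.t. `N` consists exactly of the junior points: a nonzero element of `N` with
nonnegative coordinates is additively irreducible iff its coordinate sum is `1`. -/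
theorem hilbertBasis_eq_juniorPoints
    (r : ℕ) (hr : 2 ≤ r) (N : AddSubgroup (Fin r → ℚ))
    (hZ : intLattice r ≤ N) (hGor : Gorenstein N)
    (T : Finset (Finset (Fin r → ℚ))) (hT : IsBasicTriangulation N T) :
    ∀ x ∈ N, (∀ i, 0 ≤ x i) → x ≠ 0 →
      ((¬ ∃ y z, y ∈ N ∧ z ∈ N ∧ (∀ i, 0 ≤ y i) ∧ (∀ i, 0 ≤ z i) ∧
          y ≠ 0 ∧ z ≠ 0 ∧ x = y + z) ↔ ∑ i, x i = 1) := by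
  intro x hxN hx hx0
  constructor
  · intro hirr
    have hc : 0 < ∑ i, x i := zero_lt_one.trans_le (hGor x hxN hx hx0)
    have hmem : (∑ i, x i)⁻¹ • x ∈ juniorSimplex r := by
      refine mem_juniorSimplex (fun i => mul_nonneg (inv_nonneg.2 hc.le) (hx i)) ?_
      simp only [Pi.smul_apply, smul_eq_mul, ← Finset.mul_sum]
      exact inv_mul_cancel₀ hc.ne'
    obtain ⟨s, hsT, hxs⟩ := Set.mem_iUnion₂.1 (hT.2.1 hmem)
    obtain ⟨-, hjun, hind, hgen⟩ := hT.1 s hsT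
    obtain ⟨n, hn, hnx⟩ := exists_nonneg_int_combination hind (hgen ▸ hxN) hc hxs
    obtain ⟨v, hv, hnv⟩ : ∃ v ∈ s, n v • v ≠ 0 :=
      Finset.exists_ne_zero_of_sum_ne_zero (hnx ▸ hx0)
    have hpos : 1 ≤ n v := (hn v hv).lt_of_ne fun h => hnv (by rw [← h, zero_smul])
    obtain ⟨hvN, hv_nonneg, hv_sum⟩ := hjun hv
    have hv0 : v ≠ 0 := fun h => hnv (by rw [h, smul_zero])
    have hrest : x - v = (n v - 1) • v + ∑ u ∈ s.erase v, n u • u := by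
      rw [← hnx, ← Finset.add_sum_erase s _ hv, sub_smul, one_smul]
      abel
    have hrest_nonneg : 0 ≤ x - v := by
      rw [hrest]
      refine add_nonneg (zsmul_nonneg hv_nonneg (sub_nonneg.2 hpos))
        (Finset.sum_nonneg fun u hu => ?_)
      have hus := Finset.mem_of_mem_erase hu
      exact zsmul_nonneg (hjun hus).2.1 (hn u hus)
    have hxv : x - v = 0 := by
      by_contra hne
      exact hirr ⟨v, x - v, hvN, N.sub_mem hxN hvN, hv_nonneg, hrest_nonneg, hv0, hne,
        (add_sub_cancel v x).symm⟩
    rw [sub_eq_zero.1 hxv, hv_sum]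
  · rintro hsum ⟨y, z, hyN, hzN, hy, hz, hy0, hz0, rfl⟩
    have hy1 := hGor y hyN hy hy0
    have hz1 := hGor z hzN hz hz0
    simp only [Pi.add_apply, Finset.sum_add_distrib] at hsum
    linarith
end

section
/- Let l ≥ 2 and α : Fin 4 → ℕ satisfy the Gorenstein condition l ∣ α_1+α_2+α_3+α_4 and the smallness condition gcd(l, α_j : j ≠ i) = 1 for every i. Let N = ℤ^4 + ℤ·(α_1/l, α_2/l, α_3/l, α_4/l) ⊆ ℚ^4 and let b be the number of junior points of N. If the junior simplex admits a basic triangulation with respect to N, then 2l ≤ b(b−3) − Σ_{i=1}^{4} gcd(α_i, l) − 2·Σ_{1≤i<j≤4} gcd(α_i, α_j, l) + 14. -/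
lemma card_filter_mul_natCast_eq_zero (l a : ℕ) [NeZero l] :
    (Finset.univ.filter fun k : ZMod l => k * (a : ZMod l) = 0).card = Nat.gcd a l := by
  have h := IsAddCyclic.card_nsmulAddMonoidHom_ker (ZMod l) a
  rw [Nat.card_zmod, Nat.gcd_comm] at h
  rw [← h, Nat.card_eq_fintype_card, Fintype.card_subtype]
  congr 1
  ext k
  simp [AddMonoidHom.mem_ker, mul_comm]

/-- The numerator, over the denominator `l`, of the `i`-th coordinate of the representative
in `[0, 1)^4` of `k • (α / l)` modulo `ℤ^4`. -/
def residue (l : ℕ) (α : Fin 4 → ℕ) (k : ZMod l) (i : Fin 4) : ℕ := (k * (α i : ZMod l)).val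

/-- The coordinate sum of the representative in `[0, 1)^4` of `k • (α / l)` modulo `ℤ^4`. -/
def age (l : ℕ) (α : Fin 4 → ℕ) (k : ZMod l) : ℕ := (∑ i, residue l α k i) / l

section Age

variable {l : ℕ} {α : Fin 4 → ℕ}

lemma residue_eq_zero_iff {k : ZMod l} {i : Fin 4} :
    residue l α k i = 0 ↔ k * (α i : ZMod l) = 0 := ZMod.val_eq_zero _

@[simp] lemma residue_zero (i : Fin 4) : residue l α 0 i = 0 := by simp [residue]

variable [NeZero l]

lemma residue_lt (k : ZMod l) (i : Fin 4) : residue l α k i < l := ZMod.val_lt _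

lemma residue_add_residue_neg (k : ZMod l) (i : Fin 4) :
    residue l α k i + residue l α (-k) i + (if k * (α i : ZMod l) = 0 then l else 0) = l := by
  have h := ZMod.val_lt (k * (α i : ZMod l))
  unfold residue
  rw [neg_mul, ZMod.neg_val]
  split_ifs with h0
  · simp [h0]
  · omega

lemma sum_residue (hGor : l ∣ ∑ i, α i) (k : ZMod l) :
    ∑ i, residue l α k i = l * age l α k := by
  refine (Nat.mul_div_cancel' ?_).symm
  rw [← ZMod.natCast_eq_zero_iff] at hGor ⊢
  push_cast at hGor ⊢
  simp only [residue, ZMod.natCast_val, ZMod.cast_id', id_eq]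
  rw [← Finset.mul_sum, hGor, mul_zero]

lemma age_lt_four (hGor : l ∣ ∑ i, α i) (k : ZMod l) : age l α k < 4 := by
  have h : ∑ i, residue l α k i < ∑ _i : Fin 4, l :=
    Finset.sum_lt_sum_of_nonempty Finset.univ_nonempty fun i _ => residue_lt k i
  rw [sum_residue hGor] at h
  simp only [Finset.sum_const, Finset.card_univ, Fintype.card_fin, smul_eq_mul] at h
  exact Nat.lt_of_mul_lt_mul_left (by linarith : l * age l α k < l * 4)

lemma eq_zero_of_forall_ne_mul_eq_zero
    (hsmall : ∀ i : Fin 4, Nat.gcd l (Finset.gcd (Finset.univ.erase i) α) = 1)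
    {k : ZMod l} (i : Fin 4) (h : ∀ j ≠ i, k * (α j : ZMod l) = 0) : k = 0 := by
  have h1 : l ∣ (Finset.univ.erase i).gcd fun j => k.val * α j := by
    refine Finset.dvd_gcd fun j hj => ?_
    rw [← ZMod.natCast_eq_zero_iff]
    push_cast
    simpa using h j (Finset.ne_of_mem_erase hj)
  rw [Finset.gcd_mul_left, normalize_eq] at h1
  have h2 := (Nat.Coprime.dvd_of_dvd_mul_right (hsmall i) h1)
  rw [← ZMod.val_eq_zero]
  exact Nat.eq_zero_of_dvd_of_lt h2 (ZMod.val_lt k)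

lemma age_eq_zero_iff (hGor : l ∣ ∑ i, α i)
    (hsmall : ∀ i : Fin 4, Nat.gcd l (Finset.gcd (Finset.univ.erase i) α) = 1) {k : ZMod l} :
    age l α k = 0 ↔ k = 0 := by
  refine ⟨fun h => ?_, fun h => by simp [h, age]⟩
  have h1 := sum_residue hGor k
  rw [h, mul_zero, Finset.sum_eq_zero_iff] at h1
  exact eq_zero_of_forall_ne_mul_eq_zero hsmall 0 fun j _ =>
    residue_eq_zero_iff.1 (h1 j (Finset.mem_univ j))

lemma residue_injective
    (hsmall : ∀ i : Fin 4, Nat.gcd l (Finset.gcd (Finset.univ.erase i) α) = 1) :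
    Function.Injective (residue l α) := by
  intro k k' h
  rw [← sub_eq_zero]
  refine eq_zero_of_forall_ne_mul_eq_zero hsmall 0 fun j _ => ?_
  rw [sub_mul, sub_eq_zero]
  exact ZMod.val_injective l (congrFun h j)

/-- Pairing `k` with `-k` evaluates the sum of all ages. -/
lemma two_mul_sum_age_add (hGor : l ∣ ∑ i, α i) :
    2 * ∑ k, age l α k + ∑ i, Nat.gcd (α i) l = 4 * l := by
  have hl : 0 < l := Nat.pos_of_ne_zero (NeZero.ne l)
  have hneg : ∑ k, age l α (-k) = ∑ k, age l α k :=
    Equiv.sum_comp (Equiv.neg (ZMod l)) (age l α)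
  have h (k : ZMod l) : age l α k + age l α (-k) +
      ∑ i, (if k * (α i : ZMod l) = 0 then 1 else 0) = 4 := by
    refine Nat.eq_of_mul_eq_mul_left hl ?_
    rw [mul_add, mul_add, ← sum_residue hGor, ← sum_residue hGor, Finset.mul_sum,
      ← Finset.sum_add_distrib, ← Finset.sum_add_distrib]
    simp only [mul_ite, mul_one, mul_zero, residue_add_residue_neg]
    simp [mul_comm]
  have hsum := Finset.sum_congr rfl fun k (_ : k ∈ Finset.univ) => h k
  rw [Finset.sum_add_distrib, Finset.sum_add_distrib, Finset.sum_comm, hneg] at hsum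
  simp only [← Finset.card_filter, card_filter_mul_natCast_eq_zero] at hsum
  simp only [Finset.sum_const, Finset.card_univ, ZMod.card, smul_eq_mul] at hsum
  omega

lemma card_filter_mul_eq_zero_and (a b : ℕ) :
    (Finset.univ.filter fun k : ZMod l => k * (a : ZMod l) = 0 ∧ k * (b : ZMod l) = 0).card =
      Nat.gcd (Nat.gcd a b) l := by
  rw [← card_filter_mul_natCast_eq_zero l (Nat.gcd a b)]
  congr 1
  ext k
  have h (c : ℕ) : k * (c : ZMod l) = 0 ↔ l ∣ k.val * c := by
    rw [← ZMod.natCast_eq_zero_iff]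
    push_cast
    simp
  simp only [Finset.mem_filter, Finset.mem_univ, true_and, h, ← Nat.gcd_mul_left, Nat.dvd_gcd_iff]

/-- The nonzero `k` whose representative in `[0, 1)^4` lies on an edge of the positive orthant. -/
def edgeIndex (l : ℕ) [NeZero l] (α : Fin 4 → ℕ) : Finset (ZMod l) :=
  Finset.univ.filter fun k => k ≠ 0 ∧ ∃ p : Fin 4 × Fin 4,
    p.1 < p.2 ∧ k * (α p.1 : ZMod l) = 0 ∧ k * (α p.2 : ZMod l) = 0

lemma sum_gcd_gcd_eq
    (hsmall : ∀ i : Fin 4, Nat.gcd l (Finset.gcd (Finset.univ.erase i) α) = 1) :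
    ∑ p ∈ Finset.univ.filter (fun p : Fin 4 × Fin 4 => p.1 < p.2),
      Nat.gcd (Nat.gcd (α p.1) (α p.2)) l = (edgeIndex l α).card + 6 := by
  set P := Finset.univ.filter (fun p : Fin 4 × Fin 4 => p.1 < p.2) with hP
  set Z : Fin 4 × Fin 4 → Finset (ZMod l) := fun p =>
    Finset.univ.filter fun k => k * (α p.1 : ZMod l) = 0 ∧ k * (α p.2 : ZMod l) = 0 with hZ
  have hE : edgeIndex l α = P.biUnion fun p => (Z p).erase 0 := by
    ext k
    simp only [edgeIndex, hP, hZ, Finset.mem_filter, Finset.mem_univ, true_and,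
      Finset.mem_biUnion, Finset.mem_erase]
    tauto
  have hdisj : (P : Set (Fin 4 × Fin 4)).PairwiseDisjoint fun p => (Z p).erase 0 := by
    intro p hp q hq hpq
    rw [Function.onFun, Finset.disjoint_left]
    intro k hkp hkq
    simp only [hP, hZ, Finset.coe_filter, Finset.mem_univ, true_and, Set.mem_ofPred_eq,
      Finset.mem_erase, Finset.mem_filter] at hp hq hkp hkq
    obtain ⟨hk, h1, h2⟩ := hkp
    obtain ⟨-, h3, h4⟩ := hkq
    obtain ⟨d, hd⟩ : ∃ d : Fin 4, ∀ j ≠ d, j = p.1 ∨ j = p.2 ∨ j = q.1 ∨ j = q.2 := by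
      clear hE h1 h2 h3 h4
      revert p q
      decide
    refine hk (eq_zero_of_forall_ne_mul_eq_zero hsmall d fun j hj => ?_)
    rcases hd j hj with h | h | h | h <;> rw [h] <;> assumption
  have hcard (p : Fin 4 × Fin 4) :
      Nat.gcd (Nat.gcd (α p.1) (α p.2)) l = ((Z p).erase 0).card + 1 := by
    rw [← card_filter_mul_eq_zero_and, Finset.card_erase_add_one]
    simp [hZ]
  rw [Finset.sum_congr rfl fun p _ => hcard p, Finset.sum_add_distrib,
    ← Finset.card_biUnion hdisj, ← hE]
  congr 1

end Age

/-- The lattice `ℤ^4 + ℤ • (α / l)`. -/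
def quotientLattice (l : ℕ) (α : Fin 4 → ℕ) : AddSubgroup (Fin 4 → ℚ) :=
  intLattice 4 ⊔ AddSubgroup.zmultiples (fun i : Fin 4 => (α i : ℚ) / l)

/-- The translate by `m ∈ ℕ^4` of the representative in `[0, 1)^4` of `k • (α / l)`. -/
def latticePoint (l : ℕ) (α : Fin 4 → ℕ) (p : Σ _ : ZMod l, Fin 4 → ℕ) : Fin 4 → ℚ :=
  fun i => (p.2 i : ℚ) + (residue l α p.1 i : ℚ) / l

/-- The indices of the lattice points in the positive orthant with coordinate sum `n`. -/
def levelIndex (l : ℕ) [NeZero l] (α : Fin 4 → ℕ) (n : ℕ) :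
    Finset (Σ _ : ZMod l, Fin 4 → ℕ) :=
  Finset.univ.sigma fun k =>
    if age l α k ≤ n then Finset.univ.piAntidiag (n - age l α k) else ∅

/-- The lattice points in the positive orthant with coordinate sum `n`. -/
def levelPoints (l : ℕ) [NeZero l] (α : Fin 4 → ℕ) (n : ℕ) : Finset (Fin 4 → ℚ) :=
  (levelIndex l α n).image (latticePoint l α)

section LatticePoints

variable {l : ℕ} {α : Fin 4 → ℕ}

lemma residue_div_nonneg (k : ZMod l) (i : Fin 4) : (0 : ℚ) ≤ (residue l α k i : ℚ) / l := by
  positivity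

lemma latticePoint_nonneg (p : Σ _ : ZMod l, Fin 4 → ℕ) (i : Fin 4) :
    0 ≤ latticePoint l α p i := by
  unfold latticePoint
  positivity

lemma mem_quotientLattice_iff {x : Fin 4 → ℚ} :
    x ∈ quotientLattice l α ↔ ∃ t : ℤ, ∀ i, ∃ z : ℤ, x i = z + t * ((α i : ℚ) / l) := by
  rw [quotientLattice, AddSubgroup.mem_sup]
  constructor
  · rintro ⟨y, hy, w, hw, rfl⟩
    obtain ⟨t, rfl⟩ := AddSubgroup.mem_zmultiples_iff.1 hw
    refine ⟨t, fun i => ?_⟩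
    obtain ⟨z, hz⟩ := hy i
    exact ⟨z, by simp [hz]⟩
  · rintro ⟨t, h⟩
    choose z hz using h
    refine ⟨fun i => z i, fun i => ⟨z i, rfl⟩, _, AddSubgroup.zsmul_mem_zmultiples _ t, ?_⟩
    ext i
    simp [hz i]

variable [NeZero l]

lemma mem_levelIndex {n : ℕ} {p : Σ _ : ZMod l, Fin 4 → ℕ} :
    p ∈ levelIndex l α n ↔ ∑ i, p.2 i + age l α p.1 = n := by
  rw [levelIndex, Finset.mem_sigma]
  split_ifs with h
  · simp only [Finset.mem_univ, Finset.mem_piAntidiag, true_and, implies_true, and_true]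
    change ∑ i, p.2 i = _ ↔ _
    omega
  · simp only [Finset.notMem_empty, and_false, false_iff]
    omega

lemma residue_div_lt_one (k : ZMod l) (i : Fin 4) : (residue l α k i : ℚ) / l < 1 := by
  have hl : (0 : ℚ) < l := Nat.cast_pos.2 (Nat.pos_of_ne_zero (NeZero.ne l))
  rw [div_lt_one hl]
  exact_mod_cast residue_lt k i

lemma sum_latticePoint (hGor : l ∣ ∑ i, α i) (p : Σ _ : ZMod l, Fin 4 → ℕ) :
    ∑ i, latticePoint l α p i = ((∑ i, p.2 i + age l α p.1 : ℕ) : ℚ) := by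
  have hl : (l : ℚ) ≠ 0 := Nat.cast_ne_zero.2 (NeZero.ne l)
  have h : (∑ i, (residue l α p.1 i : ℚ)) = l * age l α p.1 := by
    exact_mod_cast sum_residue hGor p.1
  simp only [latticePoint, Finset.sum_add_distrib, ← Finset.sum_div, h]
  push_cast
  field_simp

lemma latticePoint_injective
    (hsmall : ∀ i : Fin 4, Nat.gcd l (Finset.gcd (Finset.univ.erase i) α) = 1) :
    Function.Injective (latticePoint l α) := by
  have hl : (l : ℚ) ≠ 0 := Nat.cast_ne_zero.2 (NeZero.ne l)
  have hfloor (p : Σ _ : ZMod l, Fin 4 → ℕ) (i : Fin 4) : ⌊latticePoint l α p i⌋ = p.2 i := by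
    rw [Int.floor_eq_iff]
    have h1 := residue_div_nonneg (α := α) p.1 i
    have h2 := residue_div_lt_one (α := α) p.1 i
    simp only [latticePoint, Int.cast_natCast]
    constructor <;> linarith
  rintro ⟨k, m⟩ ⟨k', m'⟩ h
  have hm : m = m' := by
    ext i
    have := hfloor ⟨k, m⟩ i
    rw [h, hfloor] at this
    exact_mod_cast this.symm
  subst hm
  have hk : k = k' := by
    refine residue_injective hsmall (funext fun i => ?_)
    have hi := congrFun h i
    simp only [latticePoint, add_right_inj, div_left_inj' hl] at hi
    exact_mod_cast hi
  rw [hk]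

lemma exists_residue_intCast (t : ℤ) (i : Fin 4) :
    ∃ z : ℤ, (t : ℚ) * ((α i : ℚ) / l) = z + (residue l α (t : ZMod l) i : ℚ) / l := by
  have hl : (l : ℚ) ≠ 0 := Nat.cast_ne_zero.2 (NeZero.ne l)
  have h : ((residue l α (t : ZMod l) i : ℕ) : ℤ) = (t * α i) % l := by
    rw [residue, ← ZMod.val_intCast]
    push_cast
    rfl
  refine ⟨t * α i / l, ?_⟩
  have h2 : (l : ℚ) * ((t * α i / l : ℤ) : ℚ) + (residue l α (t : ZMod l) i : ℚ) = t * α i := by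
    exact_mod_cast h ▸ Int.mul_ediv_add_emod (t * α i) l
  field_simp
  linarith

lemma latticePoint_mem (p : Σ _ : ZMod l, Fin 4 → ℕ) :
    latticePoint l α p ∈ quotientLattice l α := by
  rw [mem_quotientLattice_iff]
  refine ⟨p.1.val, fun i => ?_⟩
  obtain ⟨z, hz⟩ := exists_residue_intCast (l := l) (α := α) p.1.val i
  refine ⟨p.2 i - z, ?_⟩
  rw [hz, Int.cast_natCast, ZMod.natCast_zmod_val, latticePoint]
  push_cast
  ring

lemma exists_latticePoint_eq {x : Fin 4 → ℚ} (hx : x ∈ quotientLattice l α)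
    (h0 : ∀ i, 0 ≤ x i) : ∃ p, latticePoint l α p = x := by
  obtain ⟨t, h⟩ := mem_quotientLattice_iff.1 hx
  have h' (i : Fin 4) : ∃ m : ℕ, x i = m + (residue l α (t : ZMod l) i : ℚ) / l := by
    obtain ⟨z, hz⟩ := h i
    obtain ⟨z', hz'⟩ := exists_residue_intCast (l := l) (α := α) t i
    have hpos : (0 : ℚ) < ((z + z' + 1 : ℤ) : ℚ) := by
      have := residue_div_lt_one (α := α) (t : ZMod l) i
      have := h0 i
      push_cast
      linarith
    have hnn : 0 ≤ z + z' := by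
      have := Int.cast_pos.1 hpos
      omega
    obtain ⟨m, hm⟩ := Int.eq_ofNat_of_zero_le hnn
    refine ⟨m, ?_⟩
    have : (m : ℚ) = z + z' := by exact_mod_cast hm.symm
    rw [this, hz, hz']
    ring
  choose m hm using h'
  exact ⟨⟨t, m⟩, funext fun i => (hm i).symm⟩

lemma mem_levelPoints (hGor : l ∣ ∑ i, α i) {n : ℕ} {x : Fin 4 → ℚ} :
    x ∈ levelPoints l α n ↔
      x ∈ quotientLattice l α ∧ (∀ i, 0 ≤ x i) ∧ ∑ i, x i = n := by
  rw [levelPoints, Finset.mem_image]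
  constructor
  · rintro ⟨p, hp, rfl⟩
    refine ⟨latticePoint_mem p, latticePoint_nonneg p, ?_⟩
    rw [sum_latticePoint hGor, mem_levelIndex.1 hp]
  · rintro ⟨hx, h0, hsum⟩
    obtain ⟨p, rfl⟩ := exists_latticePoint_eq hx h0
    refine ⟨p, mem_levelIndex.2 ?_, rfl⟩
    rw [sum_latticePoint hGor] at hsum
    exact_mod_cast hsum

lemma coe_levelPoints_one (hGor : l ∣ ∑ i, α i) :
    (levelPoints l α 1 : Set (Fin 4 → ℚ)) = juniorPoints (quotientLattice l α) := by
  ext x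
  rw [Finset.mem_coe, mem_levelPoints hGor]
  simp [juniorPoints]

lemma card_levelPoints
    (hsmall : ∀ i : Fin 4, Nat.gcd l (Finset.gcd (Finset.univ.erase i) α) = 1) (n : ℕ) :
    (levelPoints l α n).card =
      ∑ k, if age l α k ≤ n then Nat.choose (n - age l α k + 3) 3 else 0 := by
  have hcard (m : ℕ) : ((Finset.univ : Finset (Fin 4)).piAntidiag m).card = (m + 3).choose 3 := by
    have h := Finset.card_finsuppAntidiag_nat_eq_choose (s := (Finset.univ : Finset (Fin 4))) m
    rw [Finset.finsuppAntidiag, Finset.card_map, Finset.card_attach] at h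
    rw [h, Finset.card_univ, Fintype.card_fin, show 4 + m - 1 = m + 3 by omega,
      Nat.choose_symm_add]
  rw [levelPoints, Finset.card_image_of_injective _ (latticePoint_injective hsmall), levelIndex,
    Finset.card_sigma]
  refine Finset.sum_congr rfl fun k _ => ?_
  split_ifs
  · exact hcard _
  · rfl

end LatticePoints

section Triangulation

variable {r : ℕ}

lemma inv_sum_smul_mem_juniorSimplex {x : Fin r → ℚ} (h0 : ∀ i, 0 ≤ x i) (hpos : 0 < ∑ i, x i) :
    (∑ i, x i)⁻¹ • x ∈ juniorSimplex r := by
  have h : juniorSimplex r = stdSimplex ℚ (Fin r) := by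
    rw [← convexHull_basis_eq_stdSimplex, juniorSimplex]
    congr 2
    ext i j
    simp [stdVec, eq_comm]
  rw [h]
  refine ⟨fun i => ?_, ?_⟩
  · exact mul_nonneg (inv_nonneg.2 hpos.le) (h0 i)
  · simp only [Pi.smul_apply, smul_eq_mul, ← Finset.mul_sum]
    exact inv_mul_cancel₀ hpos.ne'

lemma exists_intCast_sum_eq_of_mem_closure {s : Finset (Fin r → ℚ)} {x : Fin r → ℚ}
    (hx : x ∈ AddSubgroup.closure (s : Set (Fin r → ℚ))) :
    ∃ a : (Fin r → ℚ) → ℤ, ∑ y ∈ s, (a y : ℚ) • y = x := by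
  rw [← Submodule.span_int_eq_addSubgroupClosure, Submodule.mem_toAddSubgroup,
    Submodule.mem_span_finset] at hx
  obtain ⟨a, -, ha⟩ := hx
  exact ⟨a, by simpa only [Int.cast_smul_eq_zsmul] using ha⟩

lemma IsBasicTriangulation.exists_natCast_sum_eq {N : AddSubgroup (Fin r → ℚ)}
    {T : Finset (Finset (Fin r → ℚ))} (hT : IsBasicTriangulation N T) {x : Fin r → ℚ}
    (hx : x ∈ N) (h0 : ∀ i, 0 ≤ x i) (hpos : 0 < ∑ i, x i) :
    ∃ s ∈ T, ∃ a : (Fin r → ℚ) → ℕ, ∑ y ∈ s, (a y : ℚ) • y = x := by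
  obtain ⟨hbasis, hcover, -⟩ := hT
  obtain ⟨s, hs, hxs⟩ := Set.mem_iUnion₂.1 (hcover (inv_sum_smul_mem_juniorSimplex h0 hpos))
  obtain ⟨-, -, hli, hgen⟩ := hbasis s hs
  obtain ⟨w, hw0, -, hw⟩ := Finset.mem_convexHull'.1 hxs
  obtain ⟨a, ha⟩ := exists_intCast_sum_eq_of_mem_closure (s := s) (hgen ▸ hx)
  have hli' : LinearIndepOn ℚ id (s : Set (Fin r → ℚ)) := hli
  rw [linearIndepOn_finset_iff] at hli'
  have hcoef (y) (hy : y ∈ s) : (a y : ℚ) = (∑ i, x i) * w y := by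
    rw [← sub_eq_zero]
    refine hli' (fun y => (a y : ℚ) - (∑ i, x i) * w y) ?_ y hy
    simp only [id_eq, sub_smul, mul_smul, Finset.sum_sub_distrib, ← Finset.smul_sum]
    rw [ha, hw, smul_inv_smul₀ hpos.ne', sub_self]
  refine ⟨s, hs, fun y => (a y).toNat, ?_⟩
  rw [← ha]
  refine Finset.sum_congr rfl fun y hy => ?_
  have h : 0 ≤ a y := by
    have : (0 : ℚ) ≤ a y := hcoef y hy ▸ mul_nonneg hpos.le (hw0 y hy)
    exact_mod_cast this
  congr 1
  exact_mod_cast Int.toNat_of_nonneg h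

/-- Every nonzero lattice point of the positive orthant dominates a junior point. -/
lemma IsBasicTriangulation.exists_mem_juniorPoints_le {N : AddSubgroup (Fin r → ℚ)}
    {T : Finset (Finset (Fin r → ℚ))} (hT : IsBasicTriangulation N T) {x : Fin r → ℚ}
    (hx : x ∈ N) (h0 : ∀ i, 0 ≤ x i) (hpos : 0 < ∑ i, x i) :
    ∃ u ∈ juniorPoints N, ∀ i, u i ≤ x i := by
  obtain ⟨s, hs, a, ha⟩ := hT.exists_natCast_sum_eq hx h0 hpos
  have hjun := (hT.1 s hs).2.1
  obtain ⟨u, hu, hau⟩ : ∃ u ∈ s, a u ≠ 0 := by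
    by_contra! h
    rw [Finset.sum_eq_zero fun y hy => by rw [h y hy, Nat.cast_zero, zero_smul]] at ha
    simp [← ha] at hpos
  refine ⟨u, hjun hu, fun i => ?_⟩
  have hnn (y) (hy : y ∈ s) : 0 ≤ (a y : ℚ) * y i :=
    mul_nonneg (Nat.cast_nonneg _) ((hjun hy).2.1 i)
  have h1 : (1 : ℚ) ≤ a u := by exact_mod_cast Nat.one_le_iff_ne_zero.2 hau
  calc u i ≤ a u * u i := le_mul_of_one_le_left ((hjun hu).2.1 i) h1
    _ ≤ ∑ y ∈ s, (a y : ℚ) * y i := Finset.single_le_sum hnn hu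
    _ = x i := by simp [← ha]

lemma stdVec_mem_juniorPoints {N : AddSubgroup (Fin r → ℚ)} (hN : intLattice r ≤ N) (i : Fin r) :
    stdVec r i ∈ juniorPoints N := by
  refine ⟨hN fun j => ⟨if j = i then 1 else 0, ?_⟩, fun j => ?_, ?_⟩
  · simp only [stdVec]
    split_ifs <;> simp
  · simp only [stdVec]
    split_ifs <;> norm_num
  · simp [stdVec]

lemma sub_mem_juniorPoints {N : AddSubgroup (Fin r → ℚ)} {x u : Fin r → ℚ} (hx : x ∈ N)
    (hsum : ∑ i, x i = 2) (hu : u ∈ juniorPoints N) (hle : ∀ i, u i ≤ x i) :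
    x - u ∈ juniorPoints N := by
  refine ⟨N.sub_mem hx hu.1, fun i => sub_nonneg.2 (hle i), ?_⟩
  simp only [Pi.sub_apply, Finset.sum_sub_distrib, hsum, hu.2.2]
  norm_num

/-- The double of a junior point with a coordinate in `[1/2, 1)` is the sum of two distinct
junior points. -/
lemma exists_ne_add_eq_add_self {N : AddSubgroup (Fin r → ℚ)} (hN : intLattice r ≤ N)
    {p : Fin r → ℚ} (hp : p ∈ juniorPoints N) {i : Fin r} (hi : 1 / 2 ≤ p i) (hi1 : p i < 1) :
    ∃ u ∈ juniorPoints N, ∃ w ∈ juniorPoints N, u ≠ w ∧ u + w = p + p := by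
  refine ⟨stdVec r i, stdVec_mem_juniorPoints hN i, p + p - stdVec r i,
    sub_mem_juniorPoints (N.add_mem hp.1 hp.1) ?_ (stdVec_mem_juniorPoints hN i) ?_, ?_,
    add_sub_cancel _ _⟩
  · simp only [Pi.add_apply, Finset.sum_add_distrib, hp.2.2]
    norm_num
  · intro j
    have := hp.2.1 j
    simp only [stdVec, Pi.add_apply]
    split_ifs with h
    · subst h
      linarith
    · linarith
  · intro h
    have := congrFun h i
    simp only [stdVec, Pi.sub_apply, Pi.add_apply, if_true] at this
    linarith

end Triangulation

section Count

variable {l : ℕ} [NeZero l] {α : Fin 4 → ℕ}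

lemma latticePoint_edge (hGor : l ∣ ∑ i, α i)
    (hsmall : ∀ i : Fin 4, Nat.gcd l (Finset.gcd (Finset.univ.erase i) α) = 1) {k : ZMod l}
    (hk : k ∈ edgeIndex l α) :
    latticePoint l α ⟨k, 0⟩ ∈ juniorPoints (quotientLattice l α) ∧
      ∃ i, 1 / 2 ≤ latticePoint l α ⟨k, 0⟩ i ∧ latticePoint l α ⟨k, 0⟩ i < 1 := by
  obtain ⟨hk0, p, hp, h1, h2⟩ := (Finset.mem_filter.1 hk).2
  obtain ⟨a, b, hpa, hpb, hqa, hqb, hab, huniv⟩ : ∃ a b : Fin 4, p.1 ≠ a ∧ p.1 ≠ b ∧ p.2 ≠ a ∧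
      p.2 ≠ b ∧ a ≠ b ∧ Finset.univ = ({p.1, p.2, a, b} : Finset (Fin 4)) := by
    clear h1 h2
    revert p
    decide
  have hsum := sum_residue hGor k
  rw [huniv, Finset.sum_insert (by simp [hp.ne, hpa, hpb]),
    Finset.sum_insert (by simp [hqa, hqb]), Finset.sum_pair hab, residue_eq_zero_iff.2 h1,
    residue_eq_zero_iff.2 h2, zero_add, zero_add] at hsum
  have ha := residue_lt (α := α) k a
  have hb := residue_lt (α := α) k b
  have hage : age l α k = 1 := by
    have h0 : age l α k ≠ 0 := mt (age_eq_zero_iff hGor hsmall).1 hk0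
    have hlt : age l α k < 2 := Nat.lt_of_mul_lt_mul_left (by omega : l * age l α k < l * 2)
    omega
  rw [hage, mul_one] at hsum
  have hl : (0 : ℚ) < l := Nat.cast_pos.2 (Nat.pos_of_ne_zero (NeZero.ne l))
  refine ⟨?_, ?_⟩
  · rw [← coe_levelPoints_one hGor, Finset.mem_coe, levelPoints]
    exact Finset.mem_image_of_mem _ (mem_levelIndex.2 (by simp [hage]))
  · have hhalf (i : Fin 4) (hi : l ≤ 2 * residue l α k i) :
        1 / 2 ≤ latticePoint l α ⟨k, 0⟩ i ∧ latticePoint l α ⟨k, 0⟩ i < 1 := by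
      have hi' : (l : ℚ) ≤ 2 * residue l α k i := by exact_mod_cast hi
      have hlt := residue_div_lt_one (α := α) k i
      simp only [latticePoint, Pi.zero_apply, Nat.cast_zero, zero_add]
      refine ⟨?_, hlt⟩
      rw [div_le_div_iff₀ two_pos hl]
      linarith
    rcases le_total (residue l α k a) (residue l α k b) with h | h
    · exact ⟨b, hhalf b (by omega)⟩
    · exact ⟨a, hhalf a (by omega)⟩

/-- Lattice points of height two are sums of two junior points, and the pairs `{p, p}` with `p`
interior to an edge are not needed. -/
lemma card_levelPoints_two_add_card_edgeIndex_le (hGor : l ∣ ∑ i, α i)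
    (hsmall : ∀ i : Fin 4, Nat.gcd l (Finset.gcd (Finset.univ.erase i) α) = 1)
    {T : Finset (Finset (Fin 4 → ℚ))} (hT : IsBasicTriangulation (quotientLattice l α) T) :
    (levelPoints l α 2).card + (edgeIndex l α).card ≤
      ((levelPoints l α 1).card + 1).choose 2 := by
  set D : Finset (Sym2 (Fin 4 → ℚ)) :=
    (edgeIndex l α).image fun k => Sym2.diag (latticePoint l α ⟨k, 0⟩) with hD
  have hN : intLattice 4 ≤ quotientLattice l α := le_sup_left
  have hmem (x : Fin 4 → ℚ) : x ∈ juniorPoints (quotientLattice l α) ↔ x ∈ levelPoints l α 1 := by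
    rw [← coe_levelPoints_one hGor, Finset.mem_coe]
  have hDcard : D.card = (edgeIndex l α).card := by
    refine Finset.card_image_of_injective _ fun k k' h => ?_
    have h' := latticePoint_injective hsmall (Sym2.diag_injective h)
    exact congrArg Sigma.fst h'
  have hDsub : D ⊆ (levelPoints l α 1).sym2 := by
    intro z hz
    obtain ⟨k, hk, rfl⟩ := Finset.mem_image.1 hz
    rw [Finset.diag_mem_sym2_iff, ← hmem]
    exact (latticePoint_edge hGor hsmall hk).1
  have hnotD {u w : Fin 4 → ℚ} (h : u ≠ w) : s(u, w) ∉ D := by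
    intro hz
    obtain ⟨k, -, hk⟩ := Finset.mem_image.1 hz
    exact h (Sym2.mk_isDiag_iff.1 (hk ▸ Sym2.diag_isDiag _))
  have hsurj : levelPoints l α 2 ⊆ ((levelPoints l α 1).sym2 \ D).image
      (Sym2.lift ⟨fun u w => u + w, fun u w => add_comm u w⟩) := by
    intro x hx
    obtain ⟨hxN, hx0, hxs⟩ := (mem_levelPoints hGor).1 hx
    suffices h : ∃ u ∈ levelPoints l α 1, ∃ w ∈ levelPoints l α 1, s(u, w) ∉ D ∧ u + w = x by
      obtain ⟨u, hu, w, hw, hz, rfl⟩ := h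
      exact Finset.mem_image.2
        ⟨s(u, w), Finset.mem_sdiff.2 ⟨Finset.mk_mem_sym2_iff.2 ⟨hu, hw⟩, hz⟩, rfl⟩
    simp only [← hmem]
    rw [Nat.cast_ofNat] at hxs
    obtain ⟨u, hu, hux⟩ := hT.exists_mem_juniorPoints_le hxN hx0 (by rw [hxs]; exact two_pos)
    have hw := sub_mem_juniorPoints hxN hxs hu hux
    by_cases hz : s(u, x - u) ∈ D
    · obtain ⟨k, hk, hkz⟩ := Finset.mem_image.1 hz
      obtain ⟨hp, i, hi, hi1⟩ := latticePoint_edge hGor hsmall hk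
      obtain ⟨u', hu', w', hw', hne, hadd⟩ := exists_ne_add_eq_add_self hN hp hi hi1
      refine ⟨u', hu', w', hw', hnotD hne, ?_⟩
      have := congrArg (Sym2.lift ⟨fun u w : Fin 4 → ℚ => u + w, fun u w => add_comm u w⟩) hkz
      rw [hadd]
      simpa [Sym2.diag] using this
    · exact ⟨u, hu, x - u, hw, hz, add_sub_cancel _ _⟩
  have h1 := (Finset.card_le_card hsurj).trans Finset.card_image_le
  rw [Finset.card_sdiff_of_subset hDsub, Finset.card_sym2, hDcard] at h1
  have h2 := Finset.card_le_card hDsub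
  rw [Finset.card_sym2, hDcard] at h2
  omega

lemma three_mul_add_two_mul_card_levelPoints_one (hGor : l ∣ ∑ i, α i)
    (hsmall : ∀ i : Fin 4, Nat.gcd l (Finset.gcd (Finset.univ.erase i) α) = 1) :
    3 * l + 2 * (levelPoints l α 1).card =
      ∑ k, age l α k + (levelPoints l α 2).card + 1 := by
  have h0 : ∑ k, (if age l α k = 0 then 1 else 0) = 1 := by
    simp [age_eq_zero_iff hGor hsmall]
  have h3 : 3 * l = ∑ _k : ZMod l, 3 := by simp [mul_comm]
  rw [card_levelPoints hsmall, card_levelPoints hsmall, Finset.mul_sum, h3]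
  nth_rewrite 4 [← h0]
  rw [← Finset.sum_add_distrib, ← Finset.sum_add_distrib, ← Finset.sum_add_distrib]
  refine Finset.sum_congr rfl fun k _ => ?_
  have h := age_lt_four hGor k
  generalize age l α k = a at h
  interval_cases a <;> decide

end Count

/-- **Upper bound for Gorenstein cyclic quotient singularities of type
`(1/l)(α₁,α₂,α₃,α₄)` (Corollary to the UBT).** -/
theorem upper_bound_cyclic_quotient_dim_four
    (l : ℕ) (hl : 2 ≤ l) (α : Fin 4 → ℕ)
    (hGor : l ∣ ∑ i, α i)
    (hsmall : ∀ i : Fin 4, Nat.gcd l (Finset.gcd (Finset.univ.erase i) α) = 1)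
    (N : AddSubgroup (Fin 4 → ℚ))
    (hN : N = intLattice 4 ⊔ AddSubgroup.zmultiples (fun i : Fin 4 => (α i : ℚ) / l))
    (b : ℕ) (hb : Nat.card ↥(juniorPoints N) = b)
    (T : Finset (Finset (Fin 4 → ℚ))) (hT : IsBasicTriangulation N T) :
    (2 * l : ℤ) ≤ (b : ℤ) * ((b : ℤ) - 3)
      - (∑ i, (Nat.gcd (α i) l : ℤ))
      - 2 * (∑ p ∈ Finset.univ.filter (fun p : Fin 4 × Fin 4 => p.1 < p.2),
          (Nat.gcd (Nat.gcd (α p.1) (α p.2)) l : ℤ))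
      + 14 := by
  have : NeZero l := ⟨by omega⟩
  have hN' : N = quotientLattice l α := hN
  subst hN'
  have hb' : (levelPoints l α 1).card = b := by
    rw [← hb, ← coe_levelPoints_one hGor]
    exact (Nat.card_eq_finsetCard _).symm
  have h1 := card_levelPoints_two_add_card_edgeIndex_le hGor hsmall hT
  have h2 := three_mul_add_two_mul_card_levelPoints_one hGor hsmall
  have h3 := two_mul_sum_age_add hGor
  have h4 := sum_gcd_gcd_eq hsmall
  rw [hb'] at h1 h2
  have h5 : ((b + 1).choose 2 : ℤ) * 2 = (b + 1) * b := by
    have h := Nat.add_one_mul_choose_eq b 1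
    rw [Nat.choose_one_right] at h
    exact_mod_cast h.symm
  zify at h1 h2 h3 h4
  linarith
end

section
/- Let r ≥ 3 and l ≥ r, and let N = ℤ^r + ℤ·v ⊆ ℚ^r where v = (1/l, 1/l, …, 1/l, (l−(r−1))/l) (the lattice of the cyclic quotient singularity of type (1/l)(1,1,…,1, l−(r−1))). Then every additively irreducible element of N in the positive orthant has coordinate sum equal to 1 (i.e., the Hilbert basis of the positive orthant with respect to N equals the set of junior points of N) if and only if l ≡ 0 (mod r−1) or l ≡ 1 (mod r−1). -/
/-- The generator `(1/l,…,1/l,1-d/l)` of the one-parameter series in dimension `d + 1`. -/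
def seriesVec (d l : ℕ) : Fin (d + 1) → ℚ :=
  Fin.snoc (α := fun _ => ℚ) (fun _ => 1 / (l : ℚ)) (1 - d / l)

@[simp] lemma seriesVec_castSucc (d l : ℕ) (i : Fin d) :
    seriesVec d l i.castSucc = 1 / l := by simp [seriesVec]

@[simp] lemma seriesVec_last (d l : ℕ) : seriesVec d l (Fin.last d) = 1 - d / l := by
  simp [seriesVec]

/-- The lattice `ℤ^(d+1) + ℤ·(1/l,…,1/l,1-d/l)`. -/
def seriesLattice (d l : ℕ) : AddSubgroup (Fin (d + 1) → ℚ) :=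
  intLattice (d + 1) ⊔ AddSubgroup.zmultiples (seriesVec d l)

lemma mem_seriesLattice {d l : ℕ} {x : Fin (d + 1) → ℚ} :
    x ∈ seriesLattice d l ↔ ∃ k : ℤ, ∀ i, ∃ n : ℤ, x i = n + k * seriesVec d l i := by
  simp only [seriesLattice, AddSubgroup.mem_sup, AddSubgroup.mem_zmultiples_iff]
  constructor
  · rintro ⟨y, hy, _, ⟨k, rfl⟩, rfl⟩
    refine ⟨k, fun i => ?_⟩
    obtain ⟨n, hn⟩ := hy i
    exact ⟨n, by simp [hn]⟩
  · rintro ⟨k, hk⟩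
    refine ⟨x - k • seriesVec d l, fun i => ?_, _, ⟨k, rfl⟩, by simp⟩
    obtain ⟨n, hn⟩ := hk i
    exact ⟨n, by simp [hn]⟩

lemma stdVec_mem_seriesLattice (d l : ℕ) (i : Fin (d + 1)) :
    stdVec (d + 1) i ∈ seriesLattice d l := by
  rw [mem_seriesLattice]
  refine ⟨0, fun j => ?_⟩
  by_cases h : j = i
  · exact ⟨1, by simp [stdVec, h]⟩
  · exact ⟨0, by simp [stdVec, h]⟩

lemma sum_seriesVec (d l : ℕ) : ∑ i, seriesVec d l i = 1 := by
  simp [Fin.sum_univ_castSucc, div_eq_mul_inv]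

lemma exists_sum_eq_int_of_mem_seriesLattice {d l : ℕ} {x : Fin (d + 1) → ℚ}
    (hx : x ∈ seriesLattice d l) : ∃ n : ℤ, ∑ i, x i = n := by
  obtain ⟨k, hk⟩ := mem_seriesLattice.1 hx
  choose n hn using hk
  refine ⟨∑ i, n i + k, ?_⟩
  simp only [hn, Finset.sum_add_distrib, ← Finset.mul_sum, sum_seriesVec]
  push_cast
  ring

lemma exists_mul_eq_int_of_mem_seriesLattice {d l : ℕ} (hl : 0 < l) {x : Fin (d + 1) → ℚ}
    (hx : x ∈ seriesLattice d l) (i : Fin (d + 1)) : ∃ n : ℤ, l * x i = n := by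
  have hl' : (l : ℚ) ≠ 0 := by positivity
  obtain ⟨k, hk⟩ := mem_seriesLattice.1 hx
  obtain ⟨n, hn⟩ := hk i
  induction i using Fin.lastCases with
  | last =>
    refine ⟨l * n + k * (l - d), ?_⟩
    rw [hn, seriesVec_last]
    push_cast
    field_simp
  | cast i =>
    refine ⟨l * n + k, ?_⟩
    rw [hn, seriesVec_castSucc]
    push_cast
    field_simp

lemma int_cast_eq_zero_of_mem_Ioo {q : ℚ} {n : ℤ} (hq : q = n) (h₁ : -1 < q) (h₂ : q < 1) :
    q = 0 := by
  rw [hq] at h₁ h₂ ⊢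
  norm_cast at *
  omega

lemma castSucc_eq_of_mem_seriesLattice {d l : ℕ} {x : Fin (d + 1) → ℚ}
    (hx : x ∈ seriesLattice d l) (h₀ : ∀ i, 0 ≤ x i) (h₁ : ∀ i, x i < 1) (i j : Fin d) :
    x i.castSucc = x j.castSucc := by
  obtain ⟨k, hk⟩ := mem_seriesLattice.1 hx
  obtain ⟨n, hn⟩ := hk i.castSucc
  obtain ⟨m, hm⟩ := hk j.castSucc
  have := int_cast_eq_zero_of_mem_Ioo (q := x i.castSucc - x j.castSucc) (n := n - m)
    (by rw [hn, hm]; simp) (by linarith [h₀ i.castSucc, h₁ j.castSucc])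
    (by linarith [h₁ i.castSucc, h₀ j.castSucc])
  linarith

lemma sum_eq_of_mem_seriesLattice {d l : ℕ} {x : Fin (d + 1) → ℚ}
    (hx : x ∈ seriesLattice d l) (h₀ : ∀ i, 0 ≤ x i) (h₁ : ∀ i, x i < 1) (j : Fin d) :
    ∑ i, x i = d * x j.castSucc + x (Fin.last d) := by
  rw [Fin.sum_univ_castSucc,
    Finset.sum_congr rfl fun i _ => castSucc_eq_of_mem_seriesLattice hx h₀ h₁ i j]
  simp

lemma sum_pos_of_ne_zero {ι : Type*} [Fintype ι] {x : ι → ℚ} (h₀ : ∀ i, 0 ≤ x i) (hx : x ≠ 0) :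
    0 < ∑ i, x i :=
  Fintype.sum_pos (lt_of_le_of_ne h₀ hx.symm)

/-- `x` is a sum of two nonzero elements of `N` in the positive orthant. -/
def IsReducible {ι : Type*} (N : AddSubgroup (ι → ℚ)) (x : ι → ℚ) : Prop :=
  ∃ y z, y ∈ N ∧ z ∈ N ∧ (∀ i, 0 ≤ y i) ∧ (∀ i, 0 ≤ z i) ∧ y ≠ 0 ∧ z ≠ 0 ∧ x = y + z

lemma IsReducible.of_le {ι : Type*} {N : AddSubgroup (ι → ℚ)} {x y : ι → ℚ} (hx : x ∈ N)
    (hy : y ∈ N) (h₀ : ∀ i, 0 ≤ y i) (hle : ∀ i, y i ≤ x i) (hy0 : y ≠ 0) (hne : x ≠ y) :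
    IsReducible N x :=
  ⟨y, x - y, hy, N.sub_mem hx hy, h₀, fun i => by simpa using hle i, hy0, sub_ne_zero.2 hne,
    by simp⟩

lemma sum_eq_one_of_not_isReducible {d l m s : ℕ} (hd : 0 < d) (hl : 0 < l)
    (hlm : l = d * m + s) (hs : s = 0 ∨ s = 1) {x : Fin (d + 1) → ℚ}
    (hx : x ∈ seriesLattice d l) (h₀ : ∀ i, 0 ≤ x i) (hx0 : x ≠ 0)
    (hirr : ¬ IsReducible (seriesLattice d l) x) : ∑ i, x i = 1 := by
  have hlQ : (0 : ℚ) < l := by positivity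
  have hdQ : (0 : ℚ) < d := by positivity
  have hlmQ : (l : ℚ) = d * m + s := by exact_mod_cast hlm
  by_cases h₁ : ∀ i, x i < 1
  swap
  · push Not at h₁
    obtain ⟨i, hi⟩ := h₁
    have hxi : x = stdVec (d + 1) i := by
      by_contra hne
      refine hirr (.of_le hx (stdVec_mem_seriesLattice d l i) (fun j => ?_) (fun j => ?_) ?_ hne)
      · unfold stdVec; split_ifs <;> norm_num
      · unfold stdVec; split_ifs with h
        · exact h ▸ hi
        · exact h₀ j
      · intro h
        simpa [stdVec] using congrFun h i
    simp [hxi, stdVec]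
  obtain ⟨S, hS⟩ := exists_sum_eq_int_of_mem_seriesLattice hx
  have hpos := sum_pos_of_ne_zero h₀ hx0
  by_contra hne
  have hS2 : (2 : ℚ) ≤ S := by
    rw [hS] at hpos hne
    norm_cast at *
    omega
  let j : Fin d := ⟨0, hd⟩
  have hsum := sum_eq_of_mem_seriesLattice hx h₀ h₁ j
  have hlast := h₁ (Fin.last d)
  have hlast0 := h₀ (Fin.last d)
  have hgt : 1 < d * x j.castSucc := by linarith
  have hml : (m : ℚ) / l < x j.castSucc := by
    rw [div_lt_iff₀ hlQ]
    have hs0 : (0 : ℚ) ≤ s := by positivity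
    nlinarith
  have hsl : (s : ℚ) / l ≤ x (Fin.last d) := by
    rcases hs with rfl | rfl
    · simpa using hlast0
    · obtain ⟨n, hn⟩ := exists_mul_eq_int_of_mem_seriesLattice hl hx (Fin.last d)
      obtain ⟨k, hk⟩ := exists_mul_eq_int_of_mem_seriesLattice hl hx j.castSucc
      rw [div_le_iff₀ hlQ, mul_comm, hn]
      by_contra hlt
      have hn0 : n = 0 := by
        have h : (0 : ℚ) ≤ n := by rw [← hn]; positivity
        norm_cast at *
        omega
      have hx_last : x (Fin.last d) = 0 := by
        rw [hn0] at hn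
        simpa [hlQ.ne'] using hn
      have hint : x j.castSucc = ((k - m * S : ℤ) : ℚ) := by
        push_cast
        rw [← hk, ← hS, hsum, hx_last, hlmQ]
        push_cast
        ring
      have := int_cast_eq_zero_of_mem_Ioo hint (by linarith [h₀ j.castSucc]) (h₁ _)
      rw [this] at hgt
      linarith
  let y : Fin (d + 1) → ℚ := Fin.snoc (α := fun _ => ℚ) (fun _ => (m : ℚ) / l) (s / l)
  have hy_last : y (Fin.last d) = s / l := by simp [y]
  have hy_cast (i : Fin d) : y i.castSucc = m / l := by simp [y]
  have hy : y ∈ seriesLattice d l := by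
    refine mem_seriesLattice.2 ⟨m, fun i => ?_⟩
    induction i using Fin.lastCases with
    | last =>
      refine ⟨1 - m, ?_⟩
      rw [hy_last, seriesVec_last]
      push_cast
      field_simp
      linarith
    | cast i =>
      refine ⟨0, ?_⟩
      rw [hy_cast, seriesVec_castSucc]
      push_cast
      ring
  refine hirr (.of_le hx hy (fun i => ?_) (fun i => ?_) ?_ ?_)
  · induction i using Fin.lastCases with
    | last => rw [hy_last]; positivity
    | cast i => rw [hy_cast]; positivity
  · induction i using Fin.lastCases with
    | last => rw [hy_last]; exact hsl
    | cast i =>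
      rw [hy_cast, castSucc_eq_of_mem_seriesLattice hx h₀ h₁ i j]
      exact hml.le
  · intro h
    have h1 := congrFun h j.castSucc
    have h2 := congrFun h (Fin.last d)
    rw [hy_cast, Pi.zero_apply, div_eq_zero_iff, or_iff_left hlQ.ne'] at h1
    rw [hy_last, Pi.zero_apply, div_eq_zero_iff, or_iff_left hlQ.ne'] at h2
    rw [h1, h2] at hlmQ
    linarith
  · intro h
    rw [h, hy_cast] at hml
    exact lt_irrefl _ hml

/-- Among the elements of `N` in the positive orthant satisfying a property that every sum of two
such elements passes on to a summand, one of minimal coordinate sum is irreducible. -/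
lemma exists_not_isReducible_of_summand {ι : Type*} [Fintype ι] {N : AddSubgroup (ι → ℚ)}
    (hN : ∀ x ∈ N, ∃ n : ℤ, ∑ i, x i = n) (P : (ι → ℚ) → Prop) (hP0 : ¬ P 0)
    (hP : ∀ y z, (∀ i, 0 ≤ y i) → (∀ i, 0 ≤ z i) → P (y + z) → P y ∨ P z)
    {w : ι → ℚ} (hw : w ∈ N) (hw0 : ∀ i, 0 ≤ w i) (hwP : P w) :
    ∃ x ∈ N, (∀ i, 0 ≤ x i) ∧ x ≠ 0 ∧ P x ∧ ¬ IsReducible N x := by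
  have hnat {x : ι → ℚ} (hx : x ∈ N) (hx0 : ∀ i, 0 ≤ x i) : ∃ n : ℕ, ∑ i, x i = n := by
    obtain ⟨n, hn⟩ := hN x hx
    have h : 0 ≤ n := by
      have := Finset.sum_nonneg fun i (_ : i ∈ Finset.univ) => hx0 i
      rw [hn] at this
      exact_mod_cast this
    lift n to ℕ using h
    exact ⟨n, by simpa using hn⟩
  obtain ⟨n, hn⟩ := hnat hw hw0
  induction n using Nat.strong_induction_on generalizing w with
  | _ n ih =>
    by_cases hred : IsReducible N w
    · obtain ⟨y, z, hy, hz, hy0, hz0, hyne, hzne, rfl⟩ := hred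
      obtain ⟨a, ha⟩ := hnat hy hy0
      obtain ⟨b, hb⟩ := hnat hz hz0
      have hapos := sum_pos_of_ne_zero hy0 hyne
      have hbpos := sum_pos_of_ne_zero hz0 hzne
      simp only [Pi.add_apply, Finset.sum_add_distrib] at hn
      rw [ha] at hapos hn
      rw [hb] at hbpos hn
      norm_cast at hapos hbpos hn
      rcases hP y z hy0 hz0 hwP with h | h
      · exact ih a (by omega) hy hy0 h ha
      · exact ih b (by omega) hz hz0 h hb
    · exact ⟨w, hw, hw0, fun h => hP0 (h ▸ hwP), hwP, hred⟩

lemma exists_not_isReducible_sum_ne_one {d l m s : ℕ} (hlm : l = d * m + s) (hs : 2 ≤ s)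
    (hsd : s < d) (hdl : d < l) :
    ∃ x ∈ seriesLattice d l, (∀ i, 0 ≤ x i) ∧ x ≠ 0 ∧ ¬ IsReducible (seriesLattice d l) x ∧
      ∑ i, x i ≠ 1 := by
  have hl : 0 < l := by omega
  have hlQ : (0 : ℚ) < l := by positivity
  have hdlQ : (d : ℚ) < l := by exact_mod_cast hdl
  have hlmQ : (l : ℚ) = d * m + s := by exact_mod_cast hlm
  have hsQ : (2 : ℚ) ≤ s := by exact_mod_cast hs
  have hsdQ : (s : ℚ) < d := by exact_mod_cast hsd
  let j : Fin d := ⟨0, by omega⟩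
  let w : Fin (d + 1) → ℚ := 1 - seriesVec d l
  have hw_last : w (Fin.last d) = d / l := by simp [w]
  have hw_cast (i : Fin d) : w i.castSucc = 1 - 1 / l := by simp [w]
  have hw : w ∈ seriesLattice d l :=
    mem_seriesLattice.2 ⟨-1, fun i => ⟨1, by simp [w, sub_eq_add_neg]⟩⟩
  have hl1 : 1 / (l : ℚ) < 1 := by rw [div_lt_one hlQ]; linarith
  have hw0 (i) : 0 ≤ w i := by
    induction i using Fin.lastCases with
    | last => rw [hw_last]; positivity
    | cast i => rw [hw_cast]; linarith
  have hw1 (i) : w i < 1 := by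
    induction i using Fin.lastCases with
    | last => rwa [hw_last, div_lt_one hlQ]
    | cast i => rw [hw_cast]; linarith [one_div_pos.2 hlQ]
  obtain ⟨x, hx, hx0, hxne, ⟨hx1, hxm⟩, hirr⟩ := exists_not_isReducible_of_summand
    (fun x hx => exists_sum_eq_int_of_mem_seriesLattice hx)
    (fun x : Fin (d + 1) → ℚ => (∀ i, x i < 1) ∧ m * ∑ i, x i < l * x j.castSucc)
    (by simp)
    (fun y z hy0 hz0 ⟨h1, hlt⟩ => by
      have hy1 (i) : y i < 1 := by have := h1 i; rw [Pi.add_apply] at this; linarith [hz0 i]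
      have hz1 (i) : z i < 1 := by have := h1 i; rw [Pi.add_apply] at this; linarith [hy0 i]
      simp only [Pi.add_apply, Finset.sum_add_distrib] at hlt
      by_contra! h
      linarith [h.1 hy1, h.2 hz1])
    hw hw0
    ⟨hw1, by
      rw [sum_eq_of_mem_seriesLattice hw hw0 hw1 j, hw_last, hw_cast]
      field_simp
      nlinarith⟩
  refine ⟨x, hx, hx0, hxne, hirr, fun hsum => ?_⟩
  obtain ⟨k, hk⟩ := exists_mul_eq_int_of_mem_seriesLattice hl hx j.castSucc
  rw [hsum, hk, mul_one] at hxm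
  rw [sum_eq_of_mem_seriesLattice hx hx0 hx1 j] at hsum
  have hmk : (m : ℚ) + 1 ≤ k := by
    have : (m : ℤ) < k := by exact_mod_cast hxm
    exact_mod_cast this
  have hdk : (d : ℚ) * k ≤ l := by
    rw [← hk]
    nlinarith [hx0 (Fin.last d)]
  nlinarith

/-- **First existence criterion for the `1`-parameter series
`(1/l)(1,…,1, l-(r-1))` (Theorem 7.1 (ii)).** For the lattice
`N = ℤ^r + ℤ·(1/l,…,1/l,(l-(r-1))/l)`, every additively irreducible element of `N`
in the positive orthant has coordinate sum `1` (i.e. the Hilbert basis of the positive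
orthant equals the set of junior points) if and only if
`l ≡ 0 (mod r-1)` or `l ≡ 1 (mod r-1)`. -/
theorem hilbertBasis_eq_juniors_iff_one_parameter_series
    (r l : ℕ) (hr : 3 ≤ r) (hl : r ≤ l)
    (v : Fin r → ℚ)
    (hv : v = fun i : Fin r => if (i : ℕ) = r - 1 then ((l - (r - 1) : ℕ) : ℚ) / l else 1 / l)
    (N : AddSubgroup (Fin r → ℚ))
    (hN : N = intLattice r ⊔ AddSubgroup.zmultiples v) :
    (∀ x ∈ N, (∀ i, 0 ≤ x i) → x ≠ 0 →
        (¬ ∃ y z, y ∈ N ∧ z ∈ N ∧ (∀ i, 0 ≤ y i) ∧ (∀ i, 0 ≤ z i) ∧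
            y ≠ 0 ∧ z ≠ 0 ∧ x = y + z) →
        ∑ i, x i = 1)
      ↔ (l % (r - 1) = 0 ∨ l % (r - 1) = 1) := by
  obtain ⟨d, rfl⟩ : ∃ d, r = d + 1 := ⟨r - 1, by omega⟩
  have hvd : v = seriesVec d l := by
    have hlQ : (l : ℚ) ≠ 0 := by norm_cast; omega
    subst hv
    ext i
    induction i using Fin.lastCases with
    | last =>
      simp [Nat.cast_sub (show d ≤ l by omega), sub_div, hlQ]
    | cast i => simp [i.isLt.ne]
  obtain rfl : N = seriesLattice d l := by rw [hN, hvd, seriesLattice]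
  rw [Nat.add_sub_cancel]
  have hdiv : l = d * (l / d) + l % d := (Nat.div_add_mod l d).symm
  constructor
  · intro h
    by_contra hmod
    obtain ⟨x, hx, hx0, hxne, hirr, hsum⟩ := exists_not_isReducible_sum_ne_one hdiv (by omega)
      (Nat.mod_lt _ (by omega)) (by omega)
    exact hsum (h x hx hx0 hxne hirr)
  · intro hmod x hx hx0 hxne hirr
    exact sum_eq_one_of_not_isReducible (by omega) (by omega) hdiv hmod hx hx0 hxne hirr
end

section
/- Let v_0, v_1, v_2, v_3 ∈ ℝ^3 be affinely independent points and 𝐬 = conv{v_0,…,v_3} the tetrahedron they span. Let K be a finite geometric simplicial complex in ℝ^3 whose underlying space equals 𝐬 and which has each v_i among its vertices. Let b be the total number of vertices of K, b_2 the number of vertices of K lying in a closed edge conv{v_i, v_j} (i ≠ j) but different from v_i and v_j, and b_3 the number of vertices of K lying in the intrinsic (relative) interior of some 2-face conv{v_i, v_j, v_k} (i, j, k distinct). Then the number of faces of K with exactly 4 vertices is at most b(b−3)/2 − 2·b_2 − b_3 − 1. -/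
section

open Filter Topology

theorem AffineIndependent.eq_zero_of_sum_eq_zero_finset {E : Type*} [AddCommGroup E] [Module ℝ E]
    {T : Finset E} (hT : AffineIndependent ℝ ((↑) : T → E)) {a : E → ℝ}
    (h0 : ∑ i ∈ T, a i = 0) (h1 : ∑ i ∈ T, a i • i = 0) : ∀ i ∈ T, a i = 0 := by
  intro i hi
  have := affineIndependent_iff.1 hT Finset.univ (fun i => a i)
    (by rw [← h0]; exact Finset.sum_coe_sort T a)
    (by rw [← h1]; exact Finset.sum_coe_sort T (fun i => a i • i)) ⟨i, hi⟩ (Finset.mem_univ _)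
  exact this

theorem AffineIndependent.subset_of_pos_combination_mem {E : Type*} [AddCommGroup E] [Module ℝ E]
    {T G : Finset E} (hT : AffineIndependent ℝ ((↑) : T → E)) (hG : G ⊆ T) {w : E → ℝ}
    (hw : ∀ i ∈ T, 0 < w i) (hs : ∑ i ∈ T, w i = 1)
    (hx : ∑ i ∈ T, w i • i ∈ convexHull ℝ (G : Set E)) : T ⊆ G := by
  classical
  obtain ⟨w', -, hs', hx'⟩ := Finset.mem_convexHull'.1 hx
  have e1 : ∑ i ∈ T, (if i ∈ G then w' i else 0) = 1 := by
    rw [← Finset.sum_filter, Finset.filter_mem_eq_inter, Finset.inter_eq_right.2 hG, hs']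
  have e2 : ∑ i ∈ T, (if i ∈ G then w' i else 0) • i = ∑ i ∈ T, w i • i := by
    rw [← hx']
    simp only [ite_smul, zero_smul]
    rw [← Finset.sum_filter, Finset.filter_mem_eq_inter, Finset.inter_eq_right.2 hG]
  intro i hi
  by_contra hiG
  have := hT.eq_zero_of_sum_eq_zero_finset (a := fun i => w i - if i ∈ G then w' i else 0)
    (by simp only [Finset.sum_sub_distrib, e1, hs, sub_self])
    (by simp only [sub_smul, Finset.sum_sub_distrib, e2, sub_self]) i hi
  simp only [hiG, if_false, sub_zero] at this
  exact (hw i hi).ne' this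

/-- `a` expresses the vector `u` as an affine-dependence-type combination of the points of `T`. -/
def IsDirectionCoeff {E : Type*} [AddCommGroup E] [Module ℝ E] (u : E) (T : Finset E)
    (a : E → ℝ) : Prop :=
  ∑ i ∈ T, a i = 0 ∧ ∑ i ∈ T, a i • i = u

theorem exists_isDirectionCoeff_iff {E : Type*} [AddCommGroup E] [Module ℝ E] {u : E}
    {T : Finset E} : (∃ a, IsDirectionCoeff u T a) ↔ u ∈ vectorSpan ℝ (T : Set E) := by
  classical
  constructor
  · rintro ⟨a, h0, rfl⟩
    obtain rfl | ⟨q, hq⟩ := T.eq_empty_or_nonempty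
    · simp
    have : ∑ i ∈ T, a i • i = ∑ i ∈ T, a i • (i - q) := by
      simp only [smul_sub, Finset.sum_sub_distrib, ← Finset.sum_smul, h0, zero_smul, sub_zero]
    rw [this]
    exact Submodule.sum_mem _ fun i hi => Submodule.smul_mem _ _
      (vsub_mem_vectorSpan ℝ (Finset.mem_coe.2 hi) (Finset.mem_coe.2 hq))
  · intro h
    rw [vectorSpan_def] at h
    induction h using Submodule.span_induction with
    | mem x hx =>
      obtain ⟨p, hp, q, hq, rfl⟩ := Set.mem_vsub.1 hx
      refine ⟨Pi.single p 1 - Pi.single q 1, ?_, ?_⟩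
      · simp [Finset.sum_pi_single', Finset.mem_coe.1 hp, Finset.mem_coe.1 hq]
      · simp [sub_smul, Pi.single_apply, ite_smul, Finset.mem_coe.1 hp, Finset.mem_coe.1 hq]
    | zero => exact ⟨0, by simp, by simp⟩
    | add x y _ _ hx hy =>
      obtain ⟨a, ha, rfl⟩ := hx
      obtain ⟨b, hb, rfl⟩ := hy
      exact ⟨a + b, by simp [Finset.sum_add_distrib, ha, hb],
        by simp [Finset.sum_add_distrib, add_smul]⟩
    | smul c x _ hx =>
      obtain ⟨a, ha, rfl⟩ := hx
      exact ⟨c • a, by simp [← Finset.mul_sum, ha], by simp [Finset.smul_sum, mul_smul]⟩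

namespace IsDirectionCoeff

variable {E : Type*} [AddCommGroup E] [Module ℝ E] {u : E} {T F : Finset E} {a b : E → ℝ}

theorem linear_apply (h : IsDirectionCoeff u T a) (f : E →ᵃ[ℝ] ℝ) :
    f.linear u = ∑ i ∈ T, a i * f i := by
  have : ∀ i, f i = f.linear i + f 0 := fun i => by
    simpa using congrFun f.decomp i
  rw [Finset.sum_congr rfl fun i _ => congrArg (a i * ·) (this i), ← h.2, map_sum]
  simp [mul_add, Finset.sum_add_distrib, ← Finset.sum_mul, h.1]

theorem neg (h : IsDirectionCoeff u T a) : IsDirectionCoeff (-u) T (fun i => -a i) :=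
  ⟨by simp [h.1], by simp [h.2]⟩

theorem eq_on (hT : AffineIndependent ℝ ((↑) : T → E)) (h : IsDirectionCoeff u T a)
    (h' : IsDirectionCoeff u T b) : ∀ i ∈ T, a i = b i := fun i hi => by
  have := hT.eq_zero_of_sum_eq_zero_finset (a := fun i => a i - b i)
    (by simp [h.1, h'.1]) (by simp [sub_smul, h.2, h'.2]) i hi
  linarith

theorem of_subset (h : IsDirectionCoeff u T a) (hFT : F ⊆ T) (h0 : ∀ i ∈ T, i ∉ F → a i = 0) :
    IsDirectionCoeff u F a :=
  ⟨(Finset.sum_subset hFT h0).trans h.1,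
    (Finset.sum_subset hFT fun i hi hi' => by simp [h0 i hi hi']).trans h.2⟩

end IsDirectionCoeff

theorem eventually_forall_pos_ite_add_mul {E : Type*} [DecidableEq E] {T F : Finset E} {a : E → ℝ}
    (hF : F.Nonempty) (ha : ∀ i ∈ T, i ∉ F → 0 < a i) :
    ∀ᶠ ε in 𝓝[>] (0 : ℝ), ∀ i ∈ T, 0 < (if i ∈ F then (F.card : ℝ)⁻¹ else 0) + ε * a i := by
  rw [Finset.eventually_all]
  intro i hi
  by_cases hiF : i ∈ F
  · have hc : (0 : ℝ) < (F.card : ℝ)⁻¹ := by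
      have := hF.card_pos
      positivity
    simp only [hiF, if_true]
    have : Tendsto (fun ε : ℝ => (F.card : ℝ)⁻¹ + ε * a i) (𝓝 0) (𝓝 ((F.card : ℝ)⁻¹ + 0 * a i)) :=
      (Continuous.tendsto (by fun_prop) _)
    exact (this.mono_left nhdsWithin_le_nhds).eventually_const_lt (by simpa using hc)
  · filter_upwards [self_mem_nhdsWithin] with ε hε
    simp only [hiF, if_false, zero_add]
    exact mul_pos hε (ha i hi hiF)

theorem sum_ite_inv_card {E : Type*} [DecidableEq E] {F T : Finset E}
    (hFT : F ⊆ T) (hF : F.Nonempty) : ∑ i ∈ T, (if i ∈ F then (F.card : ℝ)⁻¹ else 0) = 1 := by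
  rw [← Finset.sum_filter, Finset.filter_mem_eq_inter, Finset.inter_eq_right.2 hFT,
    Finset.sum_const, nsmul_eq_mul]
  have := hF.card_pos
  field_simp

theorem sum_ite_inv_card_smul {E : Type*} [AddCommGroup E] [Module ℝ E] [DecidableEq E]
    {F T : Finset E} (hFT : F ⊆ T) :
    ∑ i ∈ T, (if i ∈ F then (F.card : ℝ)⁻¹ else 0) • i = ∑ i ∈ F, (F.card : ℝ)⁻¹ • i := by
  simp only [ite_smul, zero_smul]
  rw [← Finset.sum_filter, Finset.filter_mem_eq_inter, Finset.inter_eq_right.2 hFT]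

namespace Geometry.SimplicialComplex

theorem eq_of_direction_enters {E : Type*} [AddCommGroup E] [Module ℝ E]
    (K : SimplicialComplex ℝ E) {u : E} {F T T' : Finset E} {a a' : E → ℝ}
    (hF : F.Nonempty) (hT : T ∈ K.faces) (hT' : T' ∈ K.faces) (hFT : F ⊆ T) (hFT' : F ⊆ T')
    (h : IsDirectionCoeff u T a) (h' : IsDirectionCoeff u T' a')
    (ha : ∀ i ∈ T, i ∉ F → 0 < a i) (ha' : ∀ i ∈ T', i ∉ F → 0 < a' i) : T = T' := by
  classical
  obtain ⟨ε, h1, h2⟩ := ((eventually_forall_pos_ite_add_mul hF ha).and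
    (eventually_forall_pos_ite_add_mul hF ha')).exists
  have key : ∀ {S : Finset E} {b : E → ℝ}, F ⊆ S → IsDirectionCoeff u S b →
      ∑ i ∈ S, ((if i ∈ F then (F.card : ℝ)⁻¹ else 0) + ε * b i) = 1 ∧
      ∑ i ∈ S, ((if i ∈ F then (F.card : ℝ)⁻¹ else 0) + ε * b i) • i =
        ∑ i ∈ F, (F.card : ℝ)⁻¹ • i + ε • u := by
    intro S b hFS hb
    refine ⟨?_, ?_⟩
    · rw [Finset.sum_add_distrib, sum_ite_inv_card hFS hF, ← Finset.mul_sum, hb.1]; simp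
    · simp only [add_smul, Finset.sum_add_distrib, mul_smul, ← Finset.smul_sum, hb.2]
      rw [sum_ite_inv_card_smul hFS]
  have m1 : ∑ i ∈ F, (F.card : ℝ)⁻¹ • i + ε • u ∈ convexHull ℝ (T : Set E) :=
    Finset.mem_convexHull'.2 ⟨_, fun i hi => (h1 i hi).le, (key hFT h).1, (key hFT h).2⟩
  have m2 : ∑ i ∈ F, (F.card : ℝ)⁻¹ • i + ε • u ∈ convexHull ℝ (T' : Set E) :=
    Finset.mem_convexHull'.2 ⟨_, fun i hi => (h2 i hi).le, (key hFT' h').1, (key hFT' h').2⟩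
  have m := K.inter_subset_convexHull hT hT' ⟨m1, m2⟩
  rw [← Finset.coe_inter] at m
  refine Finset.Subset.antisymm ?_ ?_
  · refine Finset.Subset.trans ((K.indep hT).subset_of_pos_combination_mem
      Finset.inter_subset_left h1 (key hFT h).1 ?_) Finset.inter_subset_right
    rwa [(key hFT h).2]
  · refine Finset.Subset.trans ((K.indep hT').subset_of_pos_combination_mem
      Finset.inter_subset_right h2 (key hFT' h').1 ?_) Finset.inter_subset_left
    rwa [(key hFT' h').2]

theorem exists_direction_enters {E : Type*} [NormedAddCommGroup E] [NormedSpace ℝ E]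
    (K : SimplicialComplex ℝ E) (hfin : K.faces.Finite) {u : E} {F : Finset E}
    (hF : F ∈ K.faces)
    (h : ∀ᶠ ε in 𝓝[>] (0 : ℝ), ∑ i ∈ F, (F.card : ℝ)⁻¹ • i + ε • u ∈ K.space) :
    ∃ T ∈ K.faces, F ⊆ T ∧ ∃ a, IsDirectionCoeff u T a ∧ ∀ i ∈ T, i ∉ F → 0 < a i := by
  classical
  have hFne := K.nonempty_of_mem_faces hF
  set x := ∑ i ∈ F, (F.card : ℝ)⁻¹ • i with hx
  obtain ⟨t, ht, hfreq⟩ : ∃ t ∈ K.faces, ∃ᶠ ε in 𝓝[>] (0 : ℝ),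
      x + ε • u ∈ convexHull ℝ (t : Set E) := by
    by_contra! hcon
    have : ∀ᶠ ε in 𝓝[>] (0 : ℝ), ∀ t ∈ K.faces, x + ε • u ∉ convexHull ℝ (t : Set E) := by
      rw [eventually_all_finite hfin]
      exact fun t ht => hcon t ht
    obtain ⟨ε, h1, h2⟩ := (h.and this).exists
    obtain ⟨t, ht, hm⟩ := mem_space_iff.1 h1
    exact h2 t ht hm
  have hxt : x ∈ convexHull ℝ (t : Set E) := by
    refine (t.finite_toSet.isClosed_convexHull (𝕜 := ℝ)).mem_of_frequently_of_tendsto hfreq ?_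
    have : Tendsto (fun ε : ℝ => x + ε • u) (𝓝 0) (𝓝 (x + (0 : ℝ) • u)) :=
      Continuous.tendsto (by fun_prop) _
    simpa using this.mono_left nhdsWithin_le_nhds
  have hs1 : ∑ i ∈ F, (F.card : ℝ)⁻¹ = 1 := by
    have := hFne.card_pos
    rw [Finset.sum_const, nsmul_eq_mul]
    field_simp
  have hpos : ∀ i ∈ F, (0 : ℝ) < (F.card : ℝ)⁻¹ := fun _ _ => by
    have := hFne.card_pos
    positivity
  have hxF : x ∈ convexHull ℝ (F : Set E) :=
    Finset.mem_convexHull'.2 ⟨_, fun i hi => (hpos i hi).le, hs1, rfl⟩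
  have hFt : F ⊆ t := by
    have m := K.inter_subset_convexHull hF ht ⟨hxF, hxt⟩
    rw [← Finset.coe_inter] at m
    exact ((K.indep hF).subset_of_pos_combination_mem Finset.inter_subset_left hpos hs1 m).trans
      Finset.inter_subset_right
  obtain ⟨ε, hε, hε0⟩ := (hfreq.and_eventually self_mem_nhdsWithin).exists
  have hε0 : 0 < ε := hε0
  obtain ⟨w, hw0, hw1, hw2⟩ := Finset.mem_convexHull'.1 hε
  set a : E → ℝ := fun i => ε⁻¹ * (w i - if i ∈ F then (F.card : ℝ)⁻¹ else 0) with ha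
  have hat : IsDirectionCoeff u t a := by
    refine ⟨?_, ?_⟩
    · simp only [ha]
      rw [← Finset.mul_sum, Finset.sum_sub_distrib, hw1, sum_ite_inv_card hFt hFne]; simp
    · simp only [ha, mul_smul, sub_smul]
      rw [← Finset.smul_sum, Finset.sum_sub_distrib, hw2, sum_ite_inv_card_smul hFt, ← hx,
        add_sub_cancel_left, smul_smul, inv_mul_cancel₀ hε0.ne', one_smul]
  have hsub : F ⊆ t.filter (fun i => i ∈ F ∨ a i ≠ 0) := fun i hi =>
    Finset.mem_filter.2 ⟨hFt hi, Or.inl hi⟩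
  refine ⟨t.filter (fun i => i ∈ F ∨ a i ≠ 0), K.down_closed ht (Finset.filter_subset _ _)
    (hFne.mono hsub), hsub, a, hat.of_subset (Finset.filter_subset _ _) ?_, ?_⟩
  · intro i hi hi'
    by_contra h0
    exact hi' (Finset.mem_filter.2 ⟨hi, Or.inr h0⟩)
  · intro i hi hiF
    obtain ⟨hit, h0⟩ := Finset.mem_filter.1 hi
    refine lt_of_le_of_ne ?_ (h0.resolve_left hiF).symm
    simp only [ha, hiF, if_false, sub_zero]
    exact mul_nonneg (inv_nonneg.2 hε0.le) (hw0 i hit)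

end Geometry.SimplicialComplex

namespace AffineBasis

theorem sum_linear_coord {ι E : Type*} [Fintype ι] [AddCommGroup E] [Module ℝ E]
    (B : AffineBasis ι ℝ E) (u : E) : ∑ i, (B.coord i).linear u = 0 := by
  have h : ∀ i, (B.coord i).linear u = B.coord i u - B.coord i 0 := fun i => by
    simpa using (B.coord i).linearMap_vsub u 0
  simp_rw [h, Finset.sum_sub_distrib, B.sum_coord_apply_eq_one, sub_self]

theorem sum_linear_coord_smul {ι E : Type*} [Fintype ι] [AddCommGroup E] [Module ℝ E]
    (B : AffineBasis ι ℝ E) (u : E) : ∑ i, (B.coord i).linear u • B i = u := by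
  have h : ∀ i, (B.coord i).linear u = B.coord i u - B.coord i 0 := fun i => by
    simpa using (B.coord i).linearMap_vsub u 0
  simp_rw [h, sub_smul, Finset.sum_sub_distrib, B.linear_combination_coord_eq_self, sub_zero]

theorem mem_vectorSpan_image_iff {ι E : Type*} [Fintype ι] [DecidableEq E] [AddCommGroup E]
    [Module ℝ E] (B : AffineBasis ι ℝ E) {J : Finset ι} {u : E} :
    u ∈ vectorSpan ℝ (J.image B : Set E) ↔ ∀ i ∉ J, (B.coord i).linear u = 0 := by
  classical
  constructor
  · intro hu i hi
    obtain ⟨a, ha⟩ := exists_isDirectionCoeff_iff.2 hu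
    rw [ha.linear_apply]
    refine Finset.sum_eq_zero fun x hx => ?_
    obtain ⟨j, hj, rfl⟩ := Finset.mem_image.1 hx
    rw [B.coord_apply_ne (ne_of_mem_of_not_mem hj hi).symm, mul_zero]
  · intro h
    have hs : ∀ f : ι → ℝ, (∀ i ∉ J, f i = 0) → ∀ x : ι → E,
        ∑ i ∈ J, f i • x i = ∑ i, f i • x i := fun f hf x =>
      Finset.sum_subset (Finset.subset_univ _) fun i _ hi => by simp [hf i hi]
    have hinj : ∀ f : E → E, ∑ x ∈ J.image B, f x = ∑ i ∈ J, f (B i) := fun f =>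
      Finset.sum_image fun i _ j _ hij => B.ind.injective hij
    have h1 : ∑ i ∈ J, (B.coord i).linear u = 0 := by
      rw [← B.sum_linear_coord u]
      exact Finset.sum_subset (Finset.subset_univ _) fun i _ hi => h i hi
    obtain rfl | ⟨q, hq⟩ := J.eq_empty_or_nonempty
    · rw [← B.sum_linear_coord_smul u, ← hs _ h]
      simp
    · have : u = ∑ i ∈ J, (B.coord i).linear u • (B i - B q) := by
        simp only [smul_sub, Finset.sum_sub_distrib, ← Finset.sum_smul, h1, zero_smul, sub_zero]
        rw [hs _ h, B.sum_linear_coord_smul u]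
      rw [this]
      exact Submodule.sum_mem _ fun i hi => Submodule.smul_mem _ _
        (vsub_mem_vectorSpan ℝ (Finset.mem_coe.2 (Finset.mem_image_of_mem _ hi))
          (Finset.mem_coe.2 (Finset.mem_image_of_mem _ hq)))

end AffineBasis

theorem AffineIndependent.finrank_vectorSpan_coe_finset {E : Type*} [AddCommGroup E] [Module ℝ E]
    {T : Finset E} (hT : AffineIndependent ℝ ((↑) : T → E)) (hne : T.Nonempty) :
    Module.finrank ℝ (vectorSpan ℝ (T : Set E)) + 1 = T.card := by
  have := hT.finrank_vectorSpan (n := T.card - 1)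
    (by rw [Fintype.card_coe]; have := hne.card_pos; omega)
  rw [Subtype.range_coe_subtype] at this
  have e : {x | x ∈ T} = (T : Set E) := rfl
  rw [e] at this
  have := hne.card_pos
  omega

theorem AffineBasis.finrank_vectorSpan_image {ι E : Type*} [DecidableEq E] [AddCommGroup E]
    [Module ℝ E] (B : AffineBasis ι ℝ E) {J : Finset ι} (hJ : J.Nonempty) :
    Module.finrank ℝ (vectorSpan ℝ (J.image B : Set E)) + 1 = J.card := by
  rw [B.ind.finrank_vectorSpan_image_finset (n := J.card - 1)]
  all_goals have := hJ.card_pos; omega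

/-- Moving a vector of `W` slightly inside `W` avoids finitely many subspaces not containing `W`. -/
theorem Submodule.exists_eventually_add_smul_notMem {E : Type*} [AddCommGroup E] [Module ℝ E]
    (W : Submodule ℝ E) {κ : Type*} {S : Set κ} (hS : S.Finite) (D : κ → Submodule ℝ E)
    (hD : ∀ k ∈ S, ¬ W ≤ D k) (u₀ : E) :
    ∃ w ∈ W, ∀ᶠ r in 𝓝[>] (0 : ℝ), ∀ k ∈ S, u₀ + r • w ∉ D k := by
  classical
  have hne := Subspace.biUnion_ne_univ_of_top_notMem
    (s := hS.toFinset.image fun k => (D k).comap W.subtype) (by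
      intro h
      obtain ⟨k, hk, hk'⟩ := Finset.mem_image.1 h
      refine hD k (hS.mem_toFinset.1 hk) fun x hx => ?_
      have : (⟨x, hx⟩ : W) ∈ (D k).comap W.subtype := hk' ▸ Submodule.mem_top
      exact this)
  obtain ⟨w, hw⟩ := (Set.ne_univ_iff_exists_notMem _).1 hne
  have hw : ∀ k ∈ S, (w : E) ∉ D k := fun k hk hwk => hw <| by
    simp only [Set.mem_iUnion]
    exact ⟨_, Finset.mem_image_of_mem _ (hS.mem_toFinset.2 hk), hwk⟩
  refine ⟨w, w.2, (eventually_all_finite hS).2 fun k hk => ?_⟩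
  by_cases h : ∃ r₀ > (0 : ℝ), u₀ + r₀ • (w : E) ∈ D k
  · obtain ⟨r₀, hr₀, hm⟩ := h
    filter_upwards [Ioo_mem_nhdsGT hr₀] with r hr hm'
    have : (r₀ - r) • (w : E) ∈ D k := by
      have := (D k).sub_mem hm hm'
      rwa [add_sub_add_left_eq_sub, ← sub_smul] at this
    exact hw k hk (((D k).smul_mem_iff (sub_ne_zero.2 hr.2.ne')).1 this)
  · filter_upwards [self_mem_nhdsWithin] with r hr hm
    exact h ⟨r, hr, hm⟩

namespace Geometry.SimplicialComplex

/-- The faces of `K` contained in the face of the simplex with vertices `B i` spanned by the `B i`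
with `i ∈ J`. -/
def facesIn {ι E : Type*} [AddCommGroup E] [Module ℝ E] (K : SimplicialComplex ℝ E)
    (B : AffineBasis ι ℝ E) (J : Finset ι) : Set (Finset E) :=
  {t | t ∈ K.faces ∧ ∀ x ∈ t, ∀ i ∉ J, B.coord i x = 0}

section

variable {ι E : Type*} [Fintype ι] [AddCommGroup E] [Module ℝ E]
  {K : SimplicialComplex ℝ E} {B : AffineBasis ι ℝ E} {J : Finset ι} {t : Finset E} {u : E}

theorem vectorSpan_le_of_mem_facesIn [DecidableEq E] (ht : t ∈ K.facesIn B J) :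
    vectorSpan ℝ (t : Set E) ≤ vectorSpan ℝ (J.image B : Set E) := by
  intro u hu
  obtain ⟨a, ha⟩ := exists_isDirectionCoeff_iff.2 hu
  refine B.mem_vectorSpan_image_iff.2 fun i hi => ?_
  rw [ha.linear_apply]
  exact Finset.sum_eq_zero fun x hx => by rw [ht.2 x hx i hi, mul_zero]

theorem card_le_of_mem_facesIn (hJ : J.Nonempty) (ht : t ∈ K.facesIn B J) :
    t.card ≤ J.card := by
  classical
  rw [← (K.indep ht.1).finrank_vectorSpan_coe_finset (K.nonempty_of_mem_faces ht.1),
    ← B.finrank_vectorSpan_image hJ]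
  have := finiteDimensional_vectorSpan_of_finite ℝ (J.image B).finite_toSet
  exact Nat.add_le_add_right (Submodule.finrank_mono (vectorSpan_le_of_mem_facesIn ht)) 1

theorem exists_isDirectionCoeff_of_card_eq (hJ : J.Nonempty) (ht : t ∈ K.facesIn B J)
    (hc : t.card = J.card) (hu : ∀ i ∉ J, (B.coord i).linear u = 0) :
    ∃ a, IsDirectionCoeff u t a := by
  classical
  rw [exists_isDirectionCoeff_iff]
  have := finiteDimensional_vectorSpan_of_finite ℝ (J.image B).finite_toSet
  rw [Submodule.eq_of_le_of_finrank_eq (vectorSpan_le_of_mem_facesIn ht) (by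
    have h1 := (K.indep ht.1).finrank_vectorSpan_coe_finset (K.nonempty_of_mem_faces ht.1)
    have h2 := B.finrank_vectorSpan_image hJ
    omega)]
  exact B.mem_vectorSpan_image_iff.2 hu

theorem exists_generic_direction (hfin : K.faces.Finite) {p : ι} (hp : p ∈ J)
    (hJ : 2 ≤ J.card) :
    ∃ u : E, (∀ i ∉ J, (B.coord i).linear u = 0) ∧ (B.coord p).linear u < 0 ∧
      (∀ i ∈ J, i ≠ p → 0 < (B.coord i).linear u) ∧
      ∀ t ∈ K.facesIn B J, t.card < J.card → ¬ ∃ a, IsDirectionCoeff u t a := by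
  classical
  have hJne : J.Nonempty := ⟨p, hp⟩
  set W := vectorSpan ℝ (J.image B : Set E) with hW
  set u₀ : E := ∑ i ∈ J.erase p, (B i - B p) with hu₀
  have hlin : ∀ j, (B.coord j).linear u₀ = ∑ i ∈ J.erase p, (B.coord j (B i) - B.coord j (B p)) := by
    intro j
    rw [hu₀, map_sum]
    exact Finset.sum_congr rfl fun i _ => (B.coord j).linearMap_vsub (B i) (B p)
  have hp₀ : (B.coord p).linear u₀ < 0 := by
    rw [hlin]
    refine Finset.sum_neg (fun i hi => ?_) ?_
    · rw [B.coord_apply_ne (Finset.ne_of_mem_erase hi).symm, B.coord_apply_eq]; norm_num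
    · rw [← Finset.card_pos, Finset.card_erase_of_mem hp]; omega
  have hpos₀ : ∀ i ∈ J, i ≠ p → 0 < (B.coord i).linear u₀ := by
    intro j hj hjp
    rw [hlin]
    refine Finset.sum_pos' (fun i hi => ?_) ⟨j, Finset.mem_erase.2 ⟨hjp, hj⟩, ?_⟩
    · rw [B.coord_apply_ne hjp, sub_zero, B.coord_apply]; split_ifs <;> norm_num
    · rw [B.coord_apply_ne hjp, B.coord_apply_eq]; norm_num
  have hmem₀ : u₀ ∈ W := Submodule.sum_mem _ fun i hi =>
    vsub_mem_vectorSpan ℝ (Finset.mem_coe.2 (Finset.mem_image_of_mem _ (Finset.mem_of_mem_erase hi)))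
      (Finset.mem_coe.2 (Finset.mem_image_of_mem _ hp))
  obtain ⟨w, hw, hev⟩ := W.exists_eventually_add_smul_notMem
    (S := {t | t ∈ K.facesIn B J ∧ t.card < J.card}) (hfin.subset fun t ht => ht.1.1)
    (fun t => vectorSpan ℝ (t : Set E)) (by
      intro t ht hle
      have := finiteDimensional_vectorSpan_of_finite ℝ t.finite_toSet
      have h0 : Module.finrank ℝ (vectorSpan ℝ (J.image B : Set E)) ≤ _ :=
        Submodule.finrank_mono hle
      have h1 := (K.indep ht.1.1).finrank_vectorSpan_coe_finset (K.nonempty_of_mem_faces ht.1.1)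
      have h2 := B.finrank_vectorSpan_image hJne
      have h3 := ht.2
      omega) u₀
  have htend : ∀ i, Tendsto (fun r : ℝ => (B.coord i).linear (u₀ + r • w)) (𝓝[>] 0)
      (𝓝 ((B.coord i).linear u₀)) := by
    intro i
    have : Tendsto (fun r : ℝ => (B.coord i).linear u₀ + r * (B.coord i).linear w) (𝓝 0)
        (𝓝 ((B.coord i).linear u₀ + 0 * (B.coord i).linear w)) :=
      Continuous.tendsto (by fun_prop) _
    simp only [map_add, map_smul, smul_eq_mul]
    rw [zero_mul, add_zero] at this
    exact this.mono_left nhdsWithin_le_nhds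
  have hevpos : ∀ᶠ r in 𝓝[>] (0 : ℝ), ∀ i ∈ J.erase p, 0 < (B.coord i).linear (u₀ + r • w) :=
    (Finset.eventually_all _).2 fun i hi => (htend i).eventually_const_lt
      (hpos₀ i (Finset.mem_of_mem_erase hi) (Finset.ne_of_mem_erase hi))
  obtain ⟨r, ⟨h1, h2⟩, h3⟩ := ((hev.and hevpos).and ((htend p).eventually_lt_const hp₀)).exists
  refine ⟨u₀ + r • w, ?_, h3, fun i hi hip => h2 i (Finset.mem_erase.2 ⟨hip, hi⟩), ?_⟩
  · exact B.mem_vectorSpan_image_iff.1 (W.add_mem hmem₀ (W.smul_mem _ hw))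
  · intro t ht hc
    rw [exists_isDirectionCoeff_iff]
    exact h1 t ⟨ht, hc⟩

end

end Geometry.SimplicialComplex

theorem AffineMap.map_sum_smul_of_sum_eq_one {E : Type*} [AddCommGroup E] [Module ℝ E]
    (f : E →ᵃ[ℝ] ℝ) {F : Finset E} {w : E → ℝ} (hw : ∑ i ∈ F, w i = 1) :
    f (∑ i ∈ F, w i • i) = ∑ i ∈ F, w i * f i := by
  have : ∀ i, f i = f.linear i + f 0 := fun i => by
    simpa using congrFun f.decomp i
  rw [Finset.sum_congr rfl fun i _ => congrArg (w i * ·) (this i), this, map_sum]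
  simp [mul_add, Finset.sum_add_distrib, ← Finset.sum_mul, hw]

namespace Geometry.SimplicialComplex

/-- A direction `u` parallel to the face of the simplex spanned by `J`, in general position with
respect to the faces of `K` in that face; `a` records its coefficients on top-dimensional faces. -/
structure IsSweepDirection {ι E : Type*} [AddCommGroup E] [Module ℝ E] (K : SimplicialComplex ℝ E)
    (B : AffineBasis ι ℝ E) (J : Finset ι) (u : E) (a : Finset E → E → ℝ) : Prop where
  linear_eq_zero : ∀ i ∉ J, (B.coord i).linear u = 0
  coeff : ∀ t ∈ K.facesIn B J, t.card = J.card → IsDirectionCoeff u t (a t)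
  coeff_ne_zero : ∀ t ∈ K.facesIn B J, t.card = J.card → ∀ x ∈ t, a t x ≠ 0
  card_eq : ∀ t ∈ K.facesIn B J, (∃ a, IsDirectionCoeff u t a) → t.card = J.card

theorem mem_facesIn_of_subset {ι E : Type*} [AddCommGroup E] [Module ℝ E]
    {K : SimplicialComplex ℝ E} {B : AffineBasis ι ℝ E} {J : Finset ι} {s t : Finset E}
    (ht : t ∈ K.facesIn B J) (hst : s ⊆ t) (hs : s.Nonempty) : s ∈ K.facesIn B J :=
  ⟨K.down_closed ht.1 hst hs, fun x hx => ht.2 x (hst hx)⟩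

theorem exists_isSweepDirection {ι E : Type*} [Fintype ι] [AddCommGroup E] [Module ℝ E]
    (K : SimplicialComplex ℝ E) (B : AffineBasis ι ℝ E) (hfin : K.faces.Finite) {J : Finset ι}
    {p : ι} (hp : p ∈ J) (hJ : 2 ≤ J.card) :
    ∃ u a, K.IsSweepDirection B J u a ∧ (B.coord p).linear u < 0 ∧
      ∀ i ∈ J, i ≠ p → 0 < (B.coord i).linear u := by
  classical
  obtain ⟨u, h0, hpu, hpos, hgen⟩ := exists_generic_direction (B := B) hfin hp hJ
  have hex : ∀ t : Finset E, ∃ a : E → ℝ, t ∈ K.facesIn B J → t.card = J.card →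
      IsDirectionCoeff u t a := by
    intro t
    by_cases h : t ∈ K.facesIn B J ∧ t.card = J.card
    · obtain ⟨a, ha⟩ := exists_isDirectionCoeff_of_card_eq ⟨p, hp⟩ h.1 h.2 h0
      exact ⟨a, fun _ _ => ha⟩
    · exact ⟨0, fun h1 h2 => absurd ⟨h1, h2⟩ h⟩
  choose a ha using hex
  refine ⟨u, a, ⟨h0, ha, ?_, ?_⟩, hpu, hpos⟩
  · intro t ht hc x hx hax
    have hce := Finset.card_erase_of_mem hx
    have hne : (t.erase x).Nonempty := by rw [← Finset.card_pos]; omega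
    refine hgen (t.erase x) (mem_facesIn_of_subset ht (Finset.erase_subset _ _) hne) (by omega)
      ⟨a t, (ha t ht hc).of_subset (Finset.erase_subset _ _) fun i hi hi' => ?_⟩
    by_cases h : i = x
    · rw [h, hax]
    · exact absurd (Finset.mem_erase.2 ⟨h, hi⟩) hi'
  · intro t ht h
    by_contra hc
    exact hgen t ht (lt_of_le_of_ne (card_le_of_mem_facesIn ⟨p, hp⟩ ht) hc) h

variable {ι E : Type*} [NormedAddCommGroup E] [NormedSpace ℝ E]
  {K : SimplicialComplex ℝ E} {B : AffineBasis ι ℝ E} {J : Finset ι} {u : E}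
  {a : Finset E → E → ℝ}

theorem coord_nonneg_of_mem_face (hspace : K.space = {x | ∀ i, 0 ≤ B.coord i x}) {t : Finset E}
    (ht : t ∈ K.faces) {x : E} (hx : x ∈ t) (i : ι) : 0 ≤ B.coord i x := by
  have : x ∈ K.space := K.subset_space ht hx
  rw [hspace] at this
  exact this i

theorem exists_coord_pos_of_direction_enters (hspace : K.space = {x | ∀ i, 0 ≤ B.coord i x})
    {T F : Finset E} (hT : T ∈ K.faces) {b : E → ℝ} (hb : IsDirectionCoeff u T b)
    (hpos : ∀ x ∈ T, x ∉ F → 0 < b x) {i : ι} (hi : (B.coord i).linear u < 0) :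
    ∃ x ∈ F, 0 < B.coord i x := by
  by_contra! h
  refine hi.not_ge ?_
  rw [hb.linear_apply]
  refine Finset.sum_nonneg fun x hx => ?_
  have h0 := coord_nonneg_of_mem_face hspace hT hx i
  by_cases hxF : x ∈ F
  · rw [le_antisymm (h x hxF) h0, mul_zero]
  · exact mul_nonneg (hpos x hx hxF).le h0

namespace IsSweepDirection

theorem neg (h : K.IsSweepDirection B J u a) :
    K.IsSweepDirection B J (-u) (fun t x => -a t x) where
  linear_eq_zero i hi := by rw [map_neg, h.linear_eq_zero i hi, neg_zero]
  coeff t ht hc := (h.coeff t ht hc).neg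
  coeff_ne_zero t ht hc x hx := neg_ne_zero.2 (h.coeff_ne_zero t ht hc x hx)
  card_eq t ht := fun ⟨b, hb⟩ => h.card_eq t ht ⟨_, by simpa using hb.neg⟩

theorem pos_of_notMem (h : K.IsSweepDirection B J u a) {T F : Finset E} (hT : T ∈ K.facesIn B J)
    (hc : T.card = J.card) (hN : T.filter (a T · < 0) ⊆ F) : ∀ x ∈ T, x ∉ F → 0 < a T x := by
  intro x hx hxF
  refine lt_of_le_of_ne (not_lt.1 fun hlt => hxF (hN (Finset.mem_filter.2 ⟨hx, hlt⟩))) ?_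
  exact (h.coeff_ne_zero T hT hc x hx).symm

theorem eq_of_subset (h : K.IsSweepDirection B J u a) {T T' F : Finset E} (hF : F.Nonempty)
    (hT : T ∈ K.facesIn B J) (hc : T.card = J.card)
    (hT' : T' ∈ K.facesIn B J) (hc' : T'.card = J.card) (hFT : F ⊆ T) (hFT' : F ⊆ T')
    (hN : T.filter (a T · < 0) ⊆ F) (hN' : T'.filter (a T' · < 0) ⊆ F) : T = T' :=
  K.eq_of_direction_enters hF hT.1 hT'.1 hFT hFT' (h.coeff T hT hc) (h.coeff T' hT' hc')
    (h.pos_of_notMem hT hc hN) (h.pos_of_notMem hT' hc' hN')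

theorem nonempty_filter_neg (h : K.IsSweepDirection B J u a) {T : Finset E}
    (hT : T ∈ K.facesIn B J) (hc : T.card = J.card) : (T.filter (a T · < 0)).Nonempty := by
  by_contra hne
  rw [Finset.not_nonempty_iff_eq_empty] at hne
  have hpos := h.pos_of_notMem (F := ∅) hT hc hne.subset
  exact (Finset.sum_pos (fun x hx => hpos x hx (Finset.notMem_empty x))
    (K.nonempty_of_mem_faces hT.1)).ne' (h.coeff T hT hc).1

theorem card_filter_neg_add (h : K.IsSweepDirection B J u a) {T : Finset E}
    (hT : T ∈ K.facesIn B J) (hc : T.card = J.card) :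
    (T.filter (a T · < 0)).card + (T.filter (-a T · < 0)).card = J.card := by
  rw [← hc, ← Finset.card_filter_add_card_filter_not (s := T) (a T · < 0)]
  congr 2
  refine Finset.filter_congr fun x hx => ?_
  rw [neg_lt_zero, not_lt]
  exact ⟨le_of_lt, fun h0 => lt_of_le_of_ne h0 (h.coeff_ne_zero T hT hc x hx).symm⟩

theorem exists_face [Fintype ι] (h : K.IsSweepDirection B J u a) (hfin : K.faces.Finite)
    (hspace : K.space = {x | ∀ i, 0 ≤ B.coord i x}) {F : Finset E} (hF : F ∈ K.facesIn B J)
    (hpos : ∀ i, (B.coord i).linear u < 0 → ∃ x ∈ F, 0 < B.coord i x) :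
    ∃ T ∈ K.facesIn B J, T.card = J.card ∧ F ⊆ T ∧ T.filter (a T · < 0) ⊆ F := by
  have hFne := K.nonempty_of_mem_faces hF.1
  have hcard : (0 : ℝ) < (F.card : ℝ)⁻¹ := by
    have := hFne.card_pos
    positivity
  have hsum : ∑ i ∈ F, (F.card : ℝ)⁻¹ = 1 := by
    have := hFne.card_pos
    rw [Finset.sum_const, nsmul_eq_mul]
    field_simp
  have hval : ∀ (i : ι) (ε : ℝ), B.coord i (∑ x ∈ F, (F.card : ℝ)⁻¹ • x + ε • u) =
      ∑ x ∈ F, (F.card : ℝ)⁻¹ * B.coord i x + ε * (B.coord i).linear u := by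
    intro i ε
    rw [← AffineMap.map_sum_smul_of_sum_eq_one _ hsum, add_comm, ← vadd_eq_add,
      AffineMap.map_vadd, map_smul, vadd_eq_add, smul_eq_mul, add_comm]
  have hev : ∀ᶠ ε in 𝓝[>] (0 : ℝ), ∑ x ∈ F, (F.card : ℝ)⁻¹ • x + ε • u ∈ K.space := by
    rw [hspace]
    simp only [Set.mem_ofPred_eq, hval]
    rw [eventually_all]
    intro i
    have hnn : ∀ x ∈ F, 0 ≤ (F.card : ℝ)⁻¹ * B.coord i x := fun x hx =>
      mul_nonneg hcard.le (coord_nonneg_of_mem_face hspace hF.1 hx i)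
    by_cases hi : (B.coord i).linear u < 0
    · obtain ⟨x, hx, hx0⟩ := hpos i hi
      have hlt : 0 < ∑ x ∈ F, (F.card : ℝ)⁻¹ * B.coord i x :=
        Finset.sum_pos' hnn ⟨x, hx, mul_pos hcard hx0⟩
      have : Tendsto (fun ε : ℝ => ∑ x ∈ F, (F.card : ℝ)⁻¹ * B.coord i x +
          ε * (B.coord i).linear u) (𝓝 0) (𝓝 (∑ x ∈ F, (F.card : ℝ)⁻¹ * B.coord i x +
          0 * (B.coord i).linear u)) := Continuous.tendsto (by fun_prop) _
      rw [zero_mul, add_zero] at this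
      exact ((this.mono_left nhdsWithin_le_nhds).eventually_const_lt hlt).mono fun _ => le_of_lt
    · filter_upwards [self_mem_nhdsWithin] with ε hε
      exact add_nonneg (Finset.sum_nonneg hnn) (mul_nonneg (le_of_lt hε) (not_lt.1 hi))
  obtain ⟨T, hT, hFT, b, hb, hbpos⟩ := K.exists_direction_enters hfin hF.1 hev
  have hTJ : T ∈ K.facesIn B J := by
    refine ⟨hT, fun x hx i hi => ?_⟩
    by_cases hxF : x ∈ F
    · exact hF.2 x hxF i hi
    have h0 := h.linear_eq_zero i hi
    rw [hb.linear_apply, Finset.sum_eq_zero_iff_of_nonneg] at h0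
    · exact (mul_eq_zero.1 (h0 x hx)).resolve_left (hbpos x hx hxF).ne'
    · intro y hy
      by_cases hyF : y ∈ F
      · rw [hF.2 y hyF i hi, mul_zero]
      · exact mul_nonneg (hbpos y hy hyF).le (coord_nonneg_of_mem_face hspace hT hy i)
  have hc := h.card_eq T hTJ ⟨b, hb⟩
  refine ⟨T, hTJ, hc, hFT, fun x hx => ?_⟩
  obtain ⟨hxT, hlt⟩ := Finset.mem_filter.1 hx
  by_contra hxF
  rw [(h.coeff T hTJ hc).eq_on (K.indep hT) hb x hxT] at hlt
  exact (hbpos x hxT hxF).not_gt hlt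

theorem card_filter_card_eq_one [Fintype ι] [DecidableEq ι] (h : K.IsSweepDirection B J u a)
    (hfin : K.faces.Finite) (hspace : K.space = {x | ∀ i, 0 ≤ B.coord i x})
    {V : Finset E} (hV : ∀ x, x ∈ V ↔ {x} ∈ K.faces)
    {𝒯 : Finset (Finset E)} (h𝒯 : ∀ t, t ∈ 𝒯 ↔ t ∈ K.facesIn B J ∧ t.card = J.card) :
    (𝒯.filter fun T => (T.filter (a T · < 0)).card = 1).card =
      (V.filter fun x => (∀ i ∉ J, B.coord i x = 0) ∧
        ∀ i, (B.coord i).linear u < 0 → 0 < B.coord i x).card := by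
  classical
  have key : ∀ x ∈ V.filter fun x => (∀ i ∉ J, B.coord i x = 0) ∧
      ∀ i, (B.coord i).linear u < 0 → 0 < B.coord i x,
      ∃ T ∈ 𝒯, T.filter (a T · < 0) = {x} := by
    intro x hx
    simp only [Finset.mem_filter, hV] at hx
    obtain ⟨T, hT, hc, -, hN⟩ := h.exists_face hfin hspace (F := {x})
      ⟨hx.1, by simpa using hx.2.1⟩ (by simpa using hx.2.2)
    exact ⟨T, (h𝒯 T).2 ⟨hT, hc⟩,
      (Finset.Nonempty.subset_singleton_iff (h.nonempty_filter_neg hT hc)).1 hN⟩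
  choose! f hf1 hf2 using key
  symm
  refine Finset.card_bij (fun x _ => f x) ?_ ?_ ?_
  · intro x hx
    exact Finset.mem_filter.2 ⟨hf1 x hx, by rw [hf2 x hx, Finset.card_singleton]⟩
  · intro x hx y hy hxy
    have : ({x} : Finset E) = {y} := by rw [← hf2 x hx, ← hf2 y hy, hxy]
    exact Finset.singleton_injective this
  · intro T hT
    obtain ⟨hT𝒯, hc1⟩ := Finset.mem_filter.1 hT
    obtain ⟨hT, hc⟩ := (h𝒯 T).1 hT𝒯
    obtain ⟨x, hx⟩ := Finset.card_eq_one.1 hc1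
    have hxT : x ∈ T := Finset.filter_subset _ _ (hx ▸ Finset.mem_singleton_self x)
    have hxV : x ∈ V.filter fun x => (∀ i ∉ J, B.coord i x = 0) ∧
        ∀ i, (B.coord i).linear u < 0 → 0 < B.coord i x := by
      refine Finset.mem_filter.2 ⟨(hV x).2 (K.down_closed hT.1 (by simpa using hxT) (by simp)),
        hT.2 x hxT, fun i hi => ?_⟩
      simpa using exists_coord_pos_of_direction_enters hspace hT.1 (h.coeff T hT hc)
        (h.pos_of_notMem hT hc hx.subset) hi
    refine ⟨x, hxV, ?_⟩
    obtain ⟨hf, hfc⟩ := (h𝒯 _).1 (hf1 x hxV)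
    have hxf : x ∈ f x := Finset.filter_subset _ _ ((hf2 x hxV).symm ▸ Finset.mem_singleton_self x)
    exact h.eq_of_subset (Finset.singleton_nonempty x) hf hfc hT hc (by simpa using hxf)
      (by simpa using hxT) (hf2 x hxV).subset hx.subset

theorem card_edges_ge [DecidableEq ι] (h : K.IsSweepDirection B J u a)
    (hspace : K.space = {x | ∀ i, 0 ≤ B.coord i x})
    {p : ι} (hp : (B.coord p).linear u < 0)
    {𝒯 : Finset (Finset E)} (h𝒯 : ∀ t, t ∈ 𝒯 ↔ t ∈ K.facesIn B J ∧ t.card = J.card)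
    {𝓔 𝓔' : Finset (Finset E)} (h𝓔 : ∀ t, t ∈ 𝓔 ↔ t ∈ K.facesIn B J ∧ t.card = 2)
    (h𝓔' : ∀ t, t ∈ 𝓔' ↔ t ∈ K.facesIn B (J.erase p) ∧ t.card = 2) :
    𝓔'.card + (J.card - 1) * (𝒯.filter fun T => (T.filter (a T · < 0)).card = 1).card +
      (𝒯.filter fun T => (T.filter (a T · < 0)).card = 2).card ≤ 𝓔.card := by
  classical
  set c : Finset E → Finset (Finset E) := fun T =>
    (T.powersetCard 2).filter fun e => T.filter (a T · < 0) ⊆ e with hcdef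
  have hmem : ∀ T e, e ∈ c T ↔ (e ⊆ T ∧ e.card = 2) ∧ T.filter (a T · < 0) ⊆ e := fun T e => by
    simp only [hcdef, Finset.mem_filter, Finset.mem_powersetCard]
  have hne : ∀ e : Finset E, e.card = 2 → e.Nonempty := fun e he => by
    rw [← Finset.card_pos]; omega
  have hdisj : (𝒯 : Set (Finset E)).PairwiseDisjoint c := by
    intro T hT T' hT' hTT'
    refine Finset.disjoint_left.2 fun e he he' => hTT' ?_
    obtain ⟨hT, hc⟩ := (h𝒯 T).1 hT
    obtain ⟨hT', hc'⟩ := (h𝒯 T').1 hT'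
    rw [hmem] at he he'
    exact h.eq_of_subset (hne e he.1.2) hT hc hT' hc' he.1.1 he'.1.1 he.2 he'.2
  have hdisj' : Disjoint 𝓔' (𝒯.biUnion c) := by
    refine Finset.disjoint_left.2 fun e he he' => ?_
    obtain ⟨T, hT, heT⟩ := Finset.mem_biUnion.1 he'
    obtain ⟨hT, hc⟩ := (h𝒯 T).1 hT
    rw [hmem] at heT
    obtain ⟨x, hx, hx0⟩ := exists_coord_pos_of_direction_enters hspace hT.1 (h.coeff T hT hc)
      (h.pos_of_notMem hT hc heT.2) hp
    exact hx0.ne' (((h𝓔' e).1 he).1.2 x hx p (Finset.notMem_erase p J))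
  have hsub : 𝓔' ∪ 𝒯.biUnion c ⊆ 𝓔 := by
    refine Finset.union_subset (fun e he => ?_) (Finset.biUnion_subset.2 fun T hT e he => ?_)
    · obtain ⟨he, hc⟩ := (h𝓔' e).1 he
      exact (h𝓔 e).2 ⟨⟨he.1, fun x hx i hi => he.2 x hx i fun h' => hi (Finset.mem_of_mem_erase h')⟩,
        hc⟩
    · rw [hmem] at he
      exact (h𝓔 e).2 ⟨mem_facesIn_of_subset ((h𝒯 T).1 hT).1 he.1.1 (hne e he.1.2), he.1.2⟩
  have hcount : ∀ T ∈ 𝒯, ((if (T.filter (a T · < 0)).card = 1 then J.card - 1 else 0) +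
      if (T.filter (a T · < 0)).card = 2 then 1 else 0) ≤ (c T).card := by
    intro T hT
    obtain ⟨hT, hc⟩ := (h𝒯 T).1 hT
    by_cases h1 : (T.filter (a T · < 0)).card = 1
    · obtain ⟨x, hx⟩ := Finset.card_eq_one.1 h1
      have hxT : x ∈ T := Finset.filter_subset _ _ (hx ▸ Finset.mem_singleton_self x)
      rw [if_pos h1, if_neg (by omega), add_zero, ← hc, ← Finset.card_erase_of_mem hxT]
      refine Finset.card_le_card_of_injOn (fun y => {x, y}) (fun y hy => ?_) ?_
      · obtain ⟨hyx, hyT⟩ := Finset.mem_erase.1 hy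
        rw [Finset.mem_coe, hmem, hx]
        refine ⟨⟨?_, Finset.card_pair hyx.symm⟩, by simp⟩
        simp [Finset.insert_subset_iff, hxT, hyT]
      · intro y hy z hz hyz
        have hyx := Finset.ne_of_mem_erase (Finset.mem_coe.1 hy)
        have : y ∈ ({x, z} : Finset E) := by
          have e : ({x, y} : Finset E) = {x, z} := hyz
          rw [← e]; simp
        simpa [hyx] using this
    · rw [if_neg h1, zero_add]
      split_ifs with h2
      · exact Finset.card_pos.2 ⟨_, (hmem T _).2 ⟨⟨Finset.filter_subset _ _, h2⟩, subset_rfl⟩⟩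
      · exact Nat.zero_le _
  calc _ = 𝓔'.card + ∑ T ∈ 𝒯, ((if (T.filter (a T · < 0)).card = 1 then J.card - 1 else 0) +
      if (T.filter (a T · < 0)).card = 2 then 1 else 0) := by
        rw [Finset.sum_add_distrib, Finset.card_filter _ 𝒯, Finset.card_filter _ 𝒯,
          Finset.mul_sum, add_assoc]
        simp
    _ ≤ 𝓔'.card + ∑ T ∈ 𝒯, (c T).card := by
        gcongr with T hT
        exact hcount T hT
    _ = (𝓔' ∪ 𝒯.biUnion c).card := by
        rw [Finset.card_union_of_disjoint hdisj', Finset.card_biUnion hdisj]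
    _ ≤ 𝓔.card := Finset.card_le_card hsub

end IsSweepDirection

end Geometry.SimplicialComplex

/-- The set of barycentric coordinates that are positive at `x`. -/
noncomputable def AffineBasis.posCoords {ι E : Type*} [Fintype ι] [AddCommGroup E] [Module ℝ E]
    (B : AffineBasis ι ℝ E) (x : E) : Finset ι :=
  Finset.univ.filter fun i => 0 < B.coord i x

namespace AffineBasis

variable {ι E : Type*} [Fintype ι] [AddCommGroup E] [Module ℝ E] (B : AffineBasis ι ℝ E)

theorem mem_posCoords {x : E} {i : ι} : i ∈ B.posCoords x ↔ 0 < B.coord i x := by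
  simp [posCoords]

theorem coord_eq_zero_of_notMem_posCoords {x : E} (h0 : ∀ i, 0 ≤ B.coord i x) {i : ι}
    (hi : i ∉ B.posCoords x) : B.coord i x = 0 :=
  le_antisymm (not_lt.1 fun h => hi (B.mem_posCoords.2 h)) (h0 i)

theorem posCoords_subset_iff {x : E} (h0 : ∀ i, 0 ≤ B.coord i x) {J : Finset ι} :
    B.posCoords x ⊆ J ↔ ∀ i ∉ J, B.coord i x = 0 := by
  refine ⟨fun h i hi => B.coord_eq_zero_of_notMem_posCoords h0 fun h' => hi (h h'),
    fun h i hi => ?_⟩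
  by_contra hiJ
  exact (B.mem_posCoords.1 hi).ne' (h i hiJ)

theorem posCoords_nonempty (x : E) : (B.posCoords x).Nonempty := by
  by_contra hne
  have h : ∀ i, B.coord i x ≤ 0 := fun i => not_lt.1 fun h => hne ⟨i, B.mem_posCoords.2 h⟩
  have h1 := B.sum_coord_apply_eq_one x
  have h2 := Finset.sum_nonpos fun i (_ : i ∈ Finset.univ) => h i
  linarith

theorem posCoords_apply (i : ι) : B.posCoords (B i) = {i} := by
  classical
  ext j
  rw [B.mem_posCoords, B.coord_apply]
  by_cases h : j = i <;> simp [h]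

theorem eq_sum_of_posCoords_subset {x : E} (h0 : ∀ i, 0 ≤ B.coord i x) {J : Finset ι}
    (h : B.posCoords x ⊆ J) : x = ∑ i ∈ J, B.coord i x • B i := by
  conv_lhs => rw [← B.linear_combination_coord_eq_self x]
  exact (Finset.sum_subset (Finset.subset_univ J) fun i _ hi => by
    rw [(B.posCoords_subset_iff h0).1 h i hi, zero_smul]).symm

theorem sum_coord_eq_one_of_posCoords_subset {x : E} (h0 : ∀ i, 0 ≤ B.coord i x) {J : Finset ι}
    (h : B.posCoords x ⊆ J) : ∑ i ∈ J, B.coord i x = 1 := by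
  rw [← B.sum_coord_apply_eq_one x]
  exact (Finset.sum_subset (Finset.subset_univ J) fun i _ hi =>
    (B.posCoords_subset_iff h0).1 h i hi)

theorem posCoords_eq_singleton_iff {x : E} (h0 : ∀ i, 0 ≤ B.coord i x) {i : ι} :
    B.posCoords x = {i} ↔ x = B i := by
  refine ⟨fun h => ?_, fun h => h ▸ B.posCoords_apply i⟩
  have h1 := B.sum_coord_eq_one_of_posCoords_subset h0 h.subset
  have h2 := B.eq_sum_of_posCoords_subset h0 h.subset
  rw [Finset.sum_singleton] at h1 h2
  rwa [h1, one_smul] at h2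

theorem posCoords_eq_pair_of_mem_convexHull [DecidableEq ι] {x : E} {i j : ι} (hij : i ≠ j)
    (hx : x ∈ convexHull ℝ ({B i, B j} : Set E)) (hi : x ≠ B i) (hj : x ≠ B j) :
    B.posCoords x = {i, j} := by
  rw [convexHull_pair] at hx
  obtain ⟨r, s, hr, hs, hrs, rfl⟩ := hx
  have hr' : 0 < r := lt_of_le_of_ne hr fun h => hj <| by
    rw [← h, show s = 1 by linarith]; simp
  have hs' : 0 < s := lt_of_le_of_ne hs fun h => hi <| by
    rw [← h, show r = 1 by linarith]; simp
  ext k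
  rw [B.mem_posCoords, Convex.combo_affine_apply hrs, B.coord_apply, B.coord_apply]
  by_cases hki : k = i
  · subst hki; simp [hij, hr']
  · by_cases hkj : k = j
    · subst hkj; simp [hij.symm, hs']
    · simp [hki, hkj]

end AffineBasis

theorem AffineBasis.coord_nonneg_of_mem_convexHull_image {ι E : Type*} [AddCommGroup E]
    [Module ℝ E] (B : AffineBasis ι ℝ E) {J : Finset ι} {x : E}
    (hx : x ∈ convexHull ℝ (B '' J)) (i : ι) : 0 ≤ B.coord i x := by
  classical
  have h : convexHull ℝ (B '' J) ⊆ B.coord i ⁻¹' Set.Ici 0 := by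
    refine convexHull_min ?_ ((convex_Ici 0).affine_preimage (B.coord i))
    rintro _ ⟨j, -, rfl⟩
    rw [Set.mem_preimage, B.coord_apply]
    split_ifs <;> simp
  exact h hx

theorem AffineBasis.coord_eq_zero_of_mem_convexHull_image {ι E : Type*} [AddCommGroup E]
    [Module ℝ E] (B : AffineBasis ι ℝ E) {J : Finset ι} {x : E}
    (hx : x ∈ convexHull ℝ (B '' J)) {i : ι} (hi : i ∉ J) : B.coord i x = 0 := by
  have h : convexHull ℝ (B '' J) ⊆ B.coord i ⁻¹' {0} := by
    refine convexHull_min ?_ ((convex_singleton 0).affine_preimage (B.coord i))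
    rintro _ ⟨j, hj, rfl⟩
    exact B.coord_apply_ne (ne_of_mem_of_not_mem (Finset.mem_coe.1 hj) hi).symm
  exact h hx

theorem exists_one_lt_lineMap_mem_of_mem_intrinsicInterior {E : Type*} [NormedAddCommGroup E]
    [NormedSpace ℝ E] {s : Set E} {x y : E} (hx : x ∈ intrinsicInterior ℝ s) (hy : y ∈ s) :
    ∃ r > (1 : ℝ), AffineMap.lineMap y x r ∈ s := by
  obtain ⟨z, hz, rfl⟩ := mem_intrinsicInterior.1 hx
  let f : ℝ → affineSpan ℝ s := fun r =>
    ⟨AffineMap.lineMap y (z : E) r, AffineMap.lineMap_mem r (subset_affineSpan ℝ s hy) z.2⟩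
  have hf : Continuous f := Continuous.subtype_mk AffineMap.lineMap_continuous _
  have hf1 : f 1 = z := Subtype.ext (AffineMap.lineMap_apply_one y (z : E))
  have hev : ∀ᶠ r in 𝓝 (1 : ℝ), f r ∈ interior ((↑) ⁻¹' s : Set (affineSpan ℝ s)) :=
    hf.continuousAt.eventually_mem (by rw [hf1]; exact isOpen_interior.mem_nhds hz)
  obtain ⟨r, hr, hr1⟩ := ((hev.filter_mono nhdsWithin_le_nhds).and
    (self_mem_nhdsWithin (s := Set.Ioi (1 : ℝ)))).exists
  have hfr : f r ∈ ((↑) ⁻¹' s : Set (affineSpan ℝ s)) := interior_subset hr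
  exact ⟨r, hr1, hfr⟩

theorem AffineBasis.posCoords_eq_of_mem_intrinsicInterior {ι E : Type*} [Fintype ι]
    [DecidableEq ι] [NormedAddCommGroup E] [NormedSpace ℝ E] (B : AffineBasis ι ℝ E)
    {J : Finset ι} {x : E} (hx : x ∈ intrinsicInterior ℝ (convexHull ℝ (B '' J))) :
    B.posCoords x = J := by
  have hx' := intrinsicInterior_subset hx
  refine Finset.Subset.antisymm ((B.posCoords_subset_iff
    (B.coord_nonneg_of_mem_convexHull_image hx')).2 fun i hi =>
      B.coord_eq_zero_of_mem_convexHull_image hx' hi) fun i hi => B.mem_posCoords.2 ?_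
  obtain ⟨r, hr, hm⟩ := exists_one_lt_lineMap_mem_of_mem_intrinsicInterior hx
    (subset_convexHull ℝ _ (Set.mem_image_of_mem B (Finset.mem_coe.2 hi)))
  have h := B.coord_nonneg_of_mem_convexHull_image hm i
  rw [AffineMap.apply_lineMap, B.coord_apply_eq, AffineMap.lineMap_apply_ring] at h
  by_contra hc
  nlinarith

namespace Geometry.SimplicialComplex

theorem eq_of_pair_mem_faces {ι E : Type*} [Fintype ι] [DecidableEq ι] [DecidableEq E]
    [AddCommGroup E] [Module ℝ E] {K : SimplicialComplex ℝ E} {B : AffineBasis ι ℝ E}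
    {i j : ι} (hij : i ≠ j) {x y : E} (hx0 : ∀ i, 0 ≤ B.coord i x) (hy0 : ∀ i, 0 ≤ B.coord i y)
    (hx : B.posCoords x = {i, j}) (hy : B.posCoords y = {i, j})
    (hxK : {B i, x} ∈ K.faces) (hyK : {B i, y} ∈ K.faces) : x = y := by
  wlog hle : B.coord j x ≤ B.coord j y generalizing x y
  · exact (this hy0 hx0 hy hx hyK hxK (le_of_not_ge hle)).symm
  have ex := B.eq_sum_of_posCoords_subset hx0 hx.subset
  have ey := B.eq_sum_of_posCoords_subset hy0 hy.subset
  have sx := B.sum_coord_eq_one_of_posCoords_subset hx0 hx.subset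
  have sy := B.sum_coord_eq_one_of_posCoords_subset hy0 hy.subset
  rw [Finset.sum_pair hij] at ex ey sx sy
  have hpx : 0 < B.coord j x := B.mem_posCoords.1 (by simp [hx])
  have hpy : 0 < B.coord j y := B.mem_posCoords.1 (by simp [hy])
  set s := B.coord j x / B.coord j y with hs
  have hsy : s * B.coord j y = B.coord j x := div_mul_cancel₀ _ hpy.ne'
  have hsi : 1 - s + s * B.coord i y = B.coord i x := by
    rw [eq_sub_of_add_eq sy, eq_sub_of_add_eq sx, ← hsy]; ring
  have hmem : x ∈ convexHull ℝ (({B i, y} : Finset E) : Set E) := by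
    rw [Finset.coe_pair, convexHull_pair]
    refine ⟨1 - s, s, sub_nonneg.2 ((div_le_one hpy).2 hle), (div_pos hpx hpy).le, by ring, ?_⟩
    calc (1 - s) • B i + s • y = (1 - s + s * B.coord i y) • B i + (s * B.coord j y) • B j := by
          conv_lhs => rw [ey]
          module
      _ = x := by rw [hsi, hsy, ← ex]
  have hxv : x ∈ K.vertices := K.down_closed hxK (by simp) (by simp)
  rcases Finset.mem_insert.1 ((vertex_mem_convexHull_iff hxv hyK).1 hmem) with h | h
  · rw [h, B.coord_apply_ne hij.symm] at hpx
    exact absurd hpx (lt_irrefl _)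
  · exact Finset.mem_singleton.1 h

/-- Every vertex in the relative interior of an edge of the simplex forces a pair of vertices that
is not a face of `K`. -/
theorem card_edges_add_card_le_choose {ι E : Type*} [Fintype ι] [LinearOrder ι]
    [AddCommGroup E] [Module ℝ E] {K : SimplicialComplex ℝ E} {B : AffineBasis ι ℝ E}
    (hB : ∀ i, {B i} ∈ K.faces) {V : Finset E} (hV : ∀ x, x ∈ V ↔ {x} ∈ K.faces)
    (h0 : ∀ x ∈ V, ∀ i, 0 ≤ B.coord i x)
    {𝓔 : Finset (Finset E)} (h𝓔 : ∀ t, t ∈ 𝓔 → t ∈ K.faces ∧ t.card = 2) :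
    𝓔.card + (V.filter fun x => (B.posCoords x).card = 2).card ≤ V.card.choose 2 := by
  classical
  have hpair : ∀ x ∈ V.filter fun x => (B.posCoords x).card = 2,
      ∃ ij : ι × ι, ij.1 < ij.2 ∧ B.posCoords x = {ij.1, ij.2} := by
    intro x hx
    obtain ⟨i, j, hij, h⟩ := Finset.card_eq_two.1 (Finset.mem_filter.1 hx).2
    rcases lt_or_gt_of_ne hij with hlt | hlt
    · exact ⟨(i, j), hlt, h⟩
    · exact ⟨(j, i), hlt, by rw [h, Finset.pair_comm]⟩
  have := B.nonempty
  choose! f hlt hf using hpair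
  have hsingle : ∀ i, (B.posCoords (B i)).card = 1 := fun i => by
    rw [B.posCoords_apply, Finset.card_singleton]
  have hneB : ∀ {x}, x ∈ (V.filter fun x => (B.posCoords x).card = 2) → ∀ i, x ≠ B i := by
    rintro x hx i rfl
    have := (Finset.mem_filter.1 hx).2
    rw [hsingle] at this
    omega
  set g : E → Finset E := fun x =>
    if {B (f x).1, x} ∈ K.faces then {B (f x).1, B (f x).2} else {B (f x).1, x} with hg
  have hgcard : ∀ x ∈ V.filter fun x => (B.posCoords x).card = 2,
      g x ∈ V.powersetCard 2 \ 𝓔 := by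
    intro x hx
    have hxV := (Finset.mem_filter.1 hx).1
    have hBV : ∀ i, B i ∈ V := fun i => (hV _).2 (hB i)
    simp only [hg]
    split_ifs with h
    · refine Finset.mem_sdiff.2 ⟨Finset.mem_powersetCard.2 ⟨?_, Finset.card_pair
        (B.ind.injective.ne (hlt x hx).ne)⟩, fun hmem => ?_⟩
      · simp [Finset.insert_subset_iff, hBV]
      · have hface := (h𝓔 _ hmem).1
        have ex := B.eq_sum_of_posCoords_subset (h0 x hxV) (hf x hx).subset
        have sx := B.sum_coord_eq_one_of_posCoords_subset (h0 x hxV) (hf x hx).subset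
        rw [Finset.sum_pair (hlt x hx).ne] at ex sx
        have hc : x ∈ convexHull ℝ (({B (f x).1, B (f x).2} : Finset E) : Set E) := by
          rw [Finset.coe_pair, convexHull_pair]
          exact ⟨_, _, h0 x hxV _, h0 x hxV _, sx, ex.symm⟩
        rcases Finset.mem_insert.1 ((vertex_mem_convexHull_iff ((hV x).1 hxV) hface).1 hc)
          with h' | h'
        · exact hneB hx _ h'
        · exact hneB hx _ (Finset.mem_singleton.1 h')
    · refine Finset.mem_sdiff.2 ⟨Finset.mem_powersetCard.2 ⟨?_, Finset.card_pair
        (hneB hx _).symm⟩, fun hmem => h (h𝓔 _ hmem).1⟩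
      simp [Finset.insert_subset_iff, hBV, hxV]
  have hginj : Set.InjOn g (V.filter fun x => (B.posCoords x).card = 2) := by
    intro x hx y hy hxy
    have hx := Finset.mem_coe.1 hx
    have hy := Finset.mem_coe.1 hy
    simp only [hg] at hxy
    split_ifs at hxy with h1 h2 h2
    · have e : f x = f y := by
        have hsub : ({(f x).1, (f x).2} : Finset ι) = {(f y).1, (f y).2} := by
          refine Finset.image_injective B.ind.injective ?_
          simpa only [Finset.image_insert, Finset.image_singleton] using hxy
        have m1 : (f x).1 ∈ ({(f y).1, (f y).2} : Finset ι) := by rw [← hsub]; simp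
        have m2 : (f x).2 ∈ ({(f y).1, (f y).2} : Finset ι) := by rw [← hsub]; simp
        have l1 := hlt x hx
        have l2 := hlt y hy
        simp only [Finset.mem_insert, Finset.mem_singleton] at m1 m2
        rcases m1 with m1 | m1 <;> rcases m2 with m2 | m2
        · rw [m1, m2] at l1; exact absurd l1 (lt_irrefl _)
        · exact Prod.ext m1 m2
        · rw [m1, m2] at l1; exact absurd l1 l2.not_gt
        · rw [m1, m2] at l1; exact absurd l1 (lt_irrefl _)
      rw [← e] at h2
      exact eq_of_pair_mem_faces (hlt x hx).ne (h0 x (Finset.mem_filter.1 hx).1)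
        (h0 y (Finset.mem_filter.1 hy).1) (hf x hx) (by rw [hf y hy, e]) h1 h2
    · have : y ∈ ({B (f x).1, B (f x).2} : Finset E) := by rw [hxy]; simp
      simp [hneB hy] at this
    · have : x ∈ ({B (f y).1, B (f y).2} : Finset E) := by rw [← hxy]; simp
      simp [hneB hx] at this
    · have : x ∈ ({B (f y).1, y} : Finset E) := by rw [← hxy]; simp
      simpa [hneB hx] using this
  have hsub𝓔 : 𝓔 ⊆ V.powersetCard 2 := fun t ht => by
    refine Finset.mem_powersetCard.2 ⟨fun x hx => (hV x).2 ?_, (h𝓔 t ht).2⟩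
    exact K.down_closed (h𝓔 t ht).1 (by simpa using hx) (by simp)
  have h1 := Finset.card_le_card_of_injOn g hgcard hginj
  have h2 := Finset.card_sdiff_add_card_eq_card hsub𝓔
  rw [Finset.card_powersetCard] at h2
  omega

/-- The faces of `K` with `n` vertices contained in the face of the simplex spanned by `J`. -/
noncomputable def facesInOfCard {ι E : Type*} [AddCommGroup E] [Module ℝ E]
    (K : SimplicialComplex ℝ E) (B : AffineBasis ι ℝ E) (hfin : K.faces.Finite) (J : Finset ι)
    (n : ℕ) : Finset (Finset E) :=
  (hfin.subset fun t (ht : t ∈ K.facesIn B J ∧ t.card = n) => ht.1.1).toFinset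

theorem mem_facesInOfCard {ι E : Type*} [AddCommGroup E] [Module ℝ E]
    {K : SimplicialComplex ℝ E} {B : AffineBasis ι ℝ E} {hfin : K.faces.Finite} {J : Finset ι}
    {n : ℕ} {t : Finset E} :
    t ∈ K.facesInOfCard B hfin J n ↔ t ∈ K.facesIn B J ∧ t.card = n :=
  Set.Finite.mem_toFinset _

/-- Sweeping the face of the simplex spanned by `J` in the direction away from its vertex `p`. -/
theorem exists_sweep_numbers {ι E : Type*} [Fintype ι] [DecidableEq ι] [NormedAddCommGroup E]
    [NormedSpace ℝ E] {K : SimplicialComplex ℝ E} {B : AffineBasis ι ℝ E} (hfin : K.faces.Finite)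
    (hspace : K.space = {x | ∀ i, 0 ≤ B.coord i x})
    {V : Finset E} (hV : ∀ x, x ∈ V ↔ {x} ∈ K.faces) {J : Finset ι} {p : ι} (hp : p ∈ J)
    (hJ : 2 ≤ J.card) :
    ∃ h : ℕ → ℕ, (K.facesInOfCard B hfin J J.card).card = ∑ j ∈ Finset.Icc 1 (J.card - 1), h j ∧
      h 1 = (V.filter fun x => B.posCoords x ⊆ J ∧ p ∈ B.posCoords x).card ∧
      h (J.card - 1) =
        (V.filter fun x => B.posCoords x ⊆ J ∧ J.erase p ⊆ B.posCoords x).card ∧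
      (K.facesInOfCard B hfin (J.erase p) 2).card + (J.card - 1) * h 1 + h 2 ≤
        (K.facesInOfCard B hfin J 2).card := by
  classical
  obtain ⟨u, a, hu, hpu, hpos⟩ := K.exists_isSweepDirection B hfin hp hJ
  have hmem : ∀ (J : Finset ι) (n : ℕ) (t : Finset E),
      t ∈ K.facesInOfCard B hfin J n ↔ t ∈ K.facesIn B J ∧ t.card = n :=
    fun _ _ _ => mem_facesInOfCard
  have h0 : ∀ x ∈ V, ∀ i, 0 ≤ B.coord i x := fun x hx i =>
    coord_nonneg_of_mem_face hspace ((hV x).1 hx) (Finset.mem_singleton_self x) i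
  have hneg : ∀ i, (B.coord i).linear u < 0 ↔ i = p := fun i => by
    refine ⟨fun h => ?_, fun h => h ▸ hpu⟩
    by_contra hip
    by_cases hi : i ∈ J
    · exact (hpos i hi hip).not_gt h
    · exact h.ne (hu.linear_eq_zero i hi)
  have hneg' : ∀ i, (B.coord i).linear (-u) < 0 ↔ i ∈ J.erase p := fun i => by
    rw [map_neg, neg_lt_zero, Finset.mem_erase]
    refine ⟨fun h => ⟨fun hip => ?_, ?_⟩, fun h => hpos i h.2 h.1⟩
    · subst hip; exact hpu.not_gt h
    · by_contra hi; exact h.ne' (hu.linear_eq_zero i hi)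
  obtain ⟨𝒯, h𝒯⟩ : ∃ 𝒯, 𝒯 = K.facesInOfCard B hfin J J.card := ⟨_, rfl⟩
  have h𝒯mem : ∀ t, t ∈ 𝒯 ↔ t ∈ K.facesIn B J ∧ t.card = J.card := h𝒯 ▸ hmem J _
  have hcompl : ∀ T ∈ 𝒯, (T.filter (a T · < 0)).card + (T.filter (-a T · < 0)).card = J.card :=
    fun T hT => hu.card_filter_neg_add ((h𝒯mem T).1 hT).1 ((h𝒯mem T).1 hT).2
  obtain ⟨h, hh⟩ : ∃ h : ℕ → ℕ, ∀ j, h j =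
      (𝒯.filter fun T => (T.filter (a T · < 0)).card = j).card := ⟨_, fun _ => rfl⟩
  have hedges := hu.card_edges_ge hspace hpu h𝒯mem (hmem J 2) (hmem (J.erase p) 2)
  rw [← h𝒯]
  refine ⟨h, ?_, ?_, ?_, by rw [hh, hh]; exact hedges⟩
  · simp only [hh]
    refine Finset.card_eq_sum_card_fiberwise fun T hT => ?_
    have hT' := (h𝒯mem T).1 hT
    have h1 := (hu.nonempty_filter_neg hT'.1 hT'.2).card_pos
    have h2 := (hu.neg.nonempty_filter_neg hT'.1 hT'.2).card_pos
    have h3 := hcompl T hT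
    rw [Finset.coe_Icc, Set.mem_Icc]
    omega
  · rw [hh, hu.card_filter_card_eq_one hfin hspace hV h𝒯mem]
    refine congrArg Finset.card (Finset.filter_congr fun x hx => ?_)
    rw [B.posCoords_subset_iff (h0 x hx), B.mem_posCoords]
    simp only [hneg, forall_eq]
  · have e : (𝒯.filter fun T => (T.filter (a T · < 0)).card = J.card - 1) =
        𝒯.filter fun T => (T.filter (-a T · < 0)).card = 1 := by
      refine Finset.filter_congr fun T hT => ?_
      have := hcompl T hT
      omega
    rw [hh, e, hu.neg.card_filter_card_eq_one hfin hspace hV h𝒯mem]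
    refine congrArg Finset.card (Finset.filter_congr fun x hx => ?_)
    rw [B.posCoords_subset_iff (h0 x hx), Finset.subset_iff]
    simp only [hneg', B.mem_posCoords]

end Geometry.SimplicialComplex

theorem indicator_identity_of_finset_fin_four : ∀ s : Finset (Fin 4), s.Nonempty →
    1 + (if s.card = 2 then 1 else 0) + (if s.card = 3 then 1 else 0)
      + (if s ⊆ Finset.univ ∧ Finset.univ.erase 3 ⊆ s then 1 else 0)
      + (if s = {2} then 1 else 0) + (if s = {3} then 1 else 0)
    = (if s ⊆ {0, 1} ∧ 1 ∈ s then 1 else 0) + 2 * (if s ⊆ {0, 1, 2} ∧ 2 ∈ s then 1 else 0)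
      + (if s ⊆ {0, 1, 2} ∧ Finset.erase {0, 1, 2} 2 ⊆ s then 1 else 0)
      + 2 * (if s ⊆ Finset.univ ∧ 3 ∈ s then 1 else 0) + (if s = {0} then 1 else 0) := by
  decide

theorem card_filter_identity_of_finset_fin_four {α : Type*} (V : Finset α) (f : α → Finset (Fin 4))
    (hf : ∀ x ∈ V, (f x).Nonempty) :
    V.card + (V.filter fun x => (f x).card = 2).card + (V.filter fun x => (f x).card = 3).card
      + (V.filter fun x => f x ⊆ Finset.univ ∧ Finset.univ.erase 3 ⊆ f x).card
      + (V.filter fun x => f x = {2}).card + (V.filter fun x => f x = {3}).card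
    = (V.filter fun x => f x ⊆ {0, 1} ∧ 1 ∈ f x).card
      + 2 * (V.filter fun x => f x ⊆ {0, 1, 2} ∧ 2 ∈ f x).card
      + (V.filter fun x => f x ⊆ {0, 1, 2} ∧ Finset.erase {0, 1, 2} 2 ⊆ f x).card
      + 2 * (V.filter fun x => f x ⊆ Finset.univ ∧ 3 ∈ f x).card
      + (V.filter fun x => f x = {0}).card := by
  simp only [Finset.card_filter, Finset.card_eq_sum_ones V, Finset.mul_sum,
    ← Finset.sum_add_distrib]
  exact Finset.sum_congr rfl fun x hx => indicator_identity_of_finset_fin_four (f x) (hf x hx)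

namespace Geometry.SimplicialComplex

theorem card_facets_add_le {E : Type*} [NormedAddCommGroup E] [NormedSpace ℝ E]
    {K : SimplicialComplex ℝ E} {B : AffineBasis (Fin 4) ℝ E} (hfin : K.faces.Finite)
    (hspace : K.space = {x | ∀ i, 0 ≤ B.coord i x}) (hB : ∀ i, {B i} ∈ K.faces)
    {V : Finset E} (hV : ∀ x, x ∈ V ↔ {x} ∈ K.faces) :
    (K.facesInOfCard B hfin Finset.univ 4).card + V.card
      + 2 * (V.filter fun x => (B.posCoords x).card = 2).card
      + (V.filter fun x => (B.posCoords x).card = 3).card + 1 ≤ V.card.choose 2 := by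
  have h0 : ∀ x ∈ V, ∀ i, 0 ≤ B.coord i x := fun x hx i =>
    coord_nonneg_of_mem_face hspace ((hV x).1 hx) (Finset.mem_singleton_self x) i
  have hE := card_edges_add_card_le_choose hB hV h0
    (𝓔 := K.facesInOfCard B hfin Finset.univ 2) fun t ht =>
      ⟨(mem_facesInOfCard.1 ht).1.1, (mem_facesInOfCard.1 ht).2⟩
  obtain ⟨h, hf, h1, h3, he⟩ := exists_sweep_numbers hfin hspace hV (Finset.mem_univ 3) (by decide)
  obtain ⟨g, -, g1, g2, ge⟩ := exists_sweep_numbers hfin hspace hV (J := {0, 1, 2}) (p := 2)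
    (by decide) (by decide)
  obtain ⟨k, -, k1, -, ke⟩ := exists_sweep_numbers hfin hspace hV (J := {0, 1}) (p := 1)
    (by decide) (by decide)
  have hc : (Finset.univ : Finset (Fin 4)).card = 4 := rfl
  have gc : ({0, 1, 2} : Finset (Fin 4)).card = 3 := rfl
  have kc : ({0, 1} : Finset (Fin 4)).card = 2 := rfl
  have hJ : (Finset.univ : Finset (Fin 4)).erase 3 = {0, 1, 2} := by decide
  have gJ : ({0, 1, 2} : Finset (Fin 4)).erase 2 = {0, 1} := by decide
  have hsingle : ∀ i, (V.filter fun x => B.posCoords x = {i}).card = 1 := fun i => by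
    refine Finset.card_eq_one.2 ⟨B i, ?_⟩
    ext x
    rw [Finset.mem_filter, Finset.mem_singleton]
    refine ⟨fun hx => (B.posCoords_eq_singleton_iff (h0 x hx.1)).1 hx.2, fun hx => ?_⟩
    exact hx ▸ ⟨(hV _).2 (hB i), B.posCoords_apply i⟩
  have hid := card_filter_identity_of_finset_fin_four V B.posCoords fun x _ =>
    B.posCoords_nonempty x
  rw [hsingle, hsingle, hsingle, ← h1, ← h3, ← g1, ← g2, ← k1] at hid
  rw [hJ] at he
  rw [gJ] at ge
  rw [hc] at hf he hid
  rw [gc] at ge hid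
  rw [kc] at ke
  have hf' : (K.facesInOfCard B hfin Finset.univ 4).card = h 1 + h 2 + h 3 := by
    rw [hf, show Finset.Icc 1 (4 - 1) = {1, 2, 3} from rfl]
    simp [add_assoc]
  norm_num at he ge ke hid
  omega

end Geometry.SimplicialComplex

end

/-- **Upper Bound Theorem for the facets of triangulations of a tetrahedron
(Theorem A.21 for `d = 3`).** Any finite geometric simplicial complex `K` in `ℝ³`
triangulating a tetrahedron `conv{v₀,…,v₃}` with `b` vertices in total, `b₂` of them
lying on open edges and `b₃` of them in relative interiors of `2`-faces of the
tetrahedron, has at most `b(b-3)/2 - 2·b₂ - b₃ - 1` three-dimensional faces. -/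
theorem upper_bound_facets_tetrahedron_triangulation
    (v : Fin 4 → (Fin 3 → ℝ)) (hv : AffineIndependent ℝ v)
    (K : Geometry.SimplicialComplex ℝ (Fin 3 → ℝ))
    (hfin : K.faces.Finite)
    (hspace : K.space = convexHull ℝ (Set.range v))
    (hvert : ∀ i, v i ∈ K.vertices)
    (b b2 b3 : ℕ)
    (hb : Nat.card ↥K.vertices = b)
    (hb2 : Nat.card {x : Fin 3 → ℝ // x ∈ K.vertices ∧
        ∃ i j : Fin 4, i ≠ j ∧ x ∈ convexHull ℝ ({v i, v j} : Set (Fin 3 → ℝ)) ∧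
          x ≠ v i ∧ x ≠ v j} = b2)
    (hb3 : Nat.card {x : Fin 3 → ℝ // x ∈ K.vertices ∧
        ∃ i j k : Fin 4, i ≠ j ∧ i ≠ k ∧ j ≠ k ∧
          x ∈ intrinsicInterior ℝ
            (convexHull ℝ ({v i, v j, v k} : Set (Fin 3 → ℝ)))} = b3) :
    (Nat.card {s : Finset (Fin 3 → ℝ) // s ∈ K.faces ∧ s.card = 4} : ℚ) ≤
      (b : ℚ) * ((b : ℚ) - 3) / 2 - 2 * (b2 : ℚ) - (b3 : ℚ) - 1 := by
  let B : AffineBasis (Fin 4) ℝ (Fin 3 → ℝ) :=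
    ⟨v, hv, hv.affineSpan_eq_top_iff_card_eq_finrank_add_one.2 (by simp)⟩
  have hBv : ∀ i, B i = v i := fun _ => rfl
  have hspaceB : K.space = {x | ∀ i, 0 ≤ B.coord i x} := by
    rw [hspace, ← B.convexHull_eq_nonneg_coord]; rfl
  have hVfin : K.vertices.Finite := hfin.preimage Finset.singleton_injective.injOn
  obtain ⟨V, hV⟩ : ∃ V : Finset (Fin 3 → ℝ), ∀ x, x ∈ V ↔ {x} ∈ K.faces :=
    ⟨hVfin.toFinset, fun x => hVfin.mem_toFinset⟩
  have key := Geometry.SimplicialComplex.card_facets_add_le hfin hspaceB hvert hV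
  have hcard : ∀ (p : (Fin 3 → ℝ) → Prop) (W : Finset (Fin 3 → ℝ)), (∀ x, p x → x ∈ W) →
      Nat.card {x // p x} ≤ W.card := fun p W h => by
    rw [← Nat.subtype_card W fun _ => Iff.rfl]
    exact Nat.card_le_card_of_injective (fun x : {x // p x} => (⟨x, h x x.2⟩ : W))
      fun x y hxy => Subtype.ext (congrArg Subtype.val hxy :)
  have hb' : V.card = b := by
    rw [← hb]
    exact (Nat.subtype_card V hV).symm
  have hb2' : b2 ≤ (V.filter fun x => (B.posCoords x).card = 2).card := by
    rw [← hb2]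
    refine hcard _ _ ?_
    rintro x ⟨hx, i, j, hij, hxc, hi, hj⟩
    refine Finset.mem_filter.2 ⟨(hV x).2 hx, ?_⟩
    rw [B.posCoords_eq_pair_of_mem_convexHull hij hxc hi hj, Finset.card_pair hij]
  have hb3' : b3 ≤ (V.filter fun x => (B.posCoords x).card = 3).card := by
    rw [← hb3]
    refine hcard _ _ ?_
    rintro x ⟨hx, i, j, k, hij, hik, hjk, hxc⟩
    refine Finset.mem_filter.2 ⟨(hV x).2 hx, ?_⟩
    have himage : B '' (({i, j, k} : Finset (Fin 4)) : Set (Fin 4)) = {v i, v j, v k} := by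
      simp [Set.image_insert_eq, hBv]
    rw [B.posCoords_eq_of_mem_intrinsicInterior (himage.symm ▸ hxc), Finset.card_eq_three]
    exact ⟨i, j, k, hij, hik, hjk, rfl⟩
  have hf3 : Nat.card {s : Finset (Fin 3 → ℝ) // s ∈ K.faces ∧ s.card = 4} =
      (K.facesInOfCard B hfin Finset.univ 4).card := by
    refine Nat.subtype_card _ fun s => ?_
    simp [Geometry.SimplicialComplex.mem_facesInOfCard, Geometry.SimplicialComplex.facesIn]
  rw [← hf3, hb'] at key
  have key' := (Nat.cast_le (α := ℚ)).2 key
  have h2 : (b2 : ℚ) ≤ _ := Nat.cast_le.2 hb2'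
  have h3 : (b3 : ℚ) ≤ _ := Nat.cast_le.2 hb3'
  push_cast [Nat.cast_choose_two] at key'
  linarith
end

section
/- Fix integers r ≥ 2 and k ≥ 2, and let W be the r × r integer matrix with entries W_{ij} = k^{[(i−1)+(j−1)] mod r} for 1 ≤ i, j ≤ r (equivalently, in 0-indexed form, W i j = k^{(i+j) mod r}). Then the absolute value of det W equals (k^r − 1)^{r−1}. -/
/-- Subtracting `c` times each row from the next one in the circulant matrix of the powers of `c`
leaves an upper triangular matrix. -/
theorem det_pow_add_neg_mod {R : Type*} [CommRing R] (n : ℕ) (c : R) :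
    (Matrix.of fun i j : Fin (n + 1) =>
        c ^ (((i : ℕ) + ((-j : Fin (n + 1)) : ℕ)) % (n + 1))).det
      = (1 - c ^ (n + 1)) ^ n := by
  rw [Matrix.det_eq_of_forall_row_eq_smul_add_pred (fun _ => c)
    (B := Matrix.of fun i j : Fin (n + 1) =>
      if i = 0 then c ^ ((-j : Fin (n + 1)) : ℕ) else if i = j then 1 - c ^ (n + 1) else 0)]
  · rw [Matrix.det_of_isUpperTriangular]
    · simp [Fin.prod_univ_succ]
    · intro i j hij
      have hij' : j < i := hij
      have hi : i ≠ 0 := Fin.ne_zero_of_lt hij'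
      simp [hi, hij'.ne']
  · intro j
    simp [Nat.mod_eq_of_lt (-j).isLt]
  · intro i j
    have hi := i.isLt
    have hj := j.isLt
    simp only [Matrix.of_apply, Fin.succ_ne_zero, if_false, Fin.val_succ, Fin.val_castSucc,
      Fin.val_neg', Nat.add_mod_mod]
    split_ifs with h
    · have h' : (j : ℕ) = i + 1 := by rw [← h, Fin.val_succ]
      have h1 : (i : ℕ) + 1 + (n + 1 - j) = n + 1 := by omega
      have h2 : ((i : ℕ) + (n + 1 - j)) % (n + 1) = n := by
        rw [show (i : ℕ) + (n + 1 - j) = n by omega]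
        exact Nat.mod_eq_of_lt (Nat.lt_succ_self n)
      rw [h1, h2, Nat.mod_self]
      ring
    · have h' : (j : ℕ) ≠ i + 1 := fun e => h (Fin.ext (by rw [Fin.val_succ, e]))
      rw [zero_add, ← pow_succ']
      congr 1
      rcases lt_or_ge (i : ℕ) j with hlt | hge
      · rw [Nat.mod_eq_of_lt (by omega), Nat.mod_eq_of_lt (by omega)]
        omega
      · rw [show (i : ℕ) + 1 + (n + 1 - j) = (i + 1 - j) + (n + 1) by omega,
          show (i : ℕ) + (n + 1 - j) = (i - j) + (n + 1) by omega,
          Nat.add_mod_right, Nat.add_mod_right, Nat.mod_eq_of_lt (by omega),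
          Nat.mod_eq_of_lt (by omega)]
        omega

/-- **Lemma 8.2.** The determinant of the matrix `W(r;k)` with entries
`W i j = k^((i+j) mod r)` (`0`-indexed) has absolute value `(k^r - 1)^(r-1)`. -/
theorem abs_det_W (r k : ℕ) (hr : 2 ≤ r) (hk : 2 ≤ k) :
    (Matrix.det
        (Matrix.of fun i j : Fin r => ((k : ℤ) ^ (((i : ℕ) + (j : ℕ)) % r)))).natAbs
      = (k ^ r - 1) ^ (r - 1) := by
  obtain ⟨n, rfl⟩ : ∃ n, r = n + 1 := ⟨r - 1, by omega⟩
  have hpos : 1 ≤ k ^ (n + 1) := Nat.one_le_pow _ _ (by omega)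
  have habs : (1 - (k : ℤ) ^ (n + 1)).natAbs = k ^ (n + 1) - 1 := by
    rw [← Nat.cast_pow]
    omega
  have hdet := congrArg Int.natAbs (det_pow_add_neg_mod n (k : ℤ))
  rw [Int.natAbs_pow, habs] at hdet
  rw [Nat.add_sub_cancel, ← hdet, Int.natAbs_eq_natAbs_iff, ← abs_eq_abs,
    ← Matrix.abs_det_submatrix_equiv_equiv (Equiv.refl _) (Equiv.neg (Fin (n + 1)))]
  rfl
end

section
/- Fix integers r ≥ 2 and k ≥ 2. Let W be the r × r integer matrix with (0-indexed) entries W i j = k^{(i+j) mod r}, and let W̌ be the r × r integer matrix with (0-indexed) entries W̌ i j = k if j = r−1−i, W̌ i j = −1 if j = (r−i) mod r, and W̌ i j = 0 otherwise. Then W · W̌ = (k^r − 1) · I, where I is the r × r identity matrix; in particular W̌ is, up to the scalar k^r − 1 = l(k−1), the inverse of W. -/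
/-- `x ↦ (r - x) % r` on `{0, …, r - 1}`, with the modulus resolved. -/
theorem sub_mod_self_eq_ite {r x : ℕ} (hx : x < r) :
    (r - x) % r = if x = 0 then 0 else r - x := by
  split_ifs with h
  · simp [h]
  · exact Nat.mod_eq_of_lt (by omega)

/-- Reduction modulo `r` of a number below `2 * r`. -/
theorem mod_eq_ite_of_lt_two_mul {r x : ℕ} (hx : x < 2 * r) :
    x % r = if x < r then x else x - r := by
  split_ifs with h
  · exact Nat.mod_eq_of_lt h
  · rw [Nat.mod_eq_sub_mod (by omega), Nat.mod_eq_of_lt (by omega)]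

/-- **Lemma 8.3 (i).** With `W i j = k^((i+j) mod r)` (`0`-indexed) and `W̌` the matrix
whose row `i` has entry `k` in column `r-1-i` and entry `-1` in column `(r-i) mod r`
(all other entries `0`), one has `W · W̌ = (k^r - 1) · 1`; in particular `W̌` is, up to
the scalar `k^r - 1 = l(k-1)`, the inverse of `W`. -/
theorem W_mul_Wcheck (r k : ℕ) (hr : 2 ≤ r) (hk : 2 ≤ k) :
    (Matrix.of fun i j : Fin r => ((k : ℤ) ^ (((i : ℕ) + (j : ℕ)) % r))) *
      (Matrix.of fun i j : Fin r =>
        if (j : ℕ) = r - 1 - (i : ℕ) then (k : ℤ)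
        else if (j : ℕ) = (r - (i : ℕ)) % r then -1 else 0)
      = ((k : ℤ) ^ r - 1) • (1 : Matrix (Fin r) (Fin r) ℤ) := by
  ext i j
  have hi := i.isLt
  have hj := j.isLt
  have hentry (m : Fin r) :
      (if (j : ℕ) = r - 1 - (m : ℕ) then (k : ℤ)
        else if (j : ℕ) = (r - (m : ℕ)) % r then -1 else 0) =
      (if m = ⟨r - 1 - j, by omega⟩ then (k : ℤ) else 0) +
        (if m = ⟨(r - j) % r, Nat.mod_lt _ (by omega)⟩ then -1 else 0) := by
    have hm := m.isLt
    simp only [Fin.ext_iff, sub_mod_self_eq_ite hm, sub_mod_self_eq_ite hj]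
    split_ifs <;> omega
  simp only [Matrix.mul_apply, Matrix.of_apply, hentry, mul_add, Finset.sum_add_distrib,
    mul_ite, mul_zero, Finset.sum_ite_eq', Finset.mem_univ, if_true,
    Matrix.smul_apply, Matrix.one_apply, smul_eq_mul, mul_one, mul_neg, ← pow_succ]
  have hb : ((i : ℕ) + (r - j) % r) % r = if (j : ℕ) ≤ i then (i : ℕ) - j else i + r - j := by
    rw [Nat.add_mod_mod, mod_eq_ite_of_lt_two_mul]
    all_goals grind
  have ha : ((i : ℕ) + (r - 1 - j)) % r + 1 =
      if (j : ℕ) < i then (i : ℕ) - j else i + r - j := by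
    rw [mod_eq_ite_of_lt_two_mul (by omega)]
    split_ifs <;> omega
  rw [ha, hb]
  rcases lt_trichotomy (i : ℕ) j with h | h | h
  · have hne : i ≠ j := fun e => by simp [e] at h
    simp [hne, h.not_ge, h.not_gt]
  · obtain rfl := Fin.ext h
    simp [sub_eq_add_neg]
  · have hne : i ≠ j := fun e => by simp [e] at h
    simp [hne, h, h.le]
end

section
/- Fix integers r ≥ 2 and k ≥ 2 and set l = 1 + k + ⋯ + k^{r−1}. Let N = ℤ^r + ℤ·(1/l)(k^0, k^1, …, k^{r−1}) ⊆ ℚ^r be the lattice of the cyclic quotient singularity of type (1/l)(1, k, …, k^{r−1}), and let Φ : ℚ^r → ℚ^r be the linear map given by the matrix W̌ with (0-indexed) entries W̌ i j = k if j = r−1−i, W̌ i j = −1 if j = (r−i) mod r, and 0 otherwise. Then the image Φ(N) equals the set of all integer vectors λ ∈ ℤ^r whose coordinate sum satisfies (k−1) ∣ Σ_{i} λ_i. -/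
/-- The lattice `N = ℤ^r + ℤ·(1/l)(1, k, …, k^{r-1})` of the cyclic quotient
singularity of type `(1/l)(1, k, …, k^{r-1})`, where `l = 1 + k + ⋯ + k^{r-1}`. -/
def gpLattice (r k : ℕ) : AddSubgroup (Fin r → ℚ) :=
  intLattice r ⊔ AddSubgroup.zmultiples
    (fun i : Fin r => (k : ℚ) ^ (i : ℕ) / ((∑ j ∈ Finset.range r, k ^ j : ℕ) : ℚ))

/-- The matrix `W̌` over `ℚ`: row `i` has entry `k` in column `r-1-i` and entry `-1`
in column `(r-i) mod r`; all other entries vanish. -/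
def WcheckQ (r k : ℕ) : Matrix (Fin r) (Fin r) ℚ :=
  Matrix.of fun i j =>
    if (j : ℕ) = r - 1 - (i : ℕ) then (k : ℚ)
    else if (j : ℕ) = (r - (i : ℕ)) % r then -1 else 0

theorem WcheckQ_mulVec_rev {n : ℕ} (hn : 1 ≤ n) (k : ℕ) (x : Fin (n + 1) → ℚ)
    (p : Fin (n + 1)) :
    (WcheckQ (n + 1) k).mulVec x p.rev = k * x p - x (p + 1) := by
  have hne : p + 1 ≠ p := by
    have : NeZero n := ⟨by omega⟩
    simp
  have hrow : ∀ j, WcheckQ (n + 1) k p.rev j =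
      (if j = p then (k : ℚ) else 0) + (if j = p + 1 then -1 else 0) := by
    intro j
    have hp := p.is_lt
    have h₁ : (j : ℕ) = n + 1 - 1 - (p.rev : ℕ) ↔ j = p := by
      rw [Fin.ext_iff, Fin.val_rev]; omega
    have h₂ : (j : ℕ) = (n + 1 - (p.rev : ℕ)) % (n + 1) ↔ j = p + 1 := by
      have : n + 1 - (p.rev : ℕ) = p + 1 := by rw [Fin.val_rev]; omega
      rw [this, Fin.ext_iff, Fin.val_add, Fin.val_one', Nat.add_mod_mod]
    simp only [WcheckQ, Matrix.of_apply, h₁, h₂]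
    by_cases hj : j = p
    · simp [hj, hne.symm]
    · simp [hj]
  simp [Matrix.mulVec, dotProduct, hrow, add_mul, Finset.sum_add_distrib, sub_eq_add_neg]

theorem sum_WcheckQ_mulVec {n : ℕ} (hn : 1 ≤ n) (k : ℕ) (x : Fin (n + 1) → ℚ) :
    ∑ i, (WcheckQ (n + 1) k).mulVec x i = ((k : ℚ) - 1) * ∑ i, x i := by
  rw [← Equiv.sum_comp Fin.revPerm]
  have h := Equiv.sum_comp (Equiv.addRight (1 : Fin (n + 1))) x
  simp only [Equiv.coe_addRight] at h
  simp only [Fin.revPerm_apply, WcheckQ_mulVec_rev hn, Finset.sum_sub_distrib, h,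
    ← Finset.mul_sum]
  ring

theorem WcheckQ_mulVec_generator {n : ℕ} (hn : 1 ≤ n) (k : ℕ) :
    (WcheckQ (n + 1) k).mulVec
      (fun i => (k : ℚ) ^ (i : ℕ) / ((∑ j ∈ Finset.range (n + 1), k ^ j : ℕ) : ℚ))
      = Pi.single 0 ((k : ℚ) - 1) := by
  have hl : ((∑ j ∈ Finset.range (n + 1), k ^ j : ℕ) : ℚ) ≠ 0 := by
    rw [Finset.sum_range_succ']
    positivity
  have hg := mul_geom_sum (k : ℚ) (n + 1)
  funext i
  obtain ⟨p, rfl⟩ := Fin.rev_surjective i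
  rw [WcheckQ_mulVec_rev hn]
  induction p using Fin.lastCases with
  | last =>
    simp only [Fin.last_add_one, Fin.rev_last, Pi.single_eq_same, Fin.val_last, Fin.val_zero,
      pow_zero]
    field_simp
    push_cast
    linear_combination -hg
  | cast q =>
    rw [Fin.rev_castSucc, Pi.single_eq_of_ne (Fin.succ_ne_zero _), Fin.coeSucc_eq_succ,
      Fin.val_succ, Fin.val_castSucc]
    ring

/-- The solution with initial value `0` of the recurrence `z (m + 1) = k * z m - μ m`. -/
def recurrenceSolution (k : ℤ) (μ : ℕ → ℤ) : ℕ → ℤ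
  | 0 => 0
  | m + 1 => k * recurrenceSolution k μ m - μ m

theorem sub_one_dvd_recurrenceSolution_add_sum (k : ℤ) (μ : ℕ → ℤ) (m : ℕ) :
    k - 1 ∣ recurrenceSolution k μ m + ∑ i ∈ Finset.range m, μ i := by
  induction m with
  | zero => simp [recurrenceSolution]
  | succ m ih =>
    rw [Finset.sum_range_succ, recurrenceSolution]
    obtain ⟨c, hc⟩ := ih
    exact ⟨c + recurrenceSolution k μ m, by linear_combination hc⟩

/-- **Lemma 8.3 (ii).** The linear map `Φ(x) = W̌·x` maps the lattice of the cyclic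
quotient singularity of type `(1/l)(1, k, …, k^{r-1})` onto the set of integer vectors
whose coordinate sum is divisible by `k - 1`. -/
theorem Wcheck_image_gpLattice (r k : ℕ) (hr : 2 ≤ r) (hk : 2 ≤ k) :
    (fun x => (WcheckQ r k).mulVec x) '' ((gpLattice r k : AddSubgroup (Fin r → ℚ)) :
        Set (Fin r → ℚ))
      = {x : Fin r → ℚ | ∃ lam : Fin r → ℤ,
          (∀ i, x i = (lam i : ℚ)) ∧ ((k : ℤ) - 1) ∣ ∑ i, lam i} := by
  obtain ⟨n, rfl⟩ : ∃ n, r = n + 1 := ⟨r - 1, by omega⟩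
  have hn : 1 ≤ n := by omega
  ext y
  constructor
  · rintro ⟨x, hx, rfl⟩
    obtain ⟨u, hu, v, hv, rfl⟩ := AddSubgroup.mem_sup.mp hx
    obtain ⟨c, rfl⟩ := AddSubgroup.mem_zmultiples_iff.mp hv
    choose z hz using hu
    obtain rfl : u = fun i => (z i : ℚ) := funext hz
    have hint : ∀ i, (WcheckQ (n + 1) k).mulVec (fun i => (z i : ℚ)) i =
        ((k * z i.rev - z (i.rev + 1) : ℤ) : ℚ) := by
      intro i
      have h := WcheckQ_mulVec_rev hn k (fun i => (z i : ℚ)) i.rev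
      rw [Fin.rev_rev] at h
      simp [h]
    refine ⟨fun i => (k * z i.rev - z (i.rev + 1)) + c * (Pi.single 0 ((k : ℤ) - 1) : Fin (n + 1) → ℤ) i,
      fun i => ?_, ?_⟩
    · dsimp only
      rw [Matrix.mulVec_add, Matrix.mulVec_smul, WcheckQ_mulVec_generator hn, Pi.add_apply,
        Pi.smul_apply, hint]
      by_cases hi : i = 0
      · subst hi; simp
      · simp [hi]
    · have hs := sum_WcheckQ_mulVec hn k (fun i => (z i : ℚ))
      simp only [hint] at hs
      have hs' : ∑ i : Fin (n + 1), (k * z i.rev - z (i.rev + 1)) =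
          ((k : ℤ) - 1) * ∑ i, z i := by exact_mod_cast hs
      rw [Finset.sum_add_distrib, hs', ← Finset.mul_sum, Finset.sum_pi_single']
      simp
  · rintro ⟨lam, hlam, hdvd⟩
    obtain rfl : y = fun i => (lam i : ℚ) := funext hlam
    let μ : ℕ → ℤ := fun m => lam (Fin.rev (Fin.ofNat (n + 1) m))
    have hμ : ∀ p : Fin (n + 1), μ p = lam p.rev := fun p => by simp [μ]
    have hsum : ∑ i ∈ Finset.range (n + 1), μ i = ∑ i, lam i := by
      rw [Finset.sum_range, ← Equiv.sum_comp Fin.revPerm lam]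
      simp [hμ]
    have hd := sub_one_dvd_recurrenceSolution_add_sum k μ (n + 1)
    rw [hsum] at hd
    obtain ⟨c, hc⟩ := (dvd_add_left hdvd).mp hd
    set z := recurrenceSolution k μ
    have hstep : ∀ m, z (m + 1) = k * z m - μ m := fun m => rfl
    refine ⟨(fun i : Fin (n + 1) => (z i : ℚ)) + (-c) • _,
      AddSubgroup.add_mem_sup (fun i => ⟨z i, rfl⟩)
        (AddSubgroup.zsmul_mem_zmultiples _ (-c)), ?_⟩
    dsimp only
    rw [Matrix.mulVec_add, Matrix.mulVec_smul, WcheckQ_mulVec_generator hn]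
    funext i
    obtain ⟨p, rfl⟩ := Fin.rev_surjective i
    rw [Pi.add_apply, WcheckQ_mulVec_rev hn, Pi.smul_apply, ← hμ]
    induction p using Fin.lastCases with
    | last =>
      have h := hstep n
      rw [hc] at h
      have h' : ((k : ℚ) - 1) * c = k * z n - μ n := by exact_mod_cast h
      have h₀ : z 0 = 0 := rfl
      simp only [Fin.last_add_one, Fin.rev_last, Pi.single_eq_same, Fin.val_last, Fin.val_zero,
        h₀, zsmul_eq_mul]
      push_cast
      linarith
    | cast q =>
      rw [Fin.rev_castSucc, Pi.single_eq_of_ne (Fin.succ_ne_zero _), Fin.coeSucc_eq_succ,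
        Fin.val_succ, Fin.val_castSucc, hstep]
      simp
end

section
/- Fix integers r ≥ 2 and k ≥ 2 and set l = 1 + k + ⋯ + k^{r−1}. Define integer vectors w̌_1, …, w̌_r ∈ ℤ^r by w̌_1 = −e_1 + k·e_r and w̌_j = −e_j + k·e_{j−1} for 2 ≤ j ≤ r. Let N̆ = {λ ∈ ℤ^r : (k−1) ∣ Σ_i λ_i}. Then the set of points of N̆ lying (after coercion to ℝ^r) in the convex hull conv{w̌_1, …, w̌_r} equals {λ ∈ ℤ^r : λ_i ≥ 0 for all i and Σ_i λ_i = k−1} ∪ {w̌_1, …, w̌_r}, and this set has exactly C(k+r−2, r−1) + r elements, where C(·,·) is a binomial coefficient. -/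
/-- The vectors `w̌_j ∈ ℤ^r` (`0`-indexed): `w̌_j = -e_j + k·e_{j-1}`, the index `j-1`
taken modulo `r` (so `w̌_0 = -e_0 + k·e_{r-1}`). These are the vertices of the
transformed junior simplex of the singularity of type `(1/l)(1, k, …, k^{r-1})`. -/
def wcheck (r k : ℕ) (j : Fin r) : Fin r → ℤ :=
  fun i => (if i = j then -1 else 0) +
    (if (i : ℕ) = ((j : ℕ) + r - 1) % r then (k : ℤ) else 0)

section CyclicMap

variable {ι : Type*} (σ : Equiv.Perm ι) (c : ℝ)

/-- The linear map `a ↦ (i ↦ c * a (σ i) - a i)`. -/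
noncomputable def permScaleSub : (ι → ℝ) →ₗ[ℝ] (ι → ℝ) :=
  c • LinearMap.funLeft ℝ ℝ σ - LinearMap.id

theorem permScaleSub_apply (a : ι → ℝ) (i : ι) :
    permScaleSub σ c a i = c * a (σ i) - a i := by
  simp [permScaleSub, LinearMap.funLeft_apply]

variable {c}

theorem nonneg_of_permScaleSub_nonneg [Finite ι] (hc : 1 < c) {a : ι → ℝ}
    (h : ∀ i, 0 ≤ permScaleSub σ c a i) (i : ι) : 0 ≤ a i := by
  have : Nonempty ι := ⟨i⟩
  obtain ⟨m, hm⟩ := Finite.exists_min a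
  refine le_trans ?_ (hm i)
  have h₁ := h (σ.symm m)
  rw [permScaleSub_apply, Equiv.apply_symm_apply] at h₁
  have h₂ := hm (σ.symm m)
  nlinarith

theorem permScaleSub_surjective [Finite ι] (hc : 1 < c) :
    Function.Surjective (permScaleSub σ c) := by
  rw [← LinearMap.injective_iff_surjective, injective_iff_map_eq_zero]
  intro a ha
  ext i
  apply le_antisymm
  · have := nonneg_of_permScaleSub_nonneg σ hc (a := -a) (by simp [ha]) i
    simpa using this
  · exact nonneg_of_permScaleSub_nonneg σ hc (by simp [ha]) i

theorem sum_permScaleSub [Fintype ι] (a : ι → ℝ) :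
    ∑ i, permScaleSub σ c a i = (c - 1) * ∑ i, a i := by
  simp only [permScaleSub_apply, Finset.sum_sub_distrib, ← Finset.mul_sum, Equiv.sum_comp]
  ring

end CyclicMap

section Vertices

variable {r : ℕ} [NeZero r]

theorem wcheck_apply (k : ℕ) (i j : Fin r) :
    wcheck r k j i = (if i = j then -1 else 0) + if i + 1 = j then (k : ℤ) else 0 := by
  have h : (i : ℕ) = ((j : ℕ) + r - 1) % r ↔ i + 1 = j := by
    have hi := i.isLt
    have hj := j.isLt
    rw [Fin.ext_iff, Fin.val_add, Fin.val_one', Nat.add_mod_mod]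
    rcases Nat.eq_zero_or_pos (j : ℕ) with h0 | h0
    · rw [h0, Nat.mod_eq_of_lt (by omega)]
      rcases Nat.lt_or_ge (i + 1) r with h1 | h1
      · rw [Nat.mod_eq_of_lt h1]; omega
      · rw [show (i : ℕ) + 1 = r by omega, Nat.mod_self]; omega
    · rw [show (j : ℕ) + r - 1 = (j - 1) + r by omega, Nat.add_mod_right,
        Nat.mod_eq_of_lt (by omega)]
      rcases Nat.lt_or_ge (i + 1) r with h1 | h1
      · rw [Nat.mod_eq_of_lt h1]; omega
      · rw [show (i : ℕ) + 1 = r by omega, Nat.mod_self]; omega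
  simp only [wcheck, h]

theorem sum_wcheck (k : ℕ) (j : Fin r) : ∑ i, wcheck r k j i = (k : ℤ) - 1 := by
  simp only [wcheck_apply, Finset.sum_add_distrib, ← eq_sub_iff_add_eq]
  simp only [Finset.sum_ite_eq', Finset.mem_univ, if_true]
  ring

theorem wcheck_neg_iff (hr : 2 ≤ r) (k : ℕ) (i j : Fin r) : wcheck r k j i < 0 ↔ i = j := by
  have h : i + 1 ≠ i := by
    have : Nontrivial (Fin r) := Fin.nontrivial_iff_two_le.2 hr
    simpa using (by omega : r ≠ 1)
  rw [wcheck_apply]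
  by_cases hij : i = j
  · subst hij; simp [h]
  · simp only [hij, if_false, iff_false]
    split_ifs <;> simp

theorem wcheck_injective (hr : 2 ≤ r) (k : ℕ) : Function.Injective (wcheck r k) := by
  intro j j' h
  have h₁ := (wcheck_neg_iff hr k j j).2 rfl
  rw [h] at h₁
  exact (wcheck_neg_iff hr k j j').1 h₁

theorem convexHull_range_wcheck (k : ℕ) :
    convexHull ℝ (Set.range fun j : Fin r => fun i => (wcheck r k j i : ℝ)) =
      permScaleSub (Equiv.addRight 1) (k : ℝ) '' stdSimplex ℝ (Fin r) := by
  rw [← convexHull_basis_eq_stdSimplex, LinearMap.image_convexHull, ← Set.range_comp]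
  congr 2
  ext j i
  simp only [Function.comp_apply, permScaleSub_apply, Equiv.coe_addRight, wcheck_apply]
  push_cast
  simp only [eq_comm (a := j)]
  split_ifs <;> ring

theorem mem_convexHull_wcheck_iff {k : ℕ} (hk : 2 ≤ k) (x : Fin r → ℤ) :
    (fun i => (x i : ℝ)) ∈
        convexHull ℝ (Set.range fun j : Fin r => fun i => (wcheck r k j i : ℝ)) ↔
      ((∀ i, 0 ≤ x i) ∧ ∑ i, x i = (k : ℤ) - 1) ∨ x ∈ Set.range (wcheck r k) := by
  have hk' : (1 : ℝ) < k := by exact_mod_cast hk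
  constructor
  · intro hx
    by_cases hv : x ∈ Set.range (wcheck r k)
    · exact .inr hv
    rw [convexHull_range_wcheck] at hx
    obtain ⟨a, ⟨ha₀, ha₁⟩, ha⟩ := hx
    have hxa : ∀ i, (x i : ℝ) = k * a (i + 1) - a i := fun i => by
      rw [← congrFun ha i, permScaleSub_apply, Equiv.coe_addRight]
    refine .inl ⟨fun i => ?_, ?_⟩
    · by_contra! hi
      apply hv
      have h₁ : (x i : ℝ) ≤ -1 := by exact_mod_cast Int.le_sub_one_of_lt hi
      have h₂ : 1 ≤ a i := by
        have := mul_nonneg (zero_le_one.trans hk'.le) (ha₀ (i + 1))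
        linarith [hxa i]
      have h₃ : ∀ j ≠ i, a j = 0 := by
        have h := Finset.add_sum_erase Finset.univ a (Finset.mem_univ i)
        have h' : ∑ j ∈ Finset.univ.erase i, a j = 0 :=
          le_antisymm (by linarith) (Finset.sum_nonneg fun j _ => ha₀ j)
        intro j hj
        exact (Finset.sum_eq_zero_iff_of_nonneg fun j _ => ha₀ j).1 h' j (by simp [hj])
      have h₄ : a i = 1 := by
        rw [← ha₁]
        exact (Finset.sum_eq_single i (fun j _ hj => h₃ j hj) (by simp)).symm
      have h₅ : ∀ j, a j = if j = i then 1 else 0 := fun j => by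
        split_ifs with hj
        · rw [hj, h₄]
        · exact h₃ j hj
      refine ⟨i, funext fun j => ?_⟩
      rw [← Int.cast_inj (α := ℝ), hxa, wcheck_apply, h₅, h₅]
      push_cast
      split_ifs <;> ring
    · have h := sum_permScaleSub (Equiv.addRight 1) (c := (k : ℝ)) a
      rw [ha, ha₁, mul_one] at h
      apply Int.cast_injective (α := ℝ)
      push_cast
      exact h
  · rintro (⟨hx₀, hx₁⟩ | ⟨j, rfl⟩)
    · rw [convexHull_range_wcheck]
      obtain ⟨a, ha⟩ := permScaleSub_surjective (Equiv.addRight 1) hk' fun i => (x i : ℝ)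
      refine ⟨a, ⟨nonneg_of_permScaleSub_nonneg (Equiv.addRight 1) hk' fun i => ?_, ?_⟩, ha⟩
      · rw [ha]
        exact Int.cast_nonneg (hx₀ i)
      · have h := sum_permScaleSub (Equiv.addRight 1) (c := (k : ℝ)) a
        rw [ha] at h
        have hx₁' : ∑ i, (x i : ℝ) = k - 1 := by
          simpa using congrArg (Int.cast (R := ℝ)) hx₁
        rw [hx₁'] at h
        exact (mul_left_cancel₀ (sub_pos.2 hk').ne' ((mul_one _).trans h)).symm
    · exact subset_convexHull ℝ _ ⟨j, rfl⟩

end Vertices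

theorem natCard_nonneg_sum_eq (ι : Type*) [Fintype ι] (n : ℕ) :
    Nat.card {x : ι → ℤ | (∀ i, 0 ≤ x i) ∧ ∑ i, x i = n} =
      (Fintype.card ι).multichoose n := by
  classical
  rw [← Sym.card_sym_eq_multichoose ι n, ← Nat.card_eq_fintype_card]
  symm
  apply Nat.card_congr
  refine (Sym.equivNatSumOfFintype ι n).trans ⟨
    fun P => ⟨fun i => P.1 i, fun i => Int.natCast_nonneg _, by simpa using congrArg (Nat.cast (R := ℤ)) P.2⟩,
    fun x => ⟨fun i => (x.1 i).toNat, ?_⟩, fun P => ?_, fun x => ?_⟩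
  · zify
    exact (Finset.sum_congr rfl fun i _ => Int.toNat_of_nonneg (x.2.1 i)).trans x.2.2
  · ext i
    simp
  · ext i
    exact Int.toNat_of_nonneg (x.2.1 i)

/-- **Lemma 8.4.** The points of the lattice
`N̆ = {λ ∈ ℤ^r : (k-1) ∣ Σ_i λ_i}` lying in the simplex `conv{w̌_1, …, w̌_r}` are
exactly the nonnegative integer vectors of coordinate sum `k-1` together with the
vertices `w̌_j`; there are exactly `C(k+r-2, r-1) + r` of them. -/
theorem lattice_points_of_transformed_junior_simplex (r k : ℕ) (hr : 2 ≤ r)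
    (hk : 2 ≤ k) :
    {lam : Fin r → ℤ | ((k : ℤ) - 1) ∣ (∑ i, lam i) ∧
        (fun i => (lam i : ℝ)) ∈
          convexHull ℝ (Set.range fun j : Fin r => fun i => ((wcheck r k j i : ℝ)))}
      = {lam : Fin r → ℤ | (∀ i, 0 ≤ lam i) ∧ ∑ i, lam i = (k : ℤ) - 1}
          ∪ Set.range (wcheck r k) ∧
    Nat.card ↥{lam : Fin r → ℤ | ((k : ℤ) - 1) ∣ (∑ i, lam i) ∧
        (fun i => (lam i : ℝ)) ∈
          convexHull ℝ (Set.range fun j : Fin r => fun i => ((wcheck r k j i : ℝ)))}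
      = (k + r - 2).choose (r - 1) + r := by
  have : NeZero r := ⟨by omega⟩
  have hset : {lam : Fin r → ℤ | ((k : ℤ) - 1) ∣ (∑ i, lam i) ∧
        (fun i => (lam i : ℝ)) ∈
          convexHull ℝ (Set.range fun j : Fin r => fun i => ((wcheck r k j i : ℝ)))}
      = {lam : Fin r → ℤ | (∀ i, 0 ≤ lam i) ∧ ∑ i, lam i = (k : ℤ) - 1}
          ∪ Set.range (wcheck r k) := by
    ext x
    simp only [Set.mem_ofPred_eq, Set.mem_union, mem_convexHull_wcheck_iff hk]
    refine and_iff_right_of_imp ?_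
    rintro (⟨-, hx⟩ | ⟨j, rfl⟩)
    · rw [hx]
    · rw [sum_wcheck]
  refine ⟨hset, ?_⟩
  rw [hset]
  have hcard : Set.ncard {lam : Fin r → ℤ | (∀ i, 0 ≤ lam i) ∧ ∑ i, lam i = (k : ℤ) - 1} =
      (k + r - 2).choose (r - 1) := by
    have h := natCard_nonneg_sum_eq (Fin r) (k - 1)
    rw [Nat.cast_sub (by omega), Nat.cast_one, Nat.card_coe_set_eq, Fintype.card_fin,
      Nat.multichoose_eq, show r + (k - 1) - 1 = k + r - 2 by omega] at h
    rw [h]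
    exact Nat.choose_symm_of_eq_add (by omega)
  have hpos : 0 < (k + r - 2).choose (r - 1) := Nat.choose_pos (by omega)
  rw [Nat.card_coe_set_eq, Set.ncard_union_eq ?_
    (Set.finite_of_ncard_pos (hcard ▸ hpos)) (Set.finite_range _), hcard,
    Set.ncard_range_of_injective (wcheck_injective hr k), Nat.card_fin]
  rw [Set.disjoint_left]
  rintro _ ⟨hx, -⟩ ⟨j, rfl⟩
  exact (hx j).not_gt ((wcheck_neg_iff hr k j j).2 rfl)
end

section
/- Fix integers r ≥ 2 and k ≥ 2. With w̌_1 = −e_1 + k·e_r, w̌_j = −e_j + k·e_{j−1} (2 ≤ j ≤ r) and u_j = (k−1)·e_j in ℝ^r, define for each ε ∈ {0,1}^r the set s(ε) = conv{p_1(ε), …, p_r(ε)}, where p_j(ε) = u_j if ε_j = 1 and p_j(ε) = w̌_j if ε_j = 0. Then: (a) for every ε ≠ (0,…,0) the r points p_1(ε), …, p_r(ε) are affinely independent; (b) the union of the sets s(ε) over all ε ∈ {0,1}^r \ {(0,…,0)} equals conv{w̌_1, …, w̌_r}; and (c) for any two distinct ε, ε' ∈ {0,1}^r \ {(0,…,0)},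 the intrinsic (relative) interiors of s(ε) and s(ε') are disjoint. (Thus the 2^r − 1 simplices s(ε) form a triangulation 𝔗(r;k) of the simplex conv{w̌_1,…,w̌_r}.) -/
/-- The vectors `w̌_j ∈ ℝ^r` (`0`-indexed): `w̌_j = -e_j + k·e_{j-1}`, the index `j-1`
taken modulo `r` (so `w̌_0 = -e_0 + k·e_{r-1}`). -/
def wcheckR (r k : ℕ) (j : Fin r) : Fin r → ℝ :=
  fun i => (if i = j then -1 else 0) +
    (if (i : ℕ) = ((j : ℕ) + r - 1) % r then (k : ℝ) else 0)

/-- The vectors `u_j = (k-1)·e_j ∈ ℝ^r`. -/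
def uVec (r k : ℕ) (j : Fin r) : Fin r → ℝ :=
  fun i => if i = j then (k : ℝ) - 1 else 0

/-- The vertices `p_j(ε)` of the simplex `s(ε)`: `p_j(ε) = u_j` if `ε_j = 1` and
`p_j(ε) = w̌_j` if `ε_j = 0`. -/
def pEps (r k : ℕ) (ε : Fin r → Bool) (j : Fin r) : Fin r → ℝ :=
  if ε j then uVec r k j else wcheckR r k j

/-- The simplex `s(ε) = conv{p_1(ε), …, p_r(ε)}`. -/
def sEps (r k : ℕ) (ε : Fin r → Bool) : Set (Fin r → ℝ) :=
  convexHull ℝ (Set.range (pEps r k ε))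

/-- Points of the convex hull of a finite family are exactly its convex combinations. -/
theorem mem_convexHull_range_iff_exists_weights {ι E : Type*} [Fintype ι] [AddCommGroup E]
    [Module ℝ E] (p : ι → E) (x : E) :
    x ∈ convexHull ℝ (Set.range p) ↔
      ∃ w : ι → ℝ, (∀ i, 0 ≤ w i) ∧ ∑ i, w i = 1 ∧ ∑ i, w i • p i = x := by
  classical
  constructor
  · intro hx
    have hsub : convexHull ℝ (Set.range p) ⊆ Fintype.linearCombination ℝ p '' stdSimplex ℝ ι := by
      refine convexHull_min ?_ ((convex_stdSimplex ℝ ι).linear_image _)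
      rintro _ ⟨i, rfl⟩
      exact ⟨Pi.single i 1, single_mem_stdSimplex ℝ i, by
        simp [Fintype.linearCombination_apply_single]⟩
    obtain ⟨w, hw, hwx⟩ := hsub hx
    exact ⟨w, hw.1, hw.2, by rwa [Fintype.linearCombination_apply] at hwx⟩
  · rintro ⟨w, hw0, hw1, hwx⟩
    exact mem_convexHull_of_exists_fintype w p hw0 hw1 (fun i => Set.mem_range_self i) hwx

/-- A point of the relative interior of the convex hull of a linearly independent family has
positive weights. -/
theorem weight_pos_of_mem_intrinsicInterior_convexHull {ι E : Type*} [Fintype ι]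
    [AddCommGroup E] [TopologicalSpace E] [IsTopologicalAddGroup E] [Module ℝ E]
    [ContinuousSMul ℝ E] {p : ι → E} (hp : LinearIndependent ℝ p)
    {w : ι → ℝ} (hx : ∑ i, w i • p i ∈ intrinsicInterior ℝ (convexHull ℝ (Set.range p)))
    (m : ι) : 0 < w m := by
  classical
  set x := ∑ i, w i • p i with hxdef
  obtain ⟨y, hy, hyx⟩ := mem_intrinsicInterior.1 hx
  have hpm : p m ∈ affineSpan ℝ (convexHull ℝ (Set.range p)) :=
    subset_affineSpan ℝ _ (subset_convexHull ℝ _ (Set.mem_range_self m))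
  have hmem (t : ℝ) : AffineMap.lineMap x (p m) t ∈ affineSpan ℝ (convexHull ℝ (Set.range p)) :=
    AffineMap.lineMap_mem _ (hyx ▸ y.2) hpm
  have hcont : Continuous fun t : ℝ =>
      (⟨AffineMap.lineMap x (p m) t, hmem t⟩ : affineSpan ℝ (convexHull ℝ (Set.range p))) := by
    refine Continuous.subtype_mk ?_ _
    exact AffineMap.lineMap_continuous
  have hev := hcont.continuousAt.preimage_mem_nhds (x := 0) (t := _) (by
    have h0 : (⟨AffineMap.lineMap x (p m) (0 : ℝ), hmem 0⟩ :
        affineSpan ℝ (convexHull ℝ (Set.range p))) = y := by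
      apply Subtype.ext
      simp [hyx]
    rw [h0]
    exact mem_interior_iff_mem_nhds.1 hy)
  obtain ⟨δ, hδ, hball⟩ := Metric.mem_nhds_iff.1 hev
  have ht : -(δ / 2) ∈ Metric.ball (0 : ℝ) δ := by
    rw [Metric.mem_ball, Real.dist_eq, sub_zero, abs_neg, abs_of_pos (by linarith)]
    linarith
  have hmem' : AffineMap.lineMap x (p m) (-(δ / 2)) ∈ convexHull ℝ (Set.range p) := hball ht
  obtain ⟨v, hv0, -, hv⟩ := (mem_convexHull_range_iff_exists_weights p _).1 hmem'
  have hcomb : ∑ i, v i • p i =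
      ∑ i, ((1 + δ / 2) * w i + if i = m then -(δ / 2) else 0) • p i := by
    rw [hv, AffineMap.lineMap_apply_module, hxdef]
    simp [add_smul, Finset.sum_add_distrib, mul_smul, Finset.smul_sum, ite_smul]
  have := Fintype.linearIndependent_iffₛ.1 hp _ _ hcomb m
  simp only [if_true] at this
  have hvm := hv0 m
  by_contra! hneg
  nlinarith

/-- Going down cyclically from any starting point reaches every element of `Fin r`. -/
theorem Fin.forall_of_add_one_imp {r : ℕ} [NeZero r] {P : Fin r → Prop}
    (h : ∀ i, P (i + 1) → P i) {m : Fin r} (hm : P m) (i : Fin r) : P i := by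
  have key : ∀ n : ℕ, P (m - Fin.ofNat r n) := by
    intro n
    induction n with
    | zero => simpa using hm
    | succ n ih =>
      apply h
      convert ih using 1
      have : (Fin.ofNat r (n + 1)) = Fin.ofNat r n + 1 := by
        apply Fin.ext
        simp [Fin.val_add]
      rw [this]
      abel
  have := key (m - i).val
  simpa using this

/-- Cyclic shifts do not change sums. -/
theorem Fin.sum_comp_add_one {r : ℕ} [NeZero r] (f : Fin r → ℝ) :
    ∑ i, f (i + 1) = ∑ i, f i :=
  Equiv.sum_comp (Equiv.addRight (1 : Fin r)) f

theorem wcheckR_apply {r k : ℕ} [NeZero r] (hr : 2 ≤ r) (j i : Fin r) :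
    wcheckR r k j i = (if i = j then -1 else 0) + if j = i + 1 then (k : ℝ) else 0 := by
  have hiff : (i : ℕ) = ((j : ℕ) + r - 1) % r ↔ j = i + 1 := by
    have val_one : ((1 : Fin r) : ℕ) = 1 := by
      rw [Fin.val_one', Nat.mod_eq_of_lt hr]
    have hi := i.isLt
    have hj := j.isLt
    rw [Fin.ext_iff, Fin.val_add, val_one]
    have e1 : ((j : ℕ) + r - 1) % r = if (j : ℕ) = 0 then r - 1 else j - 1 := by
      split_ifs with h
      · rw [Nat.mod_eq_of_lt] <;> omega
      · rw [show (j : ℕ) + r - 1 = (j - 1) + r by omega, Nat.add_mod_right,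
          Nat.mod_eq_of_lt (by omega)]
    have e2 : ((i : ℕ) + 1) % r = if (i : ℕ) + 1 = r then 0 else (i : ℕ) + 1 := by
      split_ifs with h
      · rw [h, Nat.mod_self]
      · exact Nat.mod_eq_of_lt (by omega)
    rw [e1, e2]
    split_ifs <;> omega
  simp only [wcheckR, hiff]

/-- Coordinates of a linear combination of the vertices of `s(ε)`. -/
theorem sum_smul_pEps_apply {r k : ℕ} [NeZero r] (hr : 2 ≤ r) (ε : Fin r → Bool)
    (w : Fin r → ℝ) (i : Fin r) :
    (∑ j, w j • pEps r k ε j) i =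
      (if ε i then ((k : ℝ) - 1) * w i else -w i) +
        k * (if ε (i + 1) then 0 else w (i + 1)) := by
  have hterm (j : Fin r) : (w j • pEps r k ε j) i =
      (if i = j then (if ε i then ((k : ℝ) - 1) * w i else -w i) else 0) +
        (if i + 1 = j then k * (if ε (i + 1) then 0 else w (i + 1)) else 0) := by
    by_cases h1 : i = j
    · subst h1
      by_cases h2 : i + 1 = i
      · cases h : ε i <;>
          simp [pEps, uVec, wcheckR_apply hr, h, h2, mul_comm, mul_add]
      · cases h : ε i <;>
          simp [pEps, uVec, wcheckR_apply hr, h, h2, Ne.symm h2, mul_comm]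
    · by_cases h2 : i + 1 = j
      · subst h2
        cases h : ε (i + 1) <;>
          simp [pEps, uVec, wcheckR_apply hr, h, h1, mul_comm]
      · cases h : ε j <;>
          simp [pEps, uVec, wcheckR_apply hr, h, h1, h2, Ne.symm h2]
  rw [Finset.sum_apply, Finset.sum_congr rfl fun j _ => hterm j, Finset.sum_add_distrib]
  simp

theorem sum_sum_smul_pEps {r k : ℕ} [NeZero r] (hr : 2 ≤ r) (ε : Fin r → Bool)
    (w : Fin r → ℝ) :
    ∑ i, (∑ j, w j • pEps r k ε j) i = ((k : ℝ) - 1) * ∑ j, w j := by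
  simp only [sum_smul_pEps_apply hr]
  rw [Finset.sum_add_distrib,
    Fin.sum_comp_add_one fun i => (k : ℝ) * (if ε i then 0 else w i), ← Finset.sum_add_distrib,
    Finset.mul_sum]
  refine Finset.sum_congr rfl fun i _ => ?_
  split_ifs <;> ring

theorem linearIndependent_pEps {r k : ℕ} [NeZero r] (hr : 2 ≤ r) (hk : 2 ≤ k)
    {ε : Fin r → Bool} (hε : ε ≠ fun _ => false) : LinearIndependent ℝ (pEps r k ε) := by
  have hk' : (2 : ℝ) ≤ k := by exact_mod_cast hk
  rw [Fintype.linearIndependent_iff]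
  intro g hg
  obtain ⟨m, hm⟩ : ∃ m, ε m = true := by
    by_contra! h
    exact hε (funext fun i => by simpa using h i)
  have hcoord (i : Fin r) : (if ε i then ((k : ℝ) - 1) * g i else -g i) +
      k * (if ε (i + 1) then 0 else g (i + 1)) = 0 := by
    rw [← sum_smul_pEps_apply hr, hg, Pi.zero_apply]
  have hstep (i : Fin r) (h : (if ε (i + 1) then 0 else g (i + 1)) = 0) : g i = 0 := by
    have := hcoord i
    rw [h, mul_zero, add_zero] at this
    split_ifs at this
    · exact (mul_eq_zero.1 this).resolve_left (by linarith)
    · linarith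
  have hcarry (i : Fin r) : (if ε i then 0 else g i) = 0 :=
    Fin.forall_of_add_one_imp (P := fun i => (if ε i then 0 else g i) = 0)
      (fun i h => by simp [hstep i h]) (m := m) (by simp [hm]) i
  exact fun i => hstep i (hcarry _)

theorem nonneg_of_le_mul_add_one {r : ℕ} [NeZero r] {c : ℝ} (hc : 1 < c) {μ : Fin r → ℝ}
    (h : ∀ i, μ i ≤ c * μ (i + 1)) (i : Fin r) : 0 ≤ μ i := by
  obtain ⟨m, hm⟩ := Finite.exists_min μ
  have h1 := h (m - 1)
  rw [sub_add_cancel] at h1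
  have h2 := hm (m - 1)
  have h3 := hm i
  nlinarith

theorem exists_eq_mul_add_one_sub {r : ℕ} [NeZero r] {c : ℝ} (hc : 1 < c) (x : Fin r → ℝ) :
    ∃ μ : Fin r → ℝ, ∀ i, c * μ (i + 1) - μ i = x i := by
  let T : (Fin r → ℝ) →ₗ[ℝ] (Fin r → ℝ) :=
    { toFun := fun μ i => c * μ (i + 1) - μ i
      map_add' := fun μ ν => by
        ext i
        simp only [Pi.add_apply]
        ring
      map_smul' := fun a μ => by
        ext i
        simp only [Pi.smul_apply, smul_eq_mul, RingHom.id_apply]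
        ring }
  have hinj : Function.Injective T := by
    rw [injective_iff_map_eq_zero]
    intro μ hμ
    have h (i : Fin r) : c * μ (i + 1) - μ i = 0 := congrFun hμ i
    ext i
    have h1 := nonneg_of_le_mul_add_one hc (μ := μ) (fun i => by linarith [h i]) i
    have h2 := nonneg_of_le_mul_add_one hc (μ := fun i => -μ i)
      (fun i => by linarith [h i]) i
    simp only [Pi.zero_apply]
    linarith
  obtain ⟨μ, hμ⟩ := LinearMap.injective_iff_surjective.1 hinj x
  exact ⟨μ, fun i => congrFun hμ i⟩

/-- The minimal nonnegative solution of the cyclic system `d i = max (c * d (i + 1) - x i) 0`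
vanishes somewhere. -/
theorem exists_eq_max_and_eq_zero {r : ℕ} [NeZero r] {c : ℝ} (hc : 1 < c) {x μ : Fin r → ℝ}
    (hμ0 : ∀ i, 0 ≤ μ i) (hμ : ∀ i, c * μ (i + 1) - μ i = x i) :
    ∃ d : Fin r → ℝ, (∀ i, d i = max (c * d (i + 1) - x i) 0) ∧ ∃ m, d m = 0 := by
  let S : Set (Fin r → ℝ) := Set.Icc 0 μ ∩ ⋂ i, {d | c * d (i + 1) - x i ≤ d i}
  have hScompact : IsCompact S := by
    refine isCompact_Icc.inter_right (isClosed_iInter fun i => ?_)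
    exact isClosed_le (by fun_prop) (by fun_prop)
  have hSne : S.Nonempty :=
    ⟨μ, ⟨hμ0, le_rfl⟩, Set.mem_iInter.2 fun i => by
      have := hμ i
      simp only [Set.mem_ofPred]
      linarith⟩
  obtain ⟨d, ⟨⟨hd0, hdμ⟩, hdS⟩, hmin⟩ := hScompact.exists_isMinOn hSne
    (f := fun d : Fin r → ℝ => ∑ i, d i) (by fun_prop)
  have hd (i : Fin r) : c * d (i + 1) - x i ≤ d i := Set.mem_iInter.1 hdS i
  have hlow (d' : Fin r → ℝ) (h0 : ∀ i, 0 ≤ d' i) (hle : ∀ i, d' i ≤ d i)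
      (hsup : ∀ i, c * d' (i + 1) - x i ≤ d' i) (i : Fin r) : d' i = d i := by
    have hsum : ∑ i, d i ≤ ∑ i, d' i :=
      hmin ⟨⟨h0, fun i => (hle i).trans (hdμ i)⟩, Set.mem_iInter.2 hsup⟩
    exact (Finset.sum_eq_sum_iff_of_le fun i _ => hle i).1
      (le_antisymm (Finset.sum_le_sum fun i _ => hle i) hsum) i (Finset.mem_univ i)
  refine ⟨d, fun i => ?_, ?_⟩
  · have h := hlow (fun i => max (c * d (i + 1) - x i) 0) (fun i => le_max_right _ _)
      (fun i => max_le (hd i) (hd0 i)) (fun i => le_max_of_le_left ?_) i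
    · exact h.symm
    · have : max (c * d (i + 1 + 1) - x (i + 1)) 0 ≤ d (i + 1) := max_le (hd _) (hd0 _)
      nlinarith
  · by_contra! hne
    obtain ⟨m, hm⟩ := Finite.exists_min d
    have hpos : 0 < d m := lt_of_le_of_ne (hd0 m) (hne m).symm
    have := hlow (fun i => d i - d m) (fun i => by linarith [hm i]) (fun i => by linarith)
      (fun i => by nlinarith [hd i]) m
    linarith

theorem eq_of_eq_max_of_eq_zero {r : ℕ} [NeZero r] {c : ℝ} (hc : 0 ≤ c) {x d d' : Fin r → ℝ}
    (hd : ∀ i, d i = max (c * d (i + 1) - x i) 0)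
    (hd' : ∀ i, d' i = max (c * d' (i + 1) - x i) 0)
    (h0 : ∃ m, d m = 0) (h0' : ∃ m, d' m = 0) : d = d' := by
  have hle {a b : Fin r → ℝ} (ha : ∀ i, a i = max (c * a (i + 1) - x i) 0)
      (hb : ∀ i, b i = max (c * b (i + 1) - x i) 0) (h : ∃ m, a m = 0) (i : Fin r) :
      a i ≤ b i := by
    obtain ⟨m, hm⟩ := h
    refine Fin.forall_of_add_one_imp (P := fun i => a i ≤ b i) (fun i hi => ?_) (m := m) ?_ i
    · rw [ha i, hb i]
      gcongr
    · rw [hm, hb m]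
      exact le_max_right _ _
  exact funext fun i => le_antisymm (hle hd hd' h0 i) (hle hd' hd h0' i)

theorem pEps_false (r k : ℕ) : pEps r k (fun _ => false) = wcheckR r k := by
  ext j i
  simp [pEps]

theorem uVec_mem_convexHull_wcheckR {r k : ℕ} [NeZero r] (hr : 2 ≤ r) (hk : 2 ≤ k)
    (j : Fin r) : uVec r k j ∈ convexHull ℝ (Set.range (wcheckR r k)) := by
  have hk' : (2 : ℝ) ≤ k := by exact_mod_cast hk
  obtain ⟨μ, hμ⟩ := exists_eq_mul_add_one_sub (c := k) (by linarith) (uVec r k j)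
  have hcomb : ∑ i, μ i • pEps r k (fun _ => false) i = uVec r k j := by
    ext i
    rw [sum_smul_pEps_apply hr, ← hμ]
    simp
    ring
  rw [← pEps_false, mem_convexHull_range_iff_exists_weights]
  refine ⟨μ, nonneg_of_le_mul_add_one (c := k) (by linarith) fun i => ?_, ?_, hcomb⟩
  · have : 0 ≤ uVec r k j i := by
      unfold uVec
      split_ifs <;> linarith
    linarith [hμ i]
  · have h := sum_sum_smul_pEps (k := k) hr (fun _ => false) μ
    rw [hcomb] at h
    simp only [uVec, Finset.sum_ite_eq', Finset.mem_univ, if_true] at h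
    have hne : (k : ℝ) - 1 ≠ 0 := by linarith
    exact mul_left_cancel₀ hne (by rw [mul_one]; exact h.symm)

theorem sEps_subset {r k : ℕ} [NeZero r] (hr : 2 ≤ r) (hk : 2 ≤ k) (ε : Fin r → Bool) :
    sEps r k ε ⊆ convexHull ℝ (Set.range (wcheckR r k)) := by
  refine convexHull_min ?_ (convex_convexHull ℝ _)
  rintro _ ⟨j, rfl⟩
  unfold pEps
  split_ifs
  · exact uVec_mem_convexHull_wcheckR hr hk j
  · exact subset_convexHull ℝ _ (Set.mem_range_self j)

theorem exists_mem_sEps {r k : ℕ} [NeZero r] (hr : 2 ≤ r) (hk : 2 ≤ k) {x : Fin r → ℝ}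
    (hx : x ∈ convexHull ℝ (Set.range (wcheckR r k))) :
    ∃ ε : Fin r → Bool, ε ≠ (fun _ => false) ∧ x ∈ sEps r k ε := by
  have hk' : (2 : ℝ) ≤ k := by exact_mod_cast hk
  have hne : (k : ℝ) - 1 ≠ 0 := by linarith
  rw [← pEps_false, mem_convexHull_range_iff_exists_weights] at hx
  obtain ⟨μ, hμ0, hμ1, hμx⟩ := hx
  have hxsum : ∑ i, x i = (k : ℝ) - 1 := by
    rw [← hμx, sum_sum_smul_pEps hr, hμ1, mul_one]
  have hμ (i : Fin r) : (k : ℝ) * μ (i + 1) - μ i = x i := by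
    rw [← hμx, sum_smul_pEps_apply hr]
    simp
    ring
  obtain ⟨d, hd, m, hm⟩ := exists_eq_max_and_eq_zero (by linarith) hμ0 hμ
  let ε : Fin r → Bool := fun i => decide (d i = 0)
  let w : Fin r → ℝ := fun i => if d i = 0 then (x i - k * d (i + 1)) / (k - 1) else d i
  have hcomb : ∑ i, w i • pEps r k ε i = x := by
    ext i
    rw [sum_smul_pEps_apply hr]
    have hcarry : (if ε (i + 1) then 0 else w (i + 1)) = d (i + 1) := by
      by_cases h : d (i + 1) = 0 <;> simp [ε, w, h]
    rw [hcarry]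
    by_cases h : d i = 0
    · simp only [ε, w, h, decide_true, if_true]
      field_simp
      ring
    · have hdi := hd i
      rcases max_cases ((k : ℝ) * d (i + 1) - x i) 0 with h' | h'
      · simp only [ε, w, h, decide_false, if_false]
        simp
        linarith
      · exact absurd (hdi.trans h'.1) h
  refine ⟨ε, fun h => ?_, (mem_convexHull_range_iff_exists_weights _ _).2
    ⟨w, fun i => ?_, ?_, hcomb⟩⟩
  · simpa [ε, hm] using congrFun h m
  · by_cases h : d i = 0
    · simp only [w, h, if_true]
      have h1 := le_max_left ((k : ℝ) * d (i + 1) - x i) 0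
      rw [← hd i, h] at h1
      exact div_nonneg (by linarith) (by linarith)
    · simp only [w, h, if_false]
      rw [hd i]
      exact le_max_right _ _
  · have h := sum_sum_smul_pEps (k := k) hr ε w
    rw [hcomb, hxsum] at h
    exact mul_left_cancel₀ hne (by rw [mul_one]; exact h.symm)

/-- A point of the relative interior of `s(ε)` determines `ε` through a solution of the cyclic
system `d i = max (k * d (i + 1) - x i) 0`. -/
theorem exists_eq_max_of_mem_intrinsicInterior_sEps {r k : ℕ} [NeZero r] (hr : 2 ≤ r)
    (hk : 2 ≤ k) {ε : Fin r → Bool} (hε : ε ≠ fun _ => false) {x : Fin r → ℝ}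
    (hx : x ∈ intrinsicInterior ℝ (sEps r k ε)) :
    ∃ d : Fin r → ℝ, (∀ i, d i = max ((k : ℝ) * d (i + 1) - x i) 0) ∧ (∃ m, d m = 0) ∧
      ∀ i, ε i = true ↔ d i = 0 := by
  have hk' : (2 : ℝ) ≤ k := by exact_mod_cast hk
  obtain ⟨w, -, -, rfl⟩ :=
    (mem_convexHull_range_iff_exists_weights _ _).1 (intrinsicInterior_subset hx)
  have hpos := weight_pos_of_mem_intrinsicInterior_convexHull
    (linearIndependent_pEps hr hk hε) hx
  have hiff (i : Fin r) : ε i = true ↔ (if ε i then 0 else w i) = 0 := by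
    cases h : ε i <;> simp [(hpos i).ne']
  refine ⟨fun i => if ε i then 0 else w i, fun i => ?_, ?_, hiff⟩
  · have hi := hpos i
    rw [sum_smul_pEps_apply hr]
    cases h : ε i
    · simp only [h, Bool.false_eq_true, if_false]
      rw [max_eq_left] <;> linarith
    · simp only [h, if_true]
      rw [max_eq_right]
      nlinarith
  · by_contra! h
    exact hε (funext fun i => by
      have := mt (hiff i).1 (h i)
      simpa using this)

/-- **Lemma 8.5.** The `2^r - 1` simplices `s(ε)`, `ε ∈ {0,1}^r ∖ {0}`, form a
triangulation `𝔗(r;k)` of the simplex `conv{w̌_1, …, w̌_r}`: (a) each `s(ε)` is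
spanned by `r` affinely independent points, (b) their union is the whole simplex, and
(c) their relative interiors are pairwise disjoint. -/
theorem triangulation_T_r_k (r k : ℕ) (hr : 2 ≤ r) (hk : 2 ≤ k) :
    (∀ ε : Fin r → Bool, ε ≠ (fun _ => false) → AffineIndependent ℝ (pEps r k ε)) ∧
    (⋃ ε ∈ {ε : Fin r → Bool | ε ≠ fun _ => false}, sEps r k ε)
      = convexHull ℝ (Set.range (wcheckR r k)) ∧
    (∀ ε ε' : Fin r → Bool, ε ≠ (fun _ => false) → ε' ≠ (fun _ => false) → ε ≠ ε' →
      intrinsicInterior ℝ (sEps r k ε) ∩ intrinsicInterior ℝ (sEps r k ε') = ∅) := by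
  have : NeZero r := ⟨by omega⟩
  refine ⟨fun ε hε => (linearIndependent_pEps hr hk hε).affineIndependent, ?_, ?_⟩
  · ext x
    simp only [Set.mem_iUnion, exists_prop]
    exact ⟨fun ⟨ε, _, hx⟩ => sEps_subset hr hk ε hx, fun hx => exists_mem_sEps hr hk hx⟩
  · intro ε ε' hε hε' hne
    rw [Set.eq_empty_iff_forall_notMem]
    rintro x ⟨hx, hx'⟩
    obtain ⟨d, hd, h0, hiff⟩ := exists_eq_max_of_mem_intrinsicInterior_sEps hr hk hε hx
    obtain ⟨d', hd', h0', hiff'⟩ := exists_eq_max_of_mem_intrinsicInterior_sEps hr hk hε' hx'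
    obtain rfl := eq_of_eq_max_of_eq_zero (Nat.cast_nonneg k) hd hd' h0 h0'
    exact hne (funext fun i => Bool.eq_iff_iff.2 ((hiff i).trans (hiff' i).symm))
end

section
/- Fix integers r ≥ 2 and k ≥ 2. With w̌_1 = −e_1 + k·e_r, w̌_j = −e_j + k·e_{j−1} (2 ≤ j ≤ r), u_j = (k−1)·e_j, and s(ε) = conv{p_1(ε),…,p_r(ε)} for ε ∈ {0,1}^r (where p_j(ε) = u_j if ε_j = 1 and p_j(ε) = w̌_j if ε_j = 0), the triangulation 𝔗(r;k) = {s(ε) : ε ≠ 0} of 𝔰̆ = conv{w̌_1,…,w̌_r} is coherent: there exists a function ψ : ℝ^r → ℝ that is concave on 𝔰̆, such that for every ε ∈ {0,1}^r \ {(0,…,0)} ψ agrees on s(ε) with some affine function, and such that for any two distinct ε, ε' ∈ {0,1}^r \ {(0,…,0)} there is no single affine function agreeing with ψ on all of s(ε) ∪ s(ε'). -/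
/-- The points `u_j`, `u_{j-1}` and `w̌_j` are collinear. -/
theorem wcheckR_eq_lineMap {r k : ℕ} [NeZero r] (hr : 2 ≤ r) (hk : 2 ≤ k) (j : Fin r) :
    wcheckR r k j =
      AffineMap.lineMap (uVec r k j) (uVec r k (j - 1)) ((k : ℝ) / ((k : ℝ) - 1)) := by
  have hk' : (2 : ℝ) ≤ k := by exact_mod_cast hk
  have hk0 : (k : ℝ) - 1 ≠ 0 := by linarith
  have hv : ((j - 1 : Fin r) : ℕ) = ((j : ℕ) + r - 1) % r := by
    rw [Fin.val_sub, Fin.val_one', Nat.mod_eq_of_lt (by omega : 1 < r)]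
    congr 1
    omega
  ext i
  have hi : (i : ℕ) = ((j : ℕ) + r - 1) % r ↔ i = j - 1 := by rw [← hv, Fin.ext_iff]
  simp only [wcheckR, hi, uVec, AffineMap.lineMap_apply_module, Pi.add_apply, Pi.smul_apply,
    smul_eq_mul]
  split_ifs <;> field_simp <;> ring

theorem affineMap_wcheckR {r k : ℕ} [NeZero r] (hr : 2 ≤ r) (hk : 2 ≤ k) (j : Fin r)
    (A : (Fin r → ℝ) →ᵃ[ℝ] ℝ) :
    ((k : ℝ) - 1) * A (wcheckR r k j) = k * A (uVec r k (j - 1)) - A (uVec r k j) := by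
  have hk' : (2 : ℝ) ≤ k := by exact_mod_cast hk
  have hk0 : (k : ℝ) - 1 ≠ 0 := by linarith
  rw [wcheckR_eq_lineMap hr hk, AffineMap.apply_lineMap, AffineMap.lineMap_apply_module]
  simp only [smul_eq_mul]
  field_simp
  ring

theorem exists_apply_sub_ofNat {r : ℕ} [NeZero r] {ε : Fin r → Bool}
    (hε : ε ≠ fun _ => false) (j : Fin r) : ∃ n : ℕ, ε (j - Fin.ofNat r n) = true := by
  obtain ⟨i, hi⟩ := Function.ne_iff.mp hε
  refine ⟨(j - i : Fin r), ?_⟩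
  rw [Fin.ofNat_val_eq_self, sub_sub_cancel]
  simpa using hi

theorem sub_ofNat_succ {r : ℕ} [NeZero r] (j : Fin r) (n : ℕ) :
    j - Fin.ofNat r (n + 1) = j - 1 - Fin.ofNat r n := by
  rw [sub_sub]
  congr 1
  ext
  simp [Fin.val_add, add_comm]

/-- The values at the `u_j` of the linear function that is `1` at the vertices `u_j` of `s(ε)` and
`0` at its vertices `w̌_j`. -/
theorem exists_heights {r k : ℕ} [NeZero r] (hk : 2 ≤ k) {ε : Fin r → Bool}
    (hε : ε ≠ fun _ => false) :
    ∃ z : Fin r → ℝ, (∀ j, 1 ≤ z j) ∧ (∀ j, z j ≤ k * z (j - 1)) ∧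
      (∀ j, ε j = true → z j = 1) ∧ (∀ j, ε j = false → z j = k * z (j - 1)) := by
  have hk' : (2 : ℝ) ≤ k := by exact_mod_cast hk
  have hz : ∀ j : Fin r,
      1 ≤ (k : ℝ) ^ Nat.find (exists_apply_sub_ofNat hε j) := fun j =>
    one_le_pow₀ (by linarith)
  have hone : ∀ j, ε j = true → (k : ℝ) ^ Nat.find (exists_apply_sub_ofNat hε j) = 1 := by
    intro j hj
    have : Nat.find (exists_apply_sub_ofNat hε j) = 0 := by
      rw [Nat.find_eq_zero]
      simpa using hj
    rw [this, pow_zero]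
  have hstep : ∀ j, ε j = false → (k : ℝ) ^ Nat.find (exists_apply_sub_ofNat hε j) =
      k * (k : ℝ) ^ Nat.find (exists_apply_sub_ofNat hε (j - 1)) := by
    intro j hj
    have : Nat.find (exists_apply_sub_ofNat hε j) =
        Nat.find (exists_apply_sub_ofNat hε (j - 1)) + 1 := by
      have h : ∃ n : ℕ, ε (j - Fin.ofNat r (n + 1)) = true := by
        simpa only [sub_ofNat_succ] using exists_apply_sub_ofNat hε (j - 1)
      refine (Nat.find_comp_succ _ h (by simpa using hj)).trans ?_
      simp only [sub_ofNat_succ]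
    rw [this, pow_succ']
  refine ⟨fun j => (k : ℝ) ^ Nat.find (exists_apply_sub_ofNat hε j), hz, fun j => ?_, hone,
    hstep⟩
  cases hj : ε j
  · exact (hstep j hj).le
  · have h1 := hone j hj
    have h2 := hz (j - 1)
    simp only [h1]
    nlinarith

/-- A cyclic sequence equal to `1` where `ε` holds and multiplied by `k` at every other step
determines `ε`. -/
theorem apply_eq_true_iff_of_heights {r k : ℕ} [NeZero r] (hk : 2 ≤ k) {ε : Fin r → Bool}
    (hε : ε ≠ fun _ => false) {v : Fin r → ℝ} (h1 : ∀ j, ε j = true → v j = 1)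
    (h0 : ∀ j, ε j = false → v j = k * v (j - 1)) (j : Fin r) : ε j = true ↔ v j = 1 := by
  have hk' : (2 : ℝ) ≤ k := by exact_mod_cast hk
  have key : ∀ (n : ℕ) (j : Fin r), ε (j - Fin.ofNat r n) = true → 1 ≤ v j := by
    intro n
    induction n with
    | zero => intro j hj; exact (h1 j (by simpa using hj)).ge
    | succ n ih =>
      intro j hj
      cases hc : ε j
      · have := ih (j - 1) (by rwa [sub_ofNat_succ] at hj)
        rw [h0 j hc]
        nlinarith
      · exact (h1 j hc).ge
  refine ⟨h1 j, fun hj => ?_⟩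
  by_contra hc
  obtain ⟨n, hn⟩ := exists_apply_sub_ofNat hε (j - 1)
  have h := key n (j - 1) hn
  have h' := h0 j (by simpa using hc)
  nlinarith

theorem le_of_mem_sEps {r k : ℕ} {ε : Fin r → Bool} {f g : (Fin r → ℝ) →ₗ[ℝ] ℝ}
    (h : ∀ j, f (pEps r k ε j) ≤ g (pEps r k ε j)) {x : Fin r → ℝ} (hx : x ∈ sEps r k ε) :
    f x ≤ g x := by
  have hc : Convex ℝ {x | (f - g) x ≤ 0} := convex_halfSpace_le (f - g).isLinear 0
  have hs : Set.range (pEps r k ε) ⊆ {x | (f - g) x ≤ 0} := by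
    rintro _ ⟨j, rfl⟩
    simpa using h j
  simpa using convexHull_min hs hc hx

theorem exists_support_function {r k : ℕ} [NeZero r] (hr : 2 ≤ r) (hk : 2 ≤ k)
    {ε : Fin r → Bool} (hε : ε ≠ fun _ => false) :
    ∃ L : (Fin r → ℝ) →ₗ[ℝ] ℝ, (∀ j, 1 ≤ L (uVec r k j)) ∧ (∀ j, 0 ≤ L (wcheckR r k j)) ∧
      ∀ j, L (pEps r k ε j) = if ε j then 1 else 0 := by
  have hk' : (2 : ℝ) ≤ k := by exact_mod_cast hk
  have hk0 : 0 < (k : ℝ) - 1 := by linarith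
  obtain ⟨z, hz1, hzk, h1, h0⟩ := exists_heights (k := k) hk hε
  let L : (Fin r → ℝ) →ₗ[ℝ] ℝ := ((k : ℝ) - 1)⁻¹ • ∑ i, z i • LinearMap.proj i
  have hu : ∀ j, L (uVec r k j) = z j := by
    intro j
    simp [L, uVec, LinearMap.sum_apply]
    field_simp
  have hw : ∀ j, ((k : ℝ) - 1) * L (wcheckR r k j) = k * z (j - 1) - z j := by
    intro j
    simpa [hu] using affineMap_wcheckR hr hk j L.toAffineMap
  refine ⟨L, fun j => (hz1 j).trans_eq (hu j).symm, fun j => ?_, fun j => ?_⟩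
  · refine nonneg_of_mul_nonneg_right ?_ hk0
    rw [hw]
    linarith [hzk j]
  · cases hj : ε j
    · have h := hw j
      rw [← h0 j hj, sub_self] at h
      simpa [pEps, hj] using (mul_eq_zero.mp h).resolve_left hk0.ne'
    · simpa [pEps, hj, hu] using h1 j hj

theorem concaveOn_finset_inf' {ι E : Type*} [AddCommGroup E] [Module ℝ E] {s : Set E}
    (hs : Convex ℝ s) {t : Finset ι} (ht : t.Nonempty) (L : ι → E →ₗ[ℝ] ℝ) :
    ConcaveOn ℝ s fun x => t.inf' ht fun i => L i x := by
  refine ⟨hs, fun x _ y _ a b ha hb _ => Finset.le_inf' _ _ fun i hi => ?_⟩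
  simp only [map_add, map_smul]
  gcongr
  · exact Finset.inf'_le _ hi
  · exact Finset.inf'_le _ hi

/-- **Corollary 8.7.** The triangulation `𝔗(r;k) = {s(ε) : ε ≠ 0}` of the simplex
`𝔰̆ = conv{w̌_1,…,w̌_r}` is coherent: there is a strictly upper convex support
function, i.e. a function `ψ` concave on `𝔰̆`, affine on each simplex `s(ε)`,
but not affine on the union of any two distinct such simplices. -/
theorem triangulation_T_r_k_coherent (r k : ℕ) (hr : 2 ≤ r) (hk : 2 ≤ k) :
    ∃ ψ : (Fin r → ℝ) → ℝ,
      ConcaveOn ℝ (convexHull ℝ (Set.range (wcheckR r k))) ψ ∧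
      (∀ ε : Fin r → Bool, ε ≠ (fun _ => false) →
        ∃ A : (Fin r → ℝ) →ᵃ[ℝ] ℝ, ∀ x ∈ sEps r k ε, ψ x = A x) ∧
      (∀ ε ε' : Fin r → Bool, ε ≠ (fun _ => false) → ε' ≠ (fun _ => false) → ε ≠ ε' →
        ¬ ∃ A : (Fin r → ℝ) →ᵃ[ℝ] ℝ, ∀ x ∈ sEps r k ε ∪ sEps r k ε', ψ x = A x) := by
  classical
  have : NeZero r := ⟨by omega⟩
  have hsupp : ∀ ε : {ε : Fin r → Bool // ε ≠ fun _ => false}, _ := fun ε =>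
    exists_support_function hr hk ε.2
  choose L hLu hLw hLp using hsupp
  have hne : (Finset.univ : Finset {ε : Fin r → Bool // ε ≠ fun _ => false}).Nonempty :=
    ⟨⟨fun _ => true, fun h => by simpa using congrFun h 0⟩, Finset.mem_univ _⟩
  let ψ : (Fin r → ℝ) → ℝ := fun x => Finset.univ.inf' hne fun ε => L ε x
  have hψ : ∀ ε, ∀ x ∈ sEps r k ε.1, ψ x = L ε x := by
    intro ε x hx
    refine le_antisymm (Finset.inf'_le _ (Finset.mem_univ ε)) (Finset.le_inf' _ _ fun ε' _ => ?_)
    refine le_of_mem_sEps (fun j => ?_) hx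
    rw [hLp]
    cases hj : ε.1 j
    · simpa [pEps, hj] using hLw ε' j
    · simpa [pEps, hj] using hLu ε' j
  have hdet : ∀ (ε : {ε : Fin r → Bool // ε ≠ fun _ => false}) (A : (Fin r → ℝ) →ᵃ[ℝ] ℝ),
      (∀ x ∈ sEps r k ε.1, ψ x = A x) → ∀ j, ε.1 j = true ↔ A (uVec r k j) = 1 := by
    intro ε A hA
    have hp : ∀ j, A (pEps r k ε.1 j) = if ε.1 j then 1 else 0 := by
      intro j
      have hm : pEps r k ε.1 j ∈ sEps r k ε.1 := subset_convexHull ℝ _ ⟨j, rfl⟩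
      rw [← hA _ hm, hψ ε _ hm, hLp]
    refine apply_eq_true_iff_of_heights hk ε.2 (v := fun j => A (uVec r k j))
      (fun j hj => ?_) fun j hj => ?_
    · simpa [pEps, hj] using hp j
    · have h := hp j
      have hw := affineMap_wcheckR hr hk j A
      simp only [pEps, hj, Bool.false_eq_true, if_false] at h
      rw [h, mul_zero] at hw
      linarith
  refine ⟨ψ, concaveOn_finset_inf' (convex_convexHull ℝ _) hne L,
    fun ε hε => ⟨(L ⟨ε, hε⟩).toAffineMap, hψ ⟨ε, hε⟩⟩, ?_⟩
  rintro ε ε' hε hε' hdiff ⟨A, hA⟩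
  refine hdiff (funext fun j => Bool.eq_iff_iff.mpr ?_)
  exact (hdet ⟨ε, hε⟩ A (fun x hx => hA x (Or.inl hx)) j).trans
    (hdet ⟨ε', hε'⟩ A (fun x hx => hA x (Or.inr hx)) j).symm
end
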